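/- Let (R,m) be a Noetherian local ring that is a homomorphic image of a Gorenstein ring, and let M be a finitely generated R-module with r = dim_R M ≥ 2 and Ass_R M = Assh_R M. For an integer q ≥ 1 let Λ_q(M) be the set of values e_1(Q,M), where Q runs over the parameter ideals Q ⊆ m^q for M which are generated by a system of parameters x_1,…,x_r forming a d-sequence for M. Assume Λ_q(M) is a finite set for some q ≥ 1 and put ℓ = −min Λ_q(M). Then m^ℓ H^i_m(M) = (0) for all i ≠ r; in particular, all the local cohomology modules H^i_m(M) with 0 ≤ i < r are finitely generated. -/

import Mathlib

open IsLocalRing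

section Defs

variable (R : Type) [CommRing R]

/-- The length of a module, as the Krull dimension of its lattice of submodules. -/
noncomputable def mLength (M : Type) [AddCommGroup M] [Module R M] : WithBot ℕ∞ :=
  Order.krullDim (Submodule R M)

/-- The (Krull) dimension of a module. -/
noncomputable def mDim (M : Type) [AddCommGroup M] [Module R M] : WithBot ℕ∞ :=
  ringKrullDim (R ⧸ Submodule.annihilator (⊤ : Submodule R M))

/-- `f` is eventually given by the Hilbert-type polynomial of degree `t` with
coefficients `s 0, …, s t` (written in the binomial basis with alternating signs). -/
def IsHilbPolyAt (f : ℕ → WithBot ℕ∞) (t : ℕ) (s : ℕ → ℤ) : Prop :=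
  ∃ N : ℕ, ∀ n ≥ N, ∃ l : ℕ, f n = (l : ℕ∞) ∧
    (l : ℤ) = ∑ i ∈ Finset.range (t + 1), (-1 : ℤ) ^ i * s i * ((n + t - i).choose (t - i) : ℤ)

/-- `s 0, …, s t` are the Hilbert coefficients `e_i(I, M)`, i.e.
`λ(M/I^{n+1}M) = ∑ (-1)^i e_i(I,M) C(n+t-i, t-i)` for `n ≫ 0`. -/
def HasHilbCoeffs (I : Ideal R) (M : Type) [AddCommGroup M] [Module R M]
    (t : ℕ) (s : ℕ → ℤ) : Prop :=
  IsHilbPolyAt (fun n => mLength R (M ⧸ (I ^ (n + 1) • (⊤ : Submodule R M)))) t s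

/-- The unmixed component `U_M(0)` of `M`: the largest submodule of dimension `< dim M`. -/
noncomputable def unmixedComp (M : Type) [AddCommGroup M] [Module R M] : Submodule R M :=
  sSup {N : Submodule R M | mDim R ↥N < mDim R M}

/-- `x` is a d-sequence on `M`. -/
def IsDSeq {r : ℕ} (x : Fin r → R) (M : Type) [AddCommGroup M] [Module R M] : Prop :=
  ∀ i j : Fin r, i ≤ j →
    Submodule.comap (LinearMap.lsmul R M (x i * x j))
        (Ideal.span (x '' {k | k < i}) • (⊤ : Submodule R M))
      = Submodule.comap (LinearMap.lsmul R M (x j))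
        (Ideal.span (x '' {k | k < i}) • (⊤ : Submodule R M))

/-- `x` is a standard (d⁺-) system: all power sequences in any order are d-sequences. -/
def IsStandardSeq {r : ℕ} (x : Fin r → R) (M : Type) [AddCommGroup M] [Module R M] : Prop :=
  ∀ n : Fin r → ℕ, (∀ k, 1 ≤ n k) → ∀ σ : Equiv.Perm (Fin r),
    IsDSeq R (fun k => x (σ k) ^ n (σ k)) M

/-- The integral closure of an ideal, as a set. -/
def intClos (Q : Ideal R) : Set R :=
  {x : R | ∃ n : ℕ, 0 < n ∧ ∃ a : ℕ → R, (∀ i, 1 ≤ i → i ≤ n → a i ∈ Q ^ i) ∧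
    x ^ n + ∑ i ∈ Finset.Icc 1 n, a i * x ^ (n - i) = 0}

variable [IsLocalRing R]

/-- `h ∈ I` is superficial for `M` with respect to `I`. -/
def IsSuperficial (I : Ideal R) (M : Type) [AddCommGroup M] [Module R M] (h : R) : Prop :=
  h ∈ I ∧ ∃ c N : ℕ, ∀ n ≥ N,
    Submodule.comap (LinearMap.lsmul R M h) (I ^ (n + 1) • (⊤ : Submodule R M))
        ⊓ (I ^ c • (⊤ : Submodule R M))
      = I ^ n • (⊤ : Submodule R M)

/-- `Q` is a parameter ideal for `M` (`r` the dimension of `M`):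
generated by `r` elements of the maximal ideal with `M/QM` of finite length. -/
def IsParamIdeal (Q : Ideal R) (M : Type) [AddCommGroup M] [Module R M] (r : ℕ) : Prop :=
  Q ≤ maximalIdeal R ∧ (∃ x : Fin r → R, Q = Ideal.span (Set.range x)) ∧
    IsFiniteLength R (M ⧸ Q • (⊤ : Submodule R M))

/-- Local cohomology `H^i_𝔪(M)` with support in the maximal ideal. -/
noncomputable def LC (i : ℕ) (M : Type) [AddCommGroup M] [Module R M] : ModuleCat R :=
  (localCohomology (maximalIdeal R) i).obj (ModuleCat.of R M)

/-- `M` is Cohen–Macaulay: there is a regular sequence on `M` in the maximal ideal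
whose length equals `dim M`. -/
def IsCM (M : Type) [AddCommGroup M] [Module R M] : Prop :=
  ∃ rs : List R, (∀ x ∈ rs, x ∈ maximalIdeal R) ∧ RingTheory.Sequence.IsRegular M rs ∧
    (rs.length : WithBot ℕ∞) = mDim R M

/-- `M` is unmixed: `dim R̂/p = dim M` for every associated prime `p` of the completion `M̂`. -/
def IsUnmixed (M : Type) [AddCommGroup M] [Module R M] : Prop :=
  ∀ p ∈ associatedPrimes (AdicCompletion (maximalIdeal R) R)
      (AdicCompletion (maximalIdeal R) M),
    ringKrullDim ((AdicCompletion (maximalIdeal R) R) ⧸ p) = mDim R M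

/-- `M` is generalized Cohen–Macaulay: `H^i_𝔪(M)` has finite length for `i < r = dim M`. -/
def IsGenCM (M : Type) [AddCommGroup M] [Module R M] (r : ℕ) : Prop :=
  ∀ i < r, IsFiniteLength R ↥(LC R i M)

/-- The set `Λ(M)` of first Hilbert coefficients of parameter ideals for `M`. -/
def Lambda (M : Type) [AddCommGroup M] [Module R M] (r : ℕ) : Set ℤ :=
  {a : ℤ | ∃ (Q : Ideal R) (e : ℕ → ℤ),
    IsParamIdeal R Q M r ∧ HasHilbCoeffs R Q M r e ∧ e 1 = a}

/-- A standard parameter ideal: one generated by a standard system of parameters. -/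
def IsStandardParamIdeal (Q : Ideal R) (M : Type) [AddCommGroup M] [Module R M]
    (r : ℕ) : Prop :=
  IsParamIdeal R Q M r ∧ ∃ x : Fin r → R, Q = Ideal.span (Set.range x) ∧
    IsStandardSeq R x M

/-- `M` is Buchsbaum: every parameter ideal for `M` is standard. -/
def IsBuchsbaum (M : Type) [AddCommGroup M] [Module R M] (r : ℕ) : Prop :=
  ∀ Q : Ideal R, IsParamIdeal R Q M r → IsStandardParamIdeal R Q M r

/-- `M` is a Vasconcelos module. -/
def IsVasconcelos (M : Type) [AddCommGroup M] [Module R M] : Prop :=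
  mDim R M ≤ 0 ∨ (0 < mDim R M ∧ ∃ (r : ℕ) (Q : Ideal R) (e : ℕ → ℤ),
    mDim R M = (r : ℕ∞) ∧ IsParamIdeal R Q M r ∧ HasHilbCoeffs R Q M r e ∧ e 1 = 0)

/-- A Gorenstein local ring: Noetherian, Cohen–Macaulay, with an irreducible parameter ideal. -/
def IsGorensteinLocalRing : Prop :=
  IsNoetherianRing R ∧ IsCM R R ∧ ∃ (r : ℕ) (Q : Ideal R),
    mDim R R = (r : ℕ∞) ∧ IsParamIdeal R Q R r ∧
    ∀ I J : Ideal R, Q = I ⊓ J → Q = I ∨ Q = J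

/-- `E` is an injective envelope of the residue field `R/𝔪`. -/
def IsInjEnvResidue (E : Type) [AddCommGroup E] [Module R E] : Prop :=
  Module.Injective R E ∧ ∃ ι : (R ⧸ maximalIdeal R) →ₗ[R] E, Function.Injective ι ∧
    ∀ N : Submodule R E, N ⊓ LinearMap.range ι = ⊥ → N = ⊥

end Defs

/-- A (not necessarily local) Cohen–Macaulay ring: Noetherian,
with all localizations at primes Cohen–Macaulay. -/
def IsCMRing (S : Type) [CommRing S] : Prop :=
  IsNoetherianRing S ∧ ∀ (p : Ideal S) [p.IsPrime],
    IsCM (Localization.AtPrime p) (Localization.AtPrime p)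

/-- A (not necessarily local) Gorenstein ring. -/
def IsGorensteinRing (S : Type) [CommRing S] : Prop :=
  IsNoetherianRing S ∧ ∀ (p : Ideal S) [p.IsPrime],
    IsGorensteinLocalRing (Localization.AtPrime p)

/-- `HDegRel R I E M v` : `v` is the homological degree `hdeg_I(M)` computed
with Matlis duals taken relative to `E`. -/
inductive HDegRel (R : Type) [CommRing R] [IsLocalRing R] (I : Ideal R)
    (E : Type) [AddCommGroup E] [Module R E] : ModuleCat R → ℕ → Prop where
  | base : ∀ (M : ModuleCat R) (l : ℕ), mDim R M ≤ 0 → mLength R M = (l : ℕ∞) →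
      HDegRel R I E M l
  | step : ∀ (M : ModuleCat R) (r : ℕ), mDim R M = (r : ℕ∞) → 0 < r →
      ∀ (e : ℕ → ℤ) (e0 : ℕ), HasHilbCoeffs R I M r e → e 0 = (e0 : ℤ) →
      ∀ v : ℕ → ℕ,
        (∀ j < r, HDegRel R I E (ModuleCat.of R ((LC R j M) →ₗ[R] E)) (v j)) →
      HDegRel R I E M (e0 + ∑ j ∈ Finset.range r, (r - 1).choose j * v j)


noncomputable section
open CategoryTheory Limits Opposite
universe u
variable {R : Type u} [CommRing R]

namespace HomologicalComplex
variable {V : Type*} [Category V] [HasZeroMorphisms V] {ι : Type*} {c : ComplexShape ι}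

theorem homologyUnop_hom_naturality {K L : HomologicalComplex Vᵒᵖ c} (φ : K ⟶ L) (i : ι)
    [K.HasHomology i] [L.HasHomology i] :
    homologyMap ((unopFunctor _ _).map φ.op) i ≫ (homologyUnop K i).hom =
      (homologyUnop L i).hom ≫ (homologyMap φ i).unop := by
  have h := homologyOp_hom_naturality (K := L.unop) (L := K.unop) ((unopFunctor _ _).map φ.op) i
  have h2 := congrArg Quiver.Hom.unop h
  exact h2.symm

end HomologicalComplex
namespace CategoryTheory.ProjectiveResolution
variable {X X' : ModuleCat.{u} R}

theorem trans_symm_hom_naturality {C : Type*} [Category C] {A A' B B' D D' : C} {a : A ⟶ A'}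
    {b : B ⟶ B'} {d : D ⟶ D'} {i : A ≅ B} {i' : A' ≅ B'} {k : D ≅ B} {k' : D' ≅ B'}
    (h : a ≫ i'.hom = i.hom ≫ b) (h' : d ≫ k'.hom = k.hom ≫ b) :
    a ≫ (i' ≪≫ k'.symm).hom = (i ≪≫ k.symm).hom ≫ d := by
  simp only [Iso.trans_hom, Iso.symm_hom, Category.assoc]
  have h2 : b ≫ k'.inv = k.inv ≫ d := by
    rw [Iso.comp_inv_eq, Category.assoc, h', Iso.inv_hom_id_assoc]
  rw [← h2, reassoc_of% h]

theorem isoExt_hom_naturality_left (P : ProjectiveResolution X) (P' : ProjectiveResolution X')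
    (f : X ⟶ X') (g : P.complex ⟶ P'.complex) (comm : g.f 0 ≫ P'.π.f 0 = P.π.f 0 ≫ f)
    (n : ℕ) (Y : ModuleCat.{u} R) :
    ((Ext R (ModuleCat.{u} R) n).map f.op).app Y ≫ (P.isoExt n Y).hom =
      (P'.isoExt n Y).hom ≫ HomologicalComplex.homologyMap
        ((HomologicalComplex.unopFunctor _ _).map
          ((((linearYoneda R (ModuleCat.{u} R)).obj Y).rightOp.mapHomologicalComplex _).map g).op)
        n := by
  have h1 := isoLeftDerivedObj_inv_naturality f P P' g comm
    ((linearYoneda R (ModuleCat.{u} R)).obj Y).rightOp n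
  have h2 := HomologicalComplex.homologyUnop_hom_naturality
    ((((linearYoneda R (ModuleCat.{u} R)).obj Y).rightOp.mapHomologicalComplex _).map g) n
  have h3 := congrArg Quiver.Hom.unop h1
  exact trans_symm_hom_naturality h3 h2

theorem isoExt_hom_naturality_right (P : ProjectiveResolution X)
    (n : ℕ) {Y Y' : ModuleCat.{u} R} (h : Y ⟶ Y') :
    ((Ext R (ModuleCat.{u} R) n).obj (op X)).map h ≫ (P.isoExt n Y').hom =
      (P.isoExt n Y).hom ≫ HomologicalComplex.homologyMap
        ((HomologicalComplex.unopFunctor _ _).map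
          ((NatTrans.mapHomologicalComplex
            (NatTrans.rightOp ((linearYoneda R (ModuleCat.{u} R)).map h)) _).app P.complex).op)
        n := by
  have h1 := leftDerived_app_eq (NatTrans.rightOp ((linearYoneda R (ModuleCat.{u} R)).map h)) P n
  have h2 := HomologicalComplex.homologyUnop_hom_naturality
    ((NatTrans.mapHomologicalComplex
            (NatTrans.rightOp ((linearYoneda R (ModuleCat.{u} R)).map h)) _).app P.complex) n
  exact trans_symm_hom_naturality
    (congrArg Quiver.Hom.unop ((Iso.inv_comp_eq _).2 h1)) h2
end CategoryTheory.ProjectiveResolution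

end

noncomputable section
open CategoryTheory Limits Opposite
universe u
variable {R : Type u} [CommRing R]

namespace HomologicalComplex
variable {ι : Type*} {c : ComplexShape ι} (K : HomologicalComplex (ModuleCat.{u} R) c)

theorem exists_cycles_iff (i j : ι) (hj : c.next i = j) (x : K.X i) :
    (∃ z : K.cycles i, (K.iCycles i).hom z = x) ↔ (K.d i j).hom x = 0 := by
  constructor
  · rintro ⟨z, rfl⟩
    rw [← ModuleCat.comp_apply, iCycles_d]; rfl
  · intro h
    have := ShortComplex.exact_of_f_is_kernel (ShortComplex.mk (K.iCycles i) (K.d i j) (K.iCycles_d i j))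
      (K.cyclesIsKernel i j hj)
    exact (ShortComplex.moduleCat_exact_iff _).1 this x h

theorem homologyπ_eq_zero_iff (i : ι) (z : K.cycles i) :
    (K.homologyπ i).hom z = 0 ↔ ∃ j, ∃ y : K.X j, (K.d j i).hom y = (K.iCycles i).hom z := by
  constructor
  · intro h
    have := ShortComplex.exact_of_g_is_cokernel
      (ShortComplex.mk _ _ (K.toCycles_comp_homologyπ (c.prev i) i))
      (K.homologyIsCokernel _ i rfl)
    obtain ⟨y, rfl⟩ := (ShortComplex.moduleCat_exact_iff _).1 this z h
    refine ⟨_, y, ?_⟩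
    erw [← ModuleCat.comp_apply]
    rw [toCycles_i]
  · rintro ⟨j, y, h⟩
    have : z = (K.toCycles j i).hom y := by
      apply (ModuleCat.mono_iff_injective (K.iCycles i)).1 inferInstance
      erw [← h, ← ModuleCat.comp_apply]
      rw [toCycles_i]
    rw [this, ← ModuleCat.comp_apply, toCycles_comp_homologyπ]; rfl

end HomologicalComplex

namespace CategoryTheory.ProjectiveResolution
variable {X X' : ModuleCat.{u} R}

/-- The cocycle `φ` represents the class `z` in `Ext^n(X, Y)`. -/
def ExtRep (P : ProjectiveResolution X) (n : ℕ) {Y : ModuleCat.{u} R} (φ : P.complex.X n ⟶ Y)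
    (z : ((Ext R (ModuleCat.{u} R) n).obj (op X)).obj Y) : Prop :=
  ∃ c : (P.complex.linearYonedaObj R Y).cycles n,
    ((P.complex.linearYonedaObj R Y).iCycles n).hom c = φ ∧
    ((P.complex.linearYonedaObj R Y).homologyπ n).hom c = (P.isoExt n Y).hom.hom z

variable (P : ProjectiveResolution X) {n : ℕ} {Y : ModuleCat.{u} R}

theorem exists_extRep (z : ((Ext R (ModuleCat.{u} R) n).obj (op X)).obj Y) :
    ∃ φ, P.ExtRep n φ z := by
  obtain ⟨c, hc⟩ := (ModuleCat.epi_iff_surjective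
    ((P.complex.linearYonedaObj R Y).homologyπ n)).1 inferInstance ((P.isoExt n Y).hom.hom z)
  exact ⟨_, c, rfl, hc⟩

theorem exists_extRep_iff (φ : P.complex.X n ⟶ Y) :
    (∃ z, P.ExtRep n φ z) ↔ P.complex.d (n + 1) n ≫ φ = 0 := by
  refine Iff.trans ?_ ((P.complex.linearYonedaObj R Y).exists_cycles_iff n (n + 1) (by simp) φ)
  constructor
  · rintro ⟨z, c, h, -⟩
    exact ⟨c, h⟩
  · rintro ⟨c, h⟩
    refine ⟨(P.isoExt n Y).inv.hom (((P.complex.linearYonedaObj R Y).homologyπ n).hom c), c, h, ?_⟩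
    exact (congrArg (fun k => ModuleCat.Hom.hom k
      (((P.complex.linearYonedaObj R Y).homologyπ n).hom c)) (P.isoExt n Y).inv_hom_id).symm

variable {P}

theorem ExtRep.add {φ ψ : P.complex.X n ⟶ Y} {z w} (h : P.ExtRep n φ z) (h' : P.ExtRep n ψ w) :
    P.ExtRep n (φ + ψ) (z + w) := by
  obtain ⟨c, rfl, h2⟩ := h
  obtain ⟨d, rfl, h2'⟩ := h'
  exact ⟨c + d, map_add _ _ _, by rw [map_add, map_add, h2, h2']⟩

theorem ExtRep.smul (a : R) {φ : P.complex.X n ⟶ Y} {z} (h : P.ExtRep n φ z)  :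
    P.ExtRep n (a • φ) (a • z) := by
  obtain ⟨c, rfl, h2⟩ := h
  exact ⟨a • c, map_smul _ _ _, by rw [map_smul, map_smul, h2]⟩

theorem extRep_zero_iff {φ : P.complex.X n ⟶ Y} :
    P.ExtRep n φ 0 ↔ ∃ j, ∃ η : P.complex.X j ⟶ Y, φ = P.complex.d n j ≫ η := by
  constructor
  · rintro ⟨c, rfl, h⟩
    rw [map_zero, HomologicalComplex.homologyπ_eq_zero_iff] at h
    obtain ⟨j, y, h⟩ := h
    exact ⟨j, y, h.symm⟩
  · rintro ⟨j, η, rfl⟩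
    obtain ⟨c, hc⟩ := ((P.complex.linearYonedaObj R Y).exists_cycles_iff n (n + 1) (by simp)
      (P.complex.d n j ≫ η)).2 (by
        change P.complex.d (n + 1) n ≫ P.complex.d n j ≫ η = 0
        simp)
    refine ⟨c, hc, ?_⟩
    rw [map_zero, HomologicalComplex.homologyπ_eq_zero_iff, hc]
    exact ⟨j, η, rfl⟩

theorem ExtRep.map_left {P : ProjectiveResolution X} {P' : ProjectiveResolution X'}
    {f : X ⟶ X'} {g : P.complex ⟶ P'.complex} (comm : g.f 0 ≫ P'.π.f 0 = P.π.f 0 ≫ f)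
    {φ : P'.complex.X n ⟶ Y} {z} (h : P'.ExtRep n φ z) :
    P.ExtRep n (g.f n ≫ φ) ((((Ext R (ModuleCat.{u} R) n).map f.op).app Y).hom z) := by
  obtain ⟨c, rfl, h2⟩ := h
  have h3 := congrArg (fun k => k.hom z) (isoExt_hom_naturality_left P P' f g comm n Y)
  let m := ((HomologicalComplex.unopFunctor _ _).map
          ((((linearYoneda R (ModuleCat.{u} R)).obj Y).rightOp.mapHomologicalComplex _).map g).op)
  refine ⟨(HomologicalComplex.cyclesMap m n).hom c, ?_, ?_⟩
  · exact congrArg (fun k => k.hom c) (HomologicalComplex.cyclesMap_i m n)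
  · refine (congrArg (fun k => k.hom c) (HomologicalComplex.homologyπ_naturality m n)).symm.trans ?_
    refine Eq.trans ?_ h3.symm
    exact congrArg (HomologicalComplex.homologyMap m n).hom h2

theorem ExtRep.map_right {P : ProjectiveResolution X} {Y' : ModuleCat.{u} R} (h : Y ⟶ Y')
    {φ : P.complex.X n ⟶ Y} {z} (hz : P.ExtRep n φ z) :
    P.ExtRep n (φ ≫ h) ((((Ext R (ModuleCat.{u} R) n).obj (op X)).map h).hom z) := by
  obtain ⟨c, rfl, h2⟩ := hz
  have h3 := congrArg (fun k => k.hom z) (isoExt_hom_naturality_right P n h)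
  let m := ((HomologicalComplex.unopFunctor _ _).map
          ((NatTrans.mapHomologicalComplex
            (NatTrans.rightOp ((linearYoneda R (ModuleCat.{u} R)).map h)) _).app P.complex).op)
  refine ⟨(HomologicalComplex.cyclesMap m n).hom c, ?_, ?_⟩
  · exact congrArg (fun k => k.hom c) (HomologicalComplex.cyclesMap_i m n)
  · refine (congrArg (fun k => k.hom c) (HomologicalComplex.homologyπ_naturality m n)).symm.trans ?_
    refine Eq.trans ?_ h3.symm
    exact congrArg (HomologicalComplex.homologyMap m n).hom h2

end CategoryTheory.ProjectiveResolution

end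

noncomputable section
open CategoryTheory Limits Opposite

variable {R : Type} [CommRing R]

namespace localCohomology
variable (J : Ideal R)

/-- The chosen projective resolution of `R ⧸ J ^ t`. -/
def res (t : ℕ) : ProjectiveResolution
    ((ringModIdeals (idealPowersDiagram J)).obj (op t)) := projectiveResolution _

/-- A lift of the projection `R ⧸ J ^ t' → R ⧸ J ^ t` to the projective resolutions. -/
def resMap {t t' : ℕ} (h : t ≤ t') : (res J t').complex ⟶ (res J t).complex :=
  ProjectiveResolution.lift ((ringModIdeals (idealPowersDiagram J)).map (homOfLE h).op) _ _

/-- The comparison map from `Ext^i(R ⧸ J ^ t, M)` to the local cohomology of `M`. -/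
def ofExt (i t : ℕ) (M : ModuleCat.{0} R) :
    ((Ext R (ModuleCat.{0} R) i).obj (op ((ringModIdeals (idealPowersDiagram J)).obj (op t)))).obj M
      ⟶ (localCohomology J i).obj M :=
  (colimit.ι (diagram (idealPowersDiagram J) i) (op (op t))).app M

/-- The cocycle `φ` on the resolution of `R ⧸ J ^ t` represents the local cohomology class `z`. -/
def Rep {i : ℕ} {M : ModuleCat.{0} R} (t : ℕ) (φ : (res J t).complex.X i ⟶ M)
    (z : (localCohomology J i).obj M) : Prop :=
  ∃ e, (res J t).ExtRep i φ e ∧ (ofExt J i t M).hom e = z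

variable {i : ℕ} {M N : ModuleCat.{0} R}

/-- Local cohomology of `M` as a colimit of `Ext` modules. -/
def isColimit (i : ℕ) (M : ModuleCat.{0} R) :
    IsColimit (((evaluation _ _).obj M).mapCocone
      (colimit.cocone (diagram (idealPowersDiagram J) i))) :=
  isColimitOfPreserves _ (colimit.isColimit _)

variable {J}

theorem exists_rep (z : (localCohomology J i).obj M) : ∃ t φ, Rep J t φ z := by
  obtain ⟨t, e, he⟩ := Concrete.isColimit_exists_rep _ (isColimit J i M) z
  obtain ⟨φ, h⟩ := (res J t.unop.unop).exists_extRep e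
  exact ⟨t.unop.unop, φ, e, h, he⟩

theorem Rep.d_comp {t : ℕ} {φ : (res J t).complex.X i ⟶ M} {z} (h : Rep J t φ z) :
    (res J t).complex.d (i + 1) i ≫ φ = 0 := by
  obtain ⟨e, he, -⟩ := h
  exact ((res J t).exists_extRep_iff φ).1 ⟨e, he⟩

theorem exists_rep_of_d_comp {t : ℕ} {φ : (res J t).complex.X i ⟶ M}
    (h : (res J t).complex.d (i + 1) i ≫ φ = 0) : ∃ z, Rep J t φ z := by
  obtain ⟨e, he⟩ := ((res J t).exists_extRep_iff φ).2 h
  exact ⟨_, e, he, rfl⟩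

theorem Rep.add {t : ℕ} {φ ψ : (res J t).complex.X i ⟶ M} {z w} (h : Rep J t φ z)
    (h' : Rep J t ψ w) : Rep J t (φ + ψ) (z + w) := by
  obtain ⟨e, he, rfl⟩ := h
  obtain ⟨e', he', rfl⟩ := h'
  exact ⟨_, he.add he', map_add _ _ _⟩

theorem Rep.smul {t : ℕ} (a : R) {φ : (res J t).complex.X i ⟶ M} {z} (h : Rep J t φ z) :
    Rep J t (a • φ) (a • z) := by
  obtain ⟨e, he, rfl⟩ := h
  exact ⟨_, he.smul a, map_smul _ _ _⟩

theorem Rep.map {t : ℕ} {φ : (res J t).complex.X i ⟶ M} {z} (h : Rep J t φ z) (f : M ⟶ N) :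
    Rep J t (φ ≫ f) (((localCohomology J i).map f).hom z) := by
  obtain ⟨e, he, rfl⟩ := h
  refine ⟨_, he.map_right f, ?_⟩
  exact (congrArg (fun k => k.hom e)
    ((colimit.ι (diagram (idealPowersDiagram J) i) (op (op t))).naturality f))

theorem resMap_comm {t t' : ℕ} (ht : t ≤ t') :
    (resMap J ht).f 0 ≫ (res J t).π.f 0 = (res J t').π.f 0 ≫
      (ringModIdeals (idealPowersDiagram J)).map (homOfLE ht).op :=
  ProjectiveResolution.lift_commutes_zero _ _ _

theorem Rep.mono {t t' : ℕ} (ht : t ≤ t') {φ : (res J t).complex.X i ⟶ M} {z}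
    (h : Rep J t φ z) : Rep J t' ((resMap J ht).f i ≫ φ) z := by
  obtain ⟨e, he, rfl⟩ := h
  refine ⟨_, he.map_left (resMap_comm ht), ?_⟩
  exact congrArg (fun k => (k.app M).hom e)
    (colimit.w (diagram (idealPowersDiagram J) i) (homOfLE ht).op.op)

theorem Rep.of_boundary {t j : ℕ} (η : (res J t).complex.X j ⟶ M) :
    Rep J t ((res J t).complex.d i j ≫ η) (0 : (localCohomology J i).obj M) :=
  ⟨0, ProjectiveResolution.extRep_zero_iff.2 ⟨j, η, rfl⟩, map_zero _⟩

theorem Rep.exists_boundary {t : ℕ} {φ : (res J t).complex.X i ⟶ M} (h : Rep J t φ 0) :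
    ∃ (t' : ℕ) (ht : t ≤ t') (j : ℕ) (η : (res J t').complex.X j ⟶ M),
      (resMap J ht).f i ≫ φ = (res J t').complex.d i j ≫ η := by
  obtain ⟨e, he, h0⟩ := h
  have h1 : (ofExt J i t M).hom e = (ofExt J i t M).hom 0 := by rw [h0, map_zero]
  obtain ⟨k, f, g, hfg⟩ := Concrete.isColimit_exists_of_rep_eq _ (isColimit J i M) e 0 h1
  have ht : t ≤ k.unop.unop := leOfHom f.unop.unop
  have h2 := he.map_left (resMap_comm ht)
  have h3 : ((((Ext R (ModuleCat.{0} R) i).map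
      ((ringModIdeals (idealPowersDiagram J)).map (homOfLE ht).op).op).app M).hom e) = 0 := by
    refine Eq.trans hfg ?_
    exact map_zero ((((Ext R (ModuleCat.{0} R) i).map
      ((ringModIdeals (idealPowersDiagram J)).map g.unop).op).app M).hom)
  rw [h3] at h2
  obtain ⟨j, η, h⟩ := ProjectiveResolution.extRep_zero_iff.1 h2
  exact ⟨_, ht, j, η, h⟩

theorem Rep.zero (t : ℕ) :
    Rep J t (0 : (res J t).complex.X i ⟶ M) (0 : (localCohomology J i).obj M) := by
  simpa using Rep.of_boundary (i := i) (j := 0) (0 : (res J t).complex.X 0 ⟶ M)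

theorem Rep.eq_zero {t : ℕ} {z : (localCohomology J i).obj M}
    (h : Rep J t (0 : (res J t).complex.X i ⟶ M) z) : z = 0 := by
  obtain ⟨e, ⟨c, h1, h2⟩, rfl⟩ := h
  have : c = 0 := by
    apply (ModuleCat.mono_iff_injective (((res J t).complex.linearYonedaObj R M).iCycles i)).1
      inferInstance
    exact h1.trans (map_zero _).symm
  rw [this, map_zero] at h2
  have : e = 0 := by
    apply (ModuleCat.mono_iff_injective ((res J t).isoExt i M).hom).1 inferInstance
    exact h2.symm.trans (map_zero _).symm
  rw [this, map_zero]

theorem Rep.sub {t : ℕ} {φ ψ : (res J t).complex.X i ⟶ M} {z w} (h : Rep J t φ z)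
    (h' : Rep J t ψ w) : Rep J t (φ - ψ) (z - w) := by
  have := h.add (h'.smul (-1))
  simpa [sub_eq_add_neg] using this

theorem Rep.unique {t : ℕ} {φ : (res J t).complex.X i ⟶ M} {z w} (h : Rep J t φ z)
    (h' : Rep J t φ w) : z = w := by
  have := h.sub h'
  rw [sub_self] at this
  exact sub_eq_zero.1 this.eq_zero

end localCohomology

end

noncomputable section
open CategoryTheory Limits Opposite

namespace localCohomology
variable {R : Type} [CommRing R] (J : Ideal R)
variable {M N L : Type} [AddCommGroup M] [Module R M] [AddCommGroup N] [Module R N]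
  [AddCommGroup L] [Module R L]

/-- The map induced on local cohomology by a linear map. -/
def hmap (i : ℕ) (f : M →ₗ[R] N) : (localCohomology J i).obj (ModuleCat.of R M) →ₗ[R]
    (localCohomology J i).obj (ModuleCat.of R N) :=
  ((localCohomology J i).map (ModuleCat.ofHom f)).hom

variable {J}

theorem hmap_comp (i : ℕ) (f : M →ₗ[R] N) (g : N →ₗ[R] L) (z) :
    hmap J i (g ∘ₗ f) z = hmap J i g (hmap J i f z) := by
  unfold hmap
  rw [ModuleCat.ofHom_comp, Functor.map_comp]
  rfl

theorem Rep.mapHom {i t : ℕ} {φ : (res J t).complex.X i ⟶ ModuleCat.of R M} {z}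
    (h : Rep J t φ z) (f : M →ₗ[R] N) : Rep J t (φ ≫ ModuleCat.ofHom f) (hmap J i f z) :=
  h.map _

theorem hmap_smul_id (i : ℕ) (a : R) (z) :
    hmap J i (a • (LinearMap.id : M →ₗ[R] M)) z = a • z := by
  obtain ⟨t, φ, h⟩ := exists_rep z
  refine (h.mapHom _).unique ?_
  exact h.smul a

theorem hmap_smul (i : ℕ) (a : R) (f : M →ₗ[R] N) (z) :
    hmap J i (a • f) z = a • hmap J i f z := by
  obtain ⟨t, φ, h⟩ := exists_rep z
  refine (h.mapHom _).unique ?_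
  exact (h.mapHom f).smul a

theorem hmap_zero (i : ℕ) (z) : hmap J i (0 : M →ₗ[R] N) z = 0 := by
  simpa using hmap_smul i (0 : R) (0 : M →ₗ[R] N) z

variable {f : M →ₗ[R] N} {g : N →ₗ[R] L}

theorem Rep.exists_boundary_succ {i t : ℕ} {M : ModuleCat.{0} R}
    {φ : (res J t).complex.X (i + 1) ⟶ M} (h : Rep J t φ 0) :
    ∃ (t' : ℕ) (ht : t ≤ t') (η : (res J t').complex.X i ⟶ M),
      (resMap J ht).f (i + 1) ≫ φ = (res J t').complex.d (i + 1) i ≫ η := by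
  obtain ⟨t', ht, j, η, h⟩ := h.exists_boundary
  by_cases hj : j = i
  · subst hj
    exact ⟨t', ht, η, h⟩
  · refine ⟨t', ht, 0, ?_⟩
    rw [h, HomologicalComplex.shape]
    · simp
    · intro h; exact hj (by simpa using h)

theorem Rep.exists_boundary_zero {t : ℕ} {M : ModuleCat.{0} R}
    {φ : (res J t).complex.X 0 ⟶ M} (h : Rep J t φ 0) :
    ∃ (t' : ℕ) (ht : t ≤ t'), (resMap J ht).f 0 ≫ φ = 0 := by
  obtain ⟨t', ht, j, η, h⟩ := h.exists_boundary
  refine ⟨t', ht, ?_⟩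
  rw [h, HomologicalComplex.shape]
  · simp
  · simp

instance {i t : ℕ} : Projective ((res J t).complex.X i) := (res J t).projective i

section Exact

variable (hf : Function.Injective f) (hfg : Function.Exact f g) (hg : Function.Surjective g)
include hf hfg hg

omit hf hfg in
theorem exists_lift {P : ModuleCat.{0} R} [Projective P] (φ : P ⟶ ModuleCat.of R L) :
    ∃ ψ : P ⟶ ModuleCat.of R N, ψ ≫ ModuleCat.ofHom g = φ := by
  have : Epi (ModuleCat.ofHom g) := (ModuleCat.epi_iff_surjective _).2 hg
  exact ⟨Projective.factorThru φ (ModuleCat.ofHom g), Projective.factorThru_comp _ _⟩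

omit hg in
theorem exists_restrict {P : ModuleCat.{0} R} (φ : P ⟶ ModuleCat.of R N)
    (h : φ ≫ ModuleCat.ofHom g = 0) :
    ∃ ψ : P ⟶ ModuleCat.of R M, ψ ≫ ModuleCat.ofHom f = φ := by
  have h1 : ∀ x, φ.hom x ∈ LinearMap.range f := by
    intro x
    exact (hfg _).1 (congrArg (fun k => k.hom x) h)
  let e := LinearEquiv.ofInjective f hf
  refine ⟨ModuleCat.ofHom (e.symm.toLinearMap ∘ₗ φ.hom.codRestrict _ h1), ?_⟩
  ext x
  change f (e.symm (φ.hom.codRestrict _ h1 x)) = φ.hom x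
  have := congrArg Subtype.val (e.apply_symm_apply (φ.hom.codRestrict _ h1 x))
  exact this

omit hfg hg in
theorem comp_ofHom_cancel {P : ModuleCat.{0} R} {φ ψ : P ⟶ ModuleCat.of R M}
    (h : φ ≫ ModuleCat.ofHom f = ψ ≫ ModuleCat.ofHom f) : φ = ψ := by
  have : Mono (ModuleCat.ofHom f) := (ModuleCat.mono_iff_injective _).2 hf
  exact (cancel_mono _).1 h

omit hfg hg in
theorem hmap_injective_zero : Function.Injective (hmap J 0 f) := by
  rw [injective_iff_map_eq_zero]
  intro z hz
  obtain ⟨t, φ, h⟩ := exists_rep z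
  have h1 := h.mapHom f
  rw [hz] at h1
  obtain ⟨t', ht, h2⟩ := h1.exists_boundary_zero
  have h3 := h.mono ht
  rw [comp_ofHom_cancel hf (φ := (resMap J ht).f 0 ≫ φ) (ψ := 0) (by simpa using h2)] at h3
  exact h3.eq_zero

theorem hmap_exact (i : ℕ) : Function.Exact (hmap J i f) (hmap J i g) := by
  intro z
  constructor
  · intro hz
    obtain ⟨t, φ, h⟩ := exists_rep z
    have h1 := h.mapHom g
    rw [hz] at h1
    obtain ⟨t', ht, j, η, h2⟩ := h1.exists_boundary
    obtain ⟨η', rfl⟩ := exists_lift hg η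
    obtain ⟨χ, hχ⟩ := exists_restrict hf hfg
      ((resMap J ht).f i ≫ φ - (res J t').complex.d i j ≫ η') (by
        rw [Preadditive.sub_comp, Category.assoc, Category.assoc, h2, sub_self])
    have h3 := (h.mono ht).sub (Rep.of_boundary (i := i) η')
    rw [← hχ, sub_zero] at h3
    obtain ⟨w, hw⟩ := exists_rep_of_d_comp (φ := χ) (by
      apply comp_ofHom_cancel hf
      rw [Category.assoc, zero_comp]
      exact h3.d_comp)
    exact ⟨w, (hw.mapHom f).unique h3⟩
  · rintro ⟨w, rfl⟩
    rw [← hmap_comp]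
    have : g ∘ₗ f = 0 := by ext x; exact hfg.apply_apply_eq_zero x
    rw [this, hmap_zero]

end Exact

/-- The graph of the connecting homomorphism. -/
def DeltaRel (f : M →ₗ[R] N) (g : N →ₗ[R] L) (i : ℕ)
    (z : (localCohomology J i).obj (ModuleCat.of R L))
    (w : (localCohomology J (i + 1)).obj (ModuleCat.of R M)) : Prop :=
  ∃ (t : ℕ) (φ : (res J t).complex.X i ⟶ ModuleCat.of R N)
    (χ : (res J t).complex.X (i + 1) ⟶ ModuleCat.of R M),
    Rep J t (φ ≫ ModuleCat.ofHom g) z ∧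
    χ ≫ ModuleCat.ofHom f = (res J t).complex.d (i + 1) i ≫ φ ∧ Rep J t χ w

theorem DeltaRel.exists_of_le {t : ℕ} {i : ℕ} {z : (localCohomology J i).obj (ModuleCat.of R L)}
    {w : (localCohomology J (i + 1)).obj (ModuleCat.of R M)}
    {φ : (res J t).complex.X i ⟶ ModuleCat.of R N}
    {χ : (res J t).complex.X (i + 1) ⟶ ModuleCat.of R M}
    (h1 : Rep J t (φ ≫ ModuleCat.ofHom g) z)
    (h2 : χ ≫ ModuleCat.ofHom f = (res J t).complex.d (i + 1) i ≫ φ) (h3 : Rep J t χ w)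
    {t' : ℕ} (ht : t ≤ t') : ∃ (φ : (res J t').complex.X i ⟶ ModuleCat.of R N)
    (χ : (res J t').complex.X (i + 1) ⟶ ModuleCat.of R M),
    Rep J t' (φ ≫ ModuleCat.ofHom g) z ∧
    χ ≫ ModuleCat.ofHom f = (res J t').complex.d (i + 1) i ≫ φ ∧ Rep J t' χ w := by
  refine ⟨(resMap J ht).f i ≫ φ, (resMap J ht).f (i + 1) ≫ χ, ?_, ?_, h3.mono ht⟩
  · rw [Category.assoc]; exact h1.mono ht
  · rw [Category.assoc, h2]; simp

theorem DeltaRel.add {i : ℕ} {z z' : (localCohomology J i).obj (ModuleCat.of R L)}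
    {w w' : (localCohomology J (i + 1)).obj (ModuleCat.of R M)} (h : DeltaRel f g i z w)
    (h' : DeltaRel f g i z' w') : DeltaRel f g i (z + z') (w + w') := by
  obtain ⟨t, φ, χ, h1, h2, h3⟩ := h
  obtain ⟨t', φ', χ', h1', h2', h3'⟩ := h'
  obtain ⟨φ, χ, h1, h2, h3⟩ := DeltaRel.exists_of_le h1 h2 h3 (le_max_left t t')
  obtain ⟨φ', χ', h1', h2', h3'⟩ := DeltaRel.exists_of_le h1' h2' h3' (le_max_right t t')
  exact ⟨_, φ + φ', χ + χ', by rw [Preadditive.add_comp]; exact h1.add h1', by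
    rw [Preadditive.add_comp, Preadditive.comp_add, h2, h2'], h3.add h3'⟩

theorem DeltaRel.smul {i : ℕ} (a : R) {z : (localCohomology J i).obj (ModuleCat.of R L)}
    {w : (localCohomology J (i + 1)).obj (ModuleCat.of R M)} (h : DeltaRel f g i z w) :
    DeltaRel f g i (a • z) (a • w) := by
  obtain ⟨t, φ, χ, h1, h2, h3⟩ := h
  exact ⟨t, a • φ, a • χ, by rw [Linear.smul_comp]; exact h1.smul a, by
    rw [Linear.smul_comp, Linear.comp_smul, h2], h3.smul a⟩

theorem DeltaRel.exists_snd (hf : Function.Injective f) (hfg : Function.Exact f g)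
    (hg : Function.Surjective g) (i : ℕ) (z : (localCohomology J i).obj (ModuleCat.of R L)) :
    ∃ w, DeltaRel f g i z w := by
  obtain ⟨t, φ, h⟩ := exists_rep z
  obtain ⟨φ, rfl⟩ := exists_lift hg φ
  obtain ⟨χ, hχ⟩ := exists_restrict hf hfg ((res J t).complex.d (i + 1) i ≫ φ) (by
    rw [Category.assoc]; exact h.d_comp)
  obtain ⟨w, hw⟩ := exists_rep_of_d_comp (φ := χ) (by
    apply comp_ofHom_cancel hf
    rw [Category.assoc, hχ]
    simp)
  exact ⟨w, t, φ, χ, h, hχ, hw⟩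

theorem DeltaRel.eq_zero (hf : Function.Injective f) (hfg : Function.Exact f g)
    (hg : Function.Surjective g) {i : ℕ} {w : (localCohomology J (i + 1)).obj (ModuleCat.of R M)}
    (h : DeltaRel f g i 0 w) : w = 0 := by
  obtain ⟨t, φ, χ, h1, h2, h3⟩ := h
  obtain ⟨t', ht, j, η, h⟩ := h1.exists_boundary
  obtain ⟨η, rfl⟩ := exists_lift hg η
  obtain ⟨χ', hχ'⟩ := exists_restrict hf hfg ((resMap J ht).f i ≫ φ - (res J t').complex.d i j ≫ η)
    (by rw [Preadditive.sub_comp, Category.assoc, Category.assoc, h, sub_self])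
  have h4 : (resMap J ht).f (i + 1) ≫ χ = (res J t').complex.d (i + 1) i ≫ χ' := by
    apply comp_ofHom_cancel hf
    rw [Category.assoc, Category.assoc, hχ', h2, Preadditive.comp_sub]
    simp
  have h5 := h3.mono ht
  rw [h4] at h5
  exact h5.unique (Rep.of_boundary _)

theorem DeltaRel.neg {i : ℕ} {z : (localCohomology J i).obj (ModuleCat.of R L)}
    {w : (localCohomology J (i + 1)).obj (ModuleCat.of R M)} (h : DeltaRel f g i z w) :
    DeltaRel f g i (-z) (-w) := by
  simpa using h.smul (-1)

theorem DeltaRel.unique (hf : Function.Injective f) (hfg : Function.Exact f g)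
    (hg : Function.Surjective g) {i : ℕ} {z : (localCohomology J i).obj (ModuleCat.of R L)}
    {w w'} (h : DeltaRel f g i z w) (h' : DeltaRel f g i z w') : w = w' := by
  have := h.add h'.neg
  rw [add_neg_cancel, ← sub_eq_add_neg] at this
  exact sub_eq_zero.1 (this.eq_zero hf hfg hg)

section delta
variable (J) (hf : Function.Injective f) (hfg : Function.Exact f g) (hg : Function.Surjective g)

/-- The connecting homomorphism of local cohomology. -/
def delta (i : ℕ) : (localCohomology J i).obj (ModuleCat.of R L) →ₗ[R]
    (localCohomology J (i + 1)).obj (ModuleCat.of R M) where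
  toFun z := (DeltaRel.exists_snd hf hfg hg i z).choose
  map_add' z z' := (DeltaRel.exists_snd hf hfg hg i (z + z')).choose_spec.unique hf hfg hg
    ((DeltaRel.exists_snd hf hfg hg i z).choose_spec.add
      (DeltaRel.exists_snd hf hfg hg i z').choose_spec)
  map_smul' a z := (DeltaRel.exists_snd hf hfg hg i (a • z)).choose_spec.unique hf hfg hg
    ((DeltaRel.exists_snd hf hfg hg i z).choose_spec.smul a)

variable {J}

theorem deltaRel_delta (i : ℕ) (z) : DeltaRel f g i z (delta J hf hfg hg i z) :=
  (DeltaRel.exists_snd hf hfg hg i z).choose_spec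

theorem exact_hmap_delta (i : ℕ) : Function.Exact (hmap J i g) (delta J hf hfg hg i) := by
  intro z
  constructor
  · intro hz
    obtain ⟨t, φ, χ, h1, h2, h3⟩ := deltaRel_delta hf hfg hg i z
    rw [hz] at h3
    obtain ⟨t', ht, η, h⟩ := h3.exists_boundary_succ
    obtain ⟨w, hw⟩ := exists_rep_of_d_comp
      (φ := (resMap J ht).f i ≫ φ - η ≫ ModuleCat.ofHom f) (by
        rw [Preadditive.comp_sub, ← Category.assoc _ η, ← h, Category.assoc _ χ, h2]
        simp)
    refine ⟨w, (hw.mapHom g).unique ?_⟩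
    have h4 : ModuleCat.ofHom f ≫ ModuleCat.ofHom g = 0 := by
      ext x; exact hfg.apply_apply_eq_zero x
    rw [Preadditive.sub_comp, Category.assoc, Category.assoc, h4, comp_zero, sub_zero]
    exact h1.mono ht
  · rintro ⟨w, rfl⟩
    obtain ⟨t, φ, h⟩ := exists_rep w
    refine (deltaRel_delta hf hfg hg i _).unique hf hfg hg ⟨t, φ, 0, h.mapHom g, ?_, Rep.zero t⟩
    rw [zero_comp, h.d_comp]

theorem exact_delta_hmap (i : ℕ) : Function.Exact (delta J hf hfg hg i) (hmap J (i + 1) f) := by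
  intro w
  constructor
  · intro hw
    obtain ⟨t, χ, h⟩ := exists_rep w
    have h1 := h.mapHom f
    rw [hw] at h1
    obtain ⟨t', ht, η, h2⟩ := h1.exists_boundary_succ
    have h4 : ModuleCat.ofHom f ≫ ModuleCat.ofHom g = 0 := by
      ext x; exact hfg.apply_apply_eq_zero x
    obtain ⟨z, hz⟩ := exists_rep_of_d_comp (φ := η ≫ ModuleCat.ofHom g) (by
      rw [← Category.assoc, ← h2]
      simp [h4])
    exact ⟨z, (deltaRel_delta hf hfg hg i z).unique hf hfg hg
      ⟨t', η, (resMap J ht).f (i + 1) ≫ χ, hz, by rw [Category.assoc, h2], h.mono ht⟩⟩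
  · rintro ⟨z, rfl⟩
    obtain ⟨t, φ, χ, h1, h2, h3⟩ := deltaRel_delta hf hfg hg i z
    have := h3.mapHom f
    rw [h2] at this
    exact this.unique (Rep.of_boundary _)

end delta
end localCohomology

end

noncomputable section
open CategoryTheory Limits Opposite

section PowerTorsion
variable {R : Type*} [CommRing R] (J : Ideal R)

/-- The submodule of elements killed by a power of `J`. -/
def powTorsion (N : Type*) [AddCommGroup N] [Module R N] : Submodule R N where
  carrier := {u | ∃ t : ℕ, ∀ a ∈ J ^ t, a • u = 0}
  add_mem' := by
    rintro u v ⟨s, hs⟩ ⟨t, ht⟩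
    refine ⟨s + t, fun a ha => ?_⟩
    rw [smul_add, hs a (Ideal.pow_le_pow_right (Nat.le_add_right s t) ha),
      ht a (Ideal.pow_le_pow_right (Nat.le_add_left t s) ha), add_zero]
  zero_mem' := ⟨0, by simp⟩
  smul_mem' := by
    rintro b u ⟨t, ht⟩
    refine ⟨t, fun a ha => ?_⟩
    rw [smul_comm, ht a ha, smul_zero]

variable {J} {N N' : Type*} [AddCommGroup N] [Module R N] [AddCommGroup N'] [Module R N']

theorem map_mem_powTorsion (f : N →ₗ[R] N') {u : N} (hu : u ∈ powTorsion J N) :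
    f u ∈ powTorsion J N' := by
  obtain ⟨t, ht⟩ := hu
  exact ⟨t, fun a ha => by rw [← map_smul, ht a ha, map_zero]⟩

theorem mem_powTorsion_of_injective (f : N →ₗ[R] N') (hf : Function.Injective f) {u : N}
    (hu : f u ∈ powTorsion J N') : u ∈ powTorsion J N := by
  obtain ⟨t, ht⟩ := hu
  exact ⟨t, fun a ha => hf (by rw [map_smul, ht a ha, map_zero])⟩

end PowerTorsion

namespace localCohomology
variable {R : Type} [CommRing R] {J : Ideal R}
variable {M N : Type} [AddCommGroup M] [Module R M] [AddCommGroup N] [Module R N]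

/-- The augmentation of the chosen resolution of `R ⧸ J ^ t`. -/
def resπ (J : Ideal R) (t : ℕ) : (res J t).complex.X 0 ⟶ ModuleCat.of R (R ⧸ J ^ t) :=
  (res J t).π.f 0

instance (t : ℕ) : Epi (resπ J t) := inferInstanceAs (Epi ((res J t).π.f 0))

theorem d_comp_resπ (t : ℕ) : (res J t).complex.d 1 0 ≫ resπ J t = 0 :=
  (res J t).complex_d_comp_π_f_zero

theorem resMap_comp_resπ {t t' : ℕ} (ht : t ≤ t') :
    (resMap J ht).f 0 ≫ resπ J t = resπ J t' ≫
      ModuleCat.ofHom (Submodule.mapQ (J ^ t') (J ^ t) LinearMap.id (Ideal.pow_le_pow_right ht)) :=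
  resMap_comm ht

/-- The linear map `R ⧸ J ^ t → M` sending `1` to an element killed by `J ^ t`. -/
def ofQuot {t : ℕ} (u : M) (hu : ∀ a ∈ J ^ t, a • u = 0) :
    ModuleCat.of R (R ⧸ J ^ t) ⟶ ModuleCat.of R M :=
  ModuleCat.ofHom (Submodule.liftQ (J ^ t) (LinearMap.toSpanSingleton R M u) (by
    intro a ha; simpa using hu a ha))

theorem ofQuot_apply {t : ℕ} (u : M) (hu : ∀ a ∈ J ^ t, a • u = 0) (a : R) :
    (ofQuot u hu).hom (Submodule.Quotient.mk a : R ⧸ J ^ t) = a • u :=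
  rfl

theorem eq_of_forall_mk {t : ℕ} {φ ψ : ModuleCat.of R (R ⧸ J ^ t) ⟶ ModuleCat.of R M}
    (h : ∀ a : R, φ.hom (Submodule.Quotient.mk a : R ⧸ J ^ t) =
      ψ.hom (Submodule.Quotient.mk a : R ⧸ J ^ t)) : φ = ψ := by
  ext : 1
  refine LinearMap.ext fun x => ?_
  obtain ⟨a, rfl⟩ := Submodule.Quotient.mk_surjective (J ^ t) x
  exact h a

theorem eq_ofQuot {t : ℕ} (φ : ModuleCat.of R (R ⧸ J ^ t) ⟶ ModuleCat.of R M) :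
    ∃ (u : M) (hu : ∀ a ∈ J ^ t, a • u = 0), φ = ofQuot u hu := by
  have key : ∀ a : R, φ.hom (Submodule.Quotient.mk a : R ⧸ J ^ t) =
      a • φ.hom (Submodule.Quotient.mk 1 : R ⧸ J ^ t) := by
    intro a
    rw [← φ.hom.map_smul, ← Submodule.Quotient.mk_smul, smul_eq_mul, mul_one]
  refine ⟨φ.hom (Submodule.Quotient.mk 1 : R ⧸ J ^ t), fun a ha => ?_, eq_of_forall_mk key⟩
  rw [← key, (Submodule.Quotient.mk_eq_zero (J ^ t)).2 ha]
  exact φ.hom.map_zero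

/-- The class in `H^0` of an element killed by a power of `J`. -/
def ZeroRel (u : M) (z : (localCohomology J 0).obj (ModuleCat.of R M)) : Prop :=
  ∃ (t : ℕ) (hu : ∀ a ∈ J ^ t, a • u = 0), Rep J t (resπ J t ≫ ofQuot u hu) z

theorem Rep.zeroRel_mono {t t' : ℕ} (ht : t ≤ t') {u : M} {hu : ∀ a ∈ J ^ t, a • u = 0} {z}
    (h : Rep J t (resπ J t ≫ ofQuot u hu) z) :
    ∃ (hu : ∀ a ∈ J ^ t', a • u = 0), Rep J t' (resπ J t' ≫ ofQuot u hu) z := by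
  refine ⟨fun a ha => hu a (Ideal.pow_le_pow_right ht ha), ?_⟩
  convert h.mono ht using 1
  rw [← Category.assoc, resMap_comp_resπ, Category.assoc]
  congr 1
  refine eq_of_forall_mk fun a => ?_
  rw [ofQuot_apply]
  exact (ofQuot_apply (t := t) u hu a).symm

theorem ZeroRel.add {u v : M} {z w} (h : ZeroRel (J := J) u z) (h' : ZeroRel v w) :
    ZeroRel (u + v) (z + w) := by
  obtain ⟨t, hu, h⟩ := h
  obtain ⟨t', hv, h'⟩ := h'
  obtain ⟨hu, h⟩ := h.zeroRel_mono (le_max_left t t')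
  obtain ⟨hv, h'⟩ := h'.zeroRel_mono (le_max_right t t')
  refine ⟨_, fun a ha => by rw [smul_add, hu a ha, hv a ha, add_zero], ?_⟩
  convert h.add h' using 1
  rw [← Preadditive.comp_add]
  congr 1
  refine eq_of_forall_mk fun a => ?_
  rw [ofQuot_apply, smul_add]
  exact congrArg₂ (· + ·) (ofQuot_apply u hu a).symm (ofQuot_apply v hv a).symm

theorem ZeroRel.smul (b : R) {u : M} {z} (h : ZeroRel (J := J) u z) :
    ZeroRel (b • u) (b • z) := by
  obtain ⟨t, hu, h⟩ := h
  refine ⟨t, fun a ha => by rw [smul_comm, hu a ha, smul_zero], ?_⟩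
  convert h.smul b using 1
  rw [← Linear.comp_smul]
  congr 1
  refine eq_of_forall_mk fun a => ?_
  rw [ofQuot_apply, smul_comm]
  exact congrArg (b • ·) (ofQuot_apply u hu a).symm

theorem ZeroRel.mapHom {u : M} {z} (h : ZeroRel (J := J) u z) (f : M →ₗ[R] N) :
    ZeroRel (f u) (hmap J 0 f z) := by
  obtain ⟨t, hu, h⟩ := h
  refine ⟨t, fun a ha => by rw [← map_smul, hu a ha, map_zero], ?_⟩
  convert h.mapHom f using 1
  rw [Category.assoc]
  congr 1
  refine eq_of_forall_mk fun a => ?_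
  rw [ofQuot_apply, ← map_smul]
  exact congrArg f (ofQuot_apply u hu a).symm

theorem ZeroRel.eq_zero {z} (h : ZeroRel (J := J) (0 : M) z) : z = 0 := by
  have h1 := (h.add (h.smul (-1)))
  obtain ⟨t, hu, h⟩ := h
  have : ofQuot (0 : M) hu = 0 := by
    refine eq_of_forall_mk fun a => ?_
    rw [ofQuot_apply, smul_zero]; rfl
  rw [this, comp_zero] at h
  exact h.eq_zero

theorem ZeroRel.eq_zero_left {u : M} (h : ZeroRel (J := J) u 0) : u = 0 := by
  obtain ⟨t, hu, h⟩ := h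
  obtain ⟨t', ht, h⟩ := h.exists_boundary_zero
  rw [← Category.assoc, resMap_comp_resπ, Category.assoc] at h
  have h2 := (cancel_epi (resπ J t')).1 (h.trans comp_zero.symm)
  have h3 := congrArg (fun k => k.hom (Submodule.Quotient.mk 1 : R ⧸ J ^ t')) h2
  have h4 := ofQuot_apply (t := t) u hu 1
  rw [one_smul] at h4
  exact h4.symm.trans h3

theorem exists_zeroRel (z : (localCohomology J 0).obj (ModuleCat.of R M)) :
    ∃ u : M, ZeroRel u z := by
  obtain ⟨t, φ, h⟩ := exists_rep z
  have h1 := (res J t).isColimitCokernelCofork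
  obtain ⟨φ', h2⟩ := CokernelCofork.IsColimit.desc' h1 φ h.d_comp
  obtain ⟨u, hu, rfl⟩ := eq_ofQuot φ'
  exact ⟨u, t, hu, by rw [← h2] at h; exact h⟩

theorem exists_zeroRel_of_mem {u : M} (hu : u ∈ powTorsion J M) :
    ∃ z : (localCohomology J 0).obj (ModuleCat.of R M), ZeroRel u z := by
  obtain ⟨t, hu⟩ := hu
  obtain ⟨z, hz⟩ := exists_rep_of_d_comp (φ := resπ J t ≫ ofQuot u hu) (i := 0) (by
    rw [← Category.assoc, d_comp_resπ, zero_comp])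
  exact ⟨z, t, hu, hz⟩

theorem ZeroRel.mem {u : M} {z} (h : ZeroRel (J := J) u z) : u ∈ powTorsion J M := by
  obtain ⟨t, hu, -⟩ := h
  exact ⟨t, hu⟩

theorem ZeroRel.unique_left {u v : M} {z} (h : ZeroRel (J := J) u z) (h' : ZeroRel v z) :
    u = v := by
  have := h.add (h'.smul (-1))
  rw [neg_one_smul, neg_one_smul, add_neg_cancel, ← sub_eq_add_neg] at this
  exact sub_eq_zero.1 this.eq_zero_left

/-- Local cohomology of `M` in degree `0` is the submodule of elements killed by a power of `J`. -/
def zeroEquiv (J : Ideal R) (M : Type) [AddCommGroup M] [Module R M] :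
    (localCohomology J 0).obj (ModuleCat.of R M) ≃ₗ[R] powTorsion J M :=
  LinearEquiv.ofBijective
    { toFun := fun z => ⟨(exists_zeroRel z).choose, (exists_zeroRel z).choose_spec.mem⟩
      map_add' := fun z w => Subtype.ext ((exists_zeroRel (z + w)).choose_spec.unique_left
        ((exists_zeroRel z).choose_spec.add (exists_zeroRel w).choose_spec))
      map_smul' := fun a z => Subtype.ext ((exists_zeroRel (a • z)).choose_spec.unique_left
        ((exists_zeroRel z).choose_spec.smul a)) }
    ⟨by
      rw [injective_iff_map_eq_zero]
      intro z hz
      have h := (exists_zeroRel z).choose_spec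
      rw [show (exists_zeroRel z).choose = 0 from congrArg Subtype.val hz] at h
      exact h.eq_zero, by
      rintro ⟨u, hu⟩
      obtain ⟨z, hz⟩ := exists_zeroRel_of_mem hu
      exact ⟨z, Subtype.ext ((exists_zeroRel z).choose_spec.unique_left hz)⟩⟩

theorem zeroEquiv_hmap (f : M →ₗ[R] N) (z) :
    ((zeroEquiv J N (hmap J 0 f z) : powTorsion J N) : N) = f (zeroEquiv J M z : powTorsion J M) :=
  (exists_zeroRel (hmap J 0 f z)).choose_spec.unique_left ((exists_zeroRel z).choose_spec.mapHom f)

theorem eq_zero_of_injective [Module.Injective R M] {i : ℕ}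
    (z : (localCohomology J (i + 1)).obj (ModuleCat.of R M)) : z = 0 := by
  obtain ⟨t, φ, h⟩ := exists_rep z
  have : Injective (ModuleCat.of R M) := Module.injective_object_of_injective_module R M
  have h1 := ((res J t).exact_succ i).comp_descToInjective φ h.d_comp
  dsimp only at h1
  rw [← h1] at h
  exact h.unique (Rep.of_boundary _)

end localCohomology

end

noncomputable section
open CategoryTheory Limits Opposite

namespace localCohomology
variable {R : Type} [CommRing R] {J : Ideal R}
variable {M N L : Type} [AddCommGroup M] [Module R M] [AddCommGroup N] [Module R N]
  [AddCommGroup L] [Module R L]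

theorem mem_powTorsion_top {i : ℕ} (z : (localCohomology J i).obj (ModuleCat.of R M)) :
    z ∈ powTorsion J ((localCohomology J i).obj (ModuleCat.of R M)) := by
  obtain ⟨t, φ, e, he, rfl⟩ := exists_rep z
  refine ⟨t, fun a ha => ?_⟩
  have h0 : ∀ x : R ⧸ J ^ t, a • x = 0 := by
    intro x
    obtain ⟨b, rfl⟩ := Submodule.Quotient.mk_surjective (J ^ t) x
    rw [← Submodule.Quotient.mk_smul, Submodule.Quotient.mk_eq_zero, smul_eq_mul, mul_comm]
    exact Ideal.mul_mem_left _ _ ha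
  have h1 := he.map_left (P := res J t) (f := 0) (g := 0) (zero_comp.trans comp_zero.symm)
  have h2 := he.map_left (P := res J t) (f := 0) (g := a • 𝟙 (res J t).complex) (by
    refine Eq.trans ?_ comp_zero.symm
    change (a • 𝟙 ((res J t).complex.X 0)) ≫ resπ J t = 0
    rw [Linear.smul_comp, Category.id_comp, ← Category.comp_id (resπ J t), ← Linear.comp_smul]
    rw [show a • 𝟙 (ModuleCat.of R (R ⧸ J ^ t)) = 0 from ?_, comp_zero]
    ext : 1
    exact LinearMap.ext h0)
  have h3 : (0 : (res J t).complex ⟶ (res J t).complex).f i ≫ φ = 0 := by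
    rw [HomologicalComplex.zero_f, zero_comp]
  have h4 : (a • 𝟙 (res J t).complex).f i ≫ φ = a • φ := by
    change (a • 𝟙 ((res J t).complex.X i)) ≫ φ = a • φ
    rw [Linear.smul_comp, Category.id_comp]
  rw [h3] at h1
  rw [h4] at h2
  have k1 : Rep J t (0 : (res J t).complex.X i ⟶ ModuleCat.of R M) _ := ⟨_, h1, rfl⟩
  have k2 : Rep J t (a • φ) _ := ⟨_, h2, rfl⟩
  have k3 : Rep J t (a • φ) _ := ⟨_, he.smul a, rfl⟩
  have k4 := k3.unique k2
  rw [k1.eq_zero, map_smul] at k4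
  exact k4

theorem _root_.powTorsion_injective [IsNoetherianRing R] [Module.Injective R M] :
    Module.Injective R (powTorsion J M) := by
  refine Module.Baer.injective fun I g => ?_
  obtain ⟨s, hs⟩ : ∃ s, ∀ x : I, ∀ a ∈ J ^ s, a • g x = 0 := by
    obtain ⟨S, hS⟩ := Module.Finite.fg_top (R := R) (M := I)
    choose t ht using fun x => (g x).2
    refine ⟨S.sup t, fun x => ?_⟩
    have : x ∈ Submodule.span R (S : Set I) := hS ▸ Submodule.mem_top
    induction this using Submodule.span_induction with
    | mem x hx => exact fun a ha => Subtype.ext (ht x a (Ideal.pow_le_pow_right (Finset.le_sup hx) ha))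
    | zero => simp
    | add x y _ _ hx hy => intro a ha; rw [map_add, smul_add, hx a ha, hy a ha, add_zero]
    | smul b x _ hx => intro a ha; rw [map_smul, smul_comm, hx a ha, smul_zero]
  obtain ⟨k, hk⟩ := J.exists_pow_inf_eq_pow_smul (M := R) I
  have hker : LinearMap.ker ((J ^ (s + k)).mkQ ∘ₗ I.subtype) ≤
      LinearMap.ker ((powTorsion J M).subtype ∘ₗ g) := by
    rintro ⟨x, hx⟩ hx'
    have h1 : x ∈ J ^ (s + k) := by simpa [Ideal.Quotient.eq_zero_iff_mem] using hx'
    have h2 : x ∈ J ^ (s + k) • (⊤ : Submodule R R) ⊓ I := ⟨by simpa using h1, hx⟩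
    rw [hk _ (Nat.le_add_left k s), Nat.add_sub_cancel] at h2
    have h3 : x ∈ J ^ s • I := (Submodule.smul_mono le_rfl inf_le_right : J ^ s • _ ≤ J ^ s • I) h2
    have h4 : (⟨x, hx⟩ : I) ∈ J ^ s • (⊤ : Submodule R I) := by
      have : x ∈ (J ^ s • (⊤ : Submodule R I)).map I.subtype := by
        rw [Submodule.map_smul'']; simpa using h3
      obtain ⟨y, hy, rfl⟩ := this
      exact hy
    have h5 : ∀ y ∈ J ^ s • (⊤ : Submodule R I), g y = 0 := fun y hy => by
      induction hy using Submodule.smul_induction_on' with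
      | smul a ha y _ => rw [map_smul]; exact hs y a ha
      | add y _ z _ hy hz => rw [map_add, hy, hz, add_zero]
    simpa using h5 _ h4
  have hinj : Function.Injective ((LinearMap.ker ((J ^ (s + k)).mkQ ∘ₗ I.subtype)).liftQ
      ((J ^ (s + k)).mkQ ∘ₗ I.subtype) le_rfl) := by
    rw [← LinearMap.ker_eq_bot]
    exact Submodule.ker_liftQ_eq_bot _ _ _ le_rfl
  obtain ⟨h, hh⟩ := Module.Injective.out (R := R) (Q := M) _ hinj
    ((LinearMap.ker ((J ^ (s + k)).mkQ ∘ₗ I.subtype)).liftQ _ hker)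
  have h6 : ∀ y : R ⧸ J ^ (s + k), h y ∈ powTorsion J M := by
    intro y
    obtain ⟨b, rfl⟩ := Submodule.Quotient.mk_surjective (J ^ (s + k)) y
    refine ⟨s + k, fun a ha => ?_⟩
    rw [← map_smul, ← Submodule.Quotient.mk_smul, smul_eq_mul,
      (Submodule.Quotient.mk_eq_zero (J ^ (s + k))).2 (Ideal.mul_mem_right b _ ha), map_zero]
  refine ⟨LinearMap.codRestrict _ (h ∘ₗ (J ^ (s + k)).mkQ) fun y => h6 _, fun x hx => ?_⟩
  apply Subtype.ext
  have := hh (Submodule.Quotient.mk ⟨x, hx⟩)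
  simpa using this

/-- Every module embeds into an injective module. -/
theorem _root_.Module.exists_injective_embedding (M : Type) [AddCommGroup M] [Module R M] :
    ∃ (E : Type) (_ : AddCommGroup E) (_ : Module R E) (f : M →ₗ[R] E),
      Function.Injective f ∧ Module.Injective R E := by
  refine ⟨(Injective.under (ModuleCat.of R M) : ModuleCat.{0} R), inferInstance, inferInstance,
    (Injective.ι (ModuleCat.of R M)).hom, (ModuleCat.mono_iff_injective _).1 inferInstance, ?_⟩
  have : Injective (ModuleCat.of R (Injective.under (ModuleCat.of R M) : ModuleCat.{0} R)) :=
    inferInstanceAs (Injective (Injective.under (ModuleCat.of R M)))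
  exact Module.injective_module_of_injective_object R _

theorem eq_zero_of_powTorsion [IsNoetherianRing R] (i : ℕ) {M : Type} [AddCommGroup M]
    [Module R M] (hM : powTorsion J M = ⊤)
    (z : (localCohomology J (i + 1)).obj (ModuleCat.of R M)) : z = 0 := by
  obtain ⟨E', _, _, f', hf', _⟩ := Module.exists_injective_embedding (R := R) M
  have hE := powTorsion_injective (R := R) (J := J) (M := E')
  generalize hEE : powTorsion J E' = E at hE
  let f : M →ₗ[R] E := f'.codRestrict E fun u =>
    hEE ▸ map_mem_powTorsion f' (hM ▸ Submodule.mem_top)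
  have hf : Function.Injective f := fun u v h => hf' (congrArg Subtype.val h)
  let g := (LinearMap.range f).mkQ
  have hg : Function.Surjective g := Submodule.mkQ_surjective _
  have hfg : Function.Exact f g := LinearMap.exact_map_mkQ_range f
  have hET : powTorsion J E = ⊤ := by
    rw [eq_top_iff]
    intro u _
    exact mem_powTorsion_of_injective E.subtype Subtype.val_injective
      (hEE ▸ u.2 : (u : E') ∈ powTorsion J E')
  have hQ : powTorsion J (E ⧸ LinearMap.range f) = ⊤ := by
    rw [eq_top_iff]
    intro u _
    obtain ⟨v, rfl⟩ := hg u
    exact map_mem_powTorsion g (hET ▸ Submodule.mem_top)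
  obtain ⟨w, rfl⟩ := (exact_delta_hmap hf hfg hg i z).1 (eq_zero_of_injective _)
  cases i with
  | zero =>
    suffices ∃ v, hmap J 0 g v = w by
      exact (exact_hmap_delta hf hfg hg 0 w).2 this
    obtain ⟨v, hv⟩ := hg (zeroEquiv J _ w)
    refine ⟨(zeroEquiv J _).symm ⟨v, hET ▸ Submodule.mem_top⟩, ?_⟩
    apply (zeroEquiv J _).injective
    apply Subtype.ext
    rw [zeroEquiv_hmap, LinearEquiv.apply_symm_apply]
    exact hv
  | succ i => rw [eq_zero_of_powTorsion i hQ w, map_zero]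

end localCohomology

end

section
open IsLocalRing Pointwise

section Generic
variable (R : Type*) [CommRing R] [IsLocalRing R]

/-- The filter of properties of elements of `R` which hold for all elements of a power of the
maximal ideal outside finitely many non-maximal primes. -/
def genericFilter : Filter R where
  sets := {U | ∃ (q : ℕ) (s : Set (Ideal R)), s.Finite ∧
    (∀ P ∈ s, P.IsPrime ∧ P ≠ maximalIdeal R) ∧
      ∀ x ∈ maximalIdeal R ^ q, (∀ P ∈ s, x ∉ P) → x ∈ U}
  univ_sets := ⟨0, ∅, by simp⟩
  sets_of_superset := by
    rintro U V ⟨q, s, hs, h, hU⟩ hUV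
    exact ⟨q, s, hs, h, fun x hx hx' => hUV (hU x hx hx')⟩
  inter_sets := by
    rintro U V ⟨q, s, hs, h, hU⟩ ⟨q', s', hs', h', hV⟩
    refine ⟨q + q', s ∪ s', hs.union hs', ?_, fun x hx hx' => ⟨?_, ?_⟩⟩
    · rintro P (hP | hP)
      exacts [h P hP, h' P hP]
    · exact hU x (Ideal.pow_le_pow_right (Nat.le_add_right q q') hx) fun P hP => hx' P (Or.inl hP)
    · exact hV x (Ideal.pow_le_pow_right (Nat.le_add_left q' q) hx) fun P hP => hx' P (Or.inr hP)

variable {R}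

instance : (genericFilter R).NeBot := by
  rw [Filter.neBot_iff]
  intro h
  have h0 : (∅ : Set R) ∈ genericFilter R := h ▸ Filter.mem_bot
  obtain ⟨q, s, hs, hP, h⟩ := h0
  have h1 : ((maximalIdeal R ^ q : Ideal R) : Set R) ⊆ ⋃ P ∈ s, ((P : Ideal R) : Set R) := by
    intro x hx
    by_contra hx'
    simp only [Set.mem_iUnion, not_exists] at hx'
    exact h x hx fun P hP => hx' P hP
  obtain ⟨P, hPs, hle⟩ := (Ideal.subset_union_prime_finite hs (f := id) ⊤ ⊤
    fun P hPs _ _ => (hP P hPs).1).1 h1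
  have := (hP P hPs).1
  have h2 : maximalIdeal R ≤ P := this.le_of_pow_le hle
  exact (hP P hPs).2 (((maximalIdeal.isMaximal R).eq_of_le this.ne_top h2).symm)

theorem eventually_mem_pow (q : ℕ) : ∀ᶠ x in genericFilter R, x ∈ maximalIdeal R ^ q :=
  ⟨q, ∅, by simp, by simp, fun _ hx _ => hx⟩

theorem eventually_mem_maximalIdeal : ∀ᶠ x in genericFilter R, x ∈ maximalIdeal R := by
  simpa using eventually_mem_pow (R := R) 1

theorem eventually_notMem {s : Set (Ideal R)} (hs : s.Finite) (h : ∀ P ∈ s, P.IsPrime)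
    (h' : maximalIdeal R ∉ s) : ∀ᶠ x in genericFilter R, ∀ P ∈ s, x ∉ P :=
  ⟨0, s, hs, fun P hP => ⟨h P hP, fun h0 => h' (h0 ▸ hP)⟩, fun _ _ hx => hx⟩

theorem tendsto_genericFilter {S : Type*} [CommRing S] [IsLocalRing S] (f : S →+* R)
    (hf : Function.Surjective f) : Filter.Tendsto f (genericFilter S) (genericFilter R) := by
  rintro U ⟨q, s, hs, h, hU⟩
  have : IsLocalHom f := .of_surjective f hf
  refine ⟨q, Ideal.comap f '' s, hs.image _, ?_, fun x hx hx' => hU _ ?_ fun P hP hP' =>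
    hx' _ ⟨P, hP, rfl⟩ hP'⟩
  · rintro _ ⟨P, hP, rfl⟩
    have := (h P hP).1
    refine ⟨inferInstance, fun h0 => (h P hP).2 ?_⟩
    rw [← Ideal.map_comap_of_surjective f hf P, h0, ← IsLocalRing.maximalIdeal_comap f]
    exact Ideal.map_comap_of_surjective f hf (maximalIdeal R)
  · have := Ideal.mem_map_of_mem f hx
    rw [Ideal.map_pow] at this
    refine Ideal.pow_right_mono ?_ q this
    exact Ideal.map_le_iff_le_comap.2 (IsLocalRing.maximalIdeal_comap f).ge

variable {M : Type*} [AddCommGroup M] [Module R M]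

/-- The element `x` is filter-regular on `M` and kills the torsion of `M`. -/
def IsGoodFor (M : Type*) [AddCommGroup M] [Module R M] (x : R) : Prop :=
  ∀ u : M, x • u = 0 ↔ u ∈ powTorsion (maximalIdeal R) M

theorem exists_pow_smul_powTorsion {R : Type*} [CommRing R] (J : Ideal R) {M : Type*}
    [AddCommGroup M] [Module R M] [IsNoetherian R M] :
    ∃ t : ℕ, ∀ a ∈ J ^ t, ∀ u ∈ powTorsion J M, a • u = 0 := by
  obtain ⟨S, hS⟩ := (IsNoetherian.noetherian (powTorsion J M))
  have hS' : ∀ u ∈ S, u ∈ powTorsion J M := fun u hu => hS ▸ Submodule.subset_span hu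
  choose! t ht using hS'
  refine ⟨S.sup t, fun a ha u hu => ?_⟩
  rw [← hS] at hu
  induction hu using Submodule.span_induction with
  | mem u hu => exact ht u hu a (Ideal.pow_le_pow_right (Finset.le_sup hu) ha)
  | zero => simp
  | add u v _ _ hu hv => rw [smul_add, hu, hv, add_zero]
  | smul b u _ hu => rw [smul_comm, hu, smul_zero]

theorem mem_powTorsion_of_forall_smul_mem {R : Type*} [CommRing R] {J : Ideal R} {M : Type*}
    [AddCommGroup M] [Module R M] [IsNoetherian R M] {u : M} (n : ℕ)
    (h : ∀ a ∈ J ^ n, a • u ∈ powTorsion J M) : u ∈ powTorsion J M := by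
  obtain ⟨t, ht⟩ := exists_pow_smul_powTorsion J (M := M)
  refine ⟨t + n, fun a ha => ?_⟩
  rw [pow_add] at ha
  induction ha using Submodule.mul_induction_on' with
  | mem_mul_mem a ha b hb => rw [mul_smul]; exact ht a ha _ (h b hb)
  | add a _ b _ ha hb => rw [add_smul, ha, hb, add_zero]

theorem powTorsion_quotient_eq_bot {R : Type*} [CommRing R] (J : Ideal R) (M : Type*)
    [AddCommGroup M] [Module R M] [IsNoetherian R M] :
    powTorsion J (M ⧸ powTorsion J M) = ⊥ := by
  rw [eq_bot_iff]
  rintro u ⟨t, ht⟩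
  obtain ⟨u, rfl⟩ := Submodule.mkQ_surjective _ u
  rw [Submodule.mem_bot, Submodule.mkQ_apply, Submodule.Quotient.mk_eq_zero]
  refine mem_powTorsion_of_forall_smul_mem t fun a ha => ?_
  rw [← Submodule.Quotient.mk_eq_zero]
  exact ht a ha

theorem mem_associatedPrimes_iff {R : Type*} [CommRing R] [IsNoetherianRing R] {M : Type*}
    [AddCommGroup M] [Module R M] {P : Ideal R} :
    P ∈ associatedPrimes R M ↔ P.IsPrime ∧ ∃ u : M, ∀ a, a ∈ P ↔ a • u = 0 := by
  refine (isAssociatedPrime_iff (I := P) (M := M)).trans (and_congr_right fun _ =>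
    exists_congr fun u => ?_)
  simp [SetLike.ext_iff, Submodule.mem_colon_singleton]

theorem eventually_isSMulRegular [IsNoetherianRing R] [Module.Finite R M]
    (h : powTorsion (maximalIdeal R) M = ⊥) :
    ∀ᶠ x in genericFilter R, IsSMulRegular M x := by
  have h1 : maximalIdeal R ∉ associatedPrimes R M := by
    intro h2
    obtain ⟨hp, u, hu⟩ := mem_associatedPrimes_iff.1 h2
    have h0 : u ∈ powTorsion (maximalIdeal R) M :=
      ⟨1, fun a ha => (hu a).1 (by rwa [pow_one] at ha)⟩
    rw [h, Submodule.mem_bot] at h0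
    exact hp.ne_top (Ideal.eq_top_iff_one _ |>.2 ((hu 1).2 (by rw [h0, smul_zero])))
  filter_upwards [eventually_notMem (associatedPrimes.finite R M) (fun P hP => hP.isPrime) h1]
    with x hx
  have h2 := biUnion_associatedPrimes_eq_zero_divisors R M
  rw [isSMulRegular_iff_right_eq_zero_of_smul]
  intro u hu
  by_contra hu'
  have : x ∈ ⋃ p ∈ associatedPrimes R M, (p : Set R) := h2 ▸ ⟨u, hu', hu⟩
  simp only [Set.mem_iUnion] at this
  obtain ⟨P, hP, hP'⟩ := this
  exact hx P hP hP'

theorem eventually_isGoodFor (M : Type*) [AddCommGroup M] [Module R M] [IsNoetherianRing R]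
    [Module.Finite R M] : ∀ᶠ x in genericFilter R, IsGoodFor M x := by
  obtain ⟨t, ht⟩ := exists_pow_smul_powTorsion (maximalIdeal R) (M := M)
  filter_upwards [eventually_mem_pow t, eventually_isSMulRegular
    (powTorsion_quotient_eq_bot (maximalIdeal R) M)] with x hx hx' u
  refine ⟨fun hu => ?_, fun hu => ht x hx u hu⟩
  rw [← Submodule.Quotient.mk_eq_zero]
  refine (isSMulRegular_iff_right_eq_zero_of_smul.1 hx') _ ?_
  rw [← Submodule.Quotient.mk_smul, hu, Submodule.Quotient.mk_zero]

theorem IsGoodFor.mem_of_smul_mem [IsNoetherian R M] {x : R} (h : IsGoodFor M x) {u : M}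
    (hu : x • u ∈ powTorsion (maximalIdeal R) M) : u ∈ powTorsion (maximalIdeal R) M := by
  obtain ⟨t, ht⟩ := hu
  exact mem_powTorsion_of_forall_smul_mem t fun a ha => (h _).1 (by rw [smul_comm, ht a ha])

theorem IsGoodFor.smul_eq_zero [IsNoetherian R M] {x : R} (h : IsGoodFor M x) {u : M}
    (hu : x • u ∈ powTorsion (maximalIdeal R) M) : x • u = 0 :=
  (h u).2 (h.mem_of_smul_mem hu)

theorem supportDim_quotSMulTop_le [IsNoetherianRing R] [Module.Finite R M] (d : ℕ)
    (h : Module.supportDim R M ≤ (d + 1 : ℕ)) :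
    ∀ᶠ x in genericFilter R, Module.supportDim R (QuotSMulTop x M) ≤ d := by
  by_cases hm : maximalIdeal R ∈ (Module.annihilator R M).minimalPrimes
  · refine Filter.Eventually.of_forall fun x => ?_
    refine (Module.supportDim_le_of_surjective (R := R) (Submodule.mkQ (x • (⊤ : Submodule R M)))
      (Submodule.mkQ_surjective _)).trans ?_
    have : Subsingleton (Module.support R M) := by
      have key : ∀ p ∈ Module.support R M, p.asIdeal = maximalIdeal R := fun p hp =>
        le_antisymm (IsLocalRing.le_maximalIdeal p.2.ne_top)
          (hm.2 ⟨p.2, Module.mem_support_iff_of_finite.1 hp⟩ (IsLocalRing.le_maximalIdeal p.2.ne_top))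
      exact ⟨fun p q => Subtype.ext (PrimeSpectrum.ext ((key p p.2).trans (key q q.2).symm))⟩
    exact Order.krullDim_nonpos_of_subsingleton.trans (by exact_mod_cast Nat.zero_le d)
  · filter_upwards [eventually_notMem
      ((Module.annihilator R M).finite_minimalPrimes_of_isNoetherianRing R)
      (fun P hP => hP.1.1) hm] with x hx
    have h2 := (Module.supportDim_quotSMulTop_succ_le_of_notMem_minimalPrimes hx).trans h
    generalize Module.supportDim R (QuotSMulTop x M) = a at h2
    induction a with
    | bot => exact bot_le
    | coe a =>
      have h3 : a + 1 ≤ (d : ℕ∞) + 1 := by exact_mod_cast h2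
      have h4 : a ≤ d := (ENat.add_le_add_iff_right (by simp)).1 h3
      exact_mod_cast h4

omit [IsLocalRing R] in
theorem isArtinianRing_quotient_annihilator [IsNoetherianRing R] [Module.Finite R M]
    (h : Module.supportDim R M ≤ 0) : IsArtinianRing (R ⧸ Module.annihilator R M) := by
  rw [Module.supportDim_eq_ringKrullDim_quotient_annihilator] at h
  rw [isArtinianRing_iff_krullDimLE_zero, Ring.krullDimLE_iff]
  exact_mod_cast h

omit [IsLocalRing R] in
theorem isFiniteLength_of_supportDim [IsNoetherianRing R] [Module.Finite R M]
    (h : Module.supportDim R M ≤ 0) : IsFiniteLength R M := by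
  have := isArtinianRing_quotient_annihilator h
  have : IsArtinian R (R ⧸ Module.annihilator R M) :=
    isArtinian_of_surjective_algebraMap (R := R ⧸ Module.annihilator R M)
      Ideal.Quotient.mk_surjective
  rw [isFiniteLength_iff_isNoetherian_isArtinian]
  refine ⟨inferInstance, ?_⟩
  obtain ⟨n, s, hs⟩ := Module.Finite.exists_fin (R := R) (M := M)
  let g : (Fin n → R ⧸ Module.annihilator R M) →ₗ[R] M :=
    LinearMap.lsum R (fun _ => R ⧸ Module.annihilator R M) R fun i =>
      (Module.annihilator R M).liftQ (LinearMap.toSpanSingleton R M (s i)) fun a ha => by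
        simpa using Module.mem_annihilator.1 ha (s i)
  refine isArtinian_of_surjective _ g (LinearMap.range_eq_top.1 ?_)
  rw [eq_top_iff, ← hs, Submodule.span_le]
  rintro _ ⟨i, rfl⟩
  refine ⟨Pi.single i (Submodule.Quotient.mk 1), ?_⟩
  simp only [g, LinearMap.lsum_piSingle]
  exact one_smul R (s i)

theorem powTorsion_eq_top_of_supportDim [IsNoetherianRing R] [Module.Finite R M]
    (h : Module.supportDim R M ≤ 0) : powTorsion (maximalIdeal R) M = ⊤ := by
  have := isArtinianRing_quotient_annihilator h
  obtain ⟨n, hn⟩ := exists_maximalIdeal_pow_le_of_isArtinianRing_quotient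
    (Module.annihilator R M)
  rw [eq_top_iff]
  exact fun u _ => ⟨n, fun a ha => Module.mem_annihilator.1 (hn ha) u⟩

end Generic

end

noncomputable section
open CategoryTheory IsLocalRing Pointwise

namespace localCohomology
variable {R : Type} [CommRing R] {J : Ideal R}
variable {M : Type} [AddCommGroup M] [Module R M]

/-- Passing to the quotient by the torsion does not change higher local cohomology. -/
theorem hmap_mkQ_powTorsion_bijective [IsNoetherianRing R] (i : ℕ) :
    Function.Bijective (hmap J (i + 1) (powTorsion J M).mkQ) := by
  have hT : powTorsion J (powTorsion J M) = ⊤ := by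
    rw [eq_top_iff]
    exact fun u _ => mem_powTorsion_of_injective _ (powTorsion J M).subtype_injective u.2
  have hf := (powTorsion J M).subtype_injective
  have hg := (powTorsion J M).mkQ_surjective
  have hfg := LinearMap.exact_subtype_mkQ (powTorsion J M)
  constructor
  · rw [injective_iff_map_eq_zero]
    intro z hz
    obtain ⟨w, rfl⟩ := (hmap_exact hf hfg hg (i + 1) z).1 hz
    rw [eq_zero_of_powTorsion i hT w, map_zero]
  · intro z
    exact (exact_hmap_delta hf hfg hg (i + 1) z).1 (eq_zero_of_powTorsion _ hT _)

/-- The short exact sequence `0 → M → M → M / xM → 0`. -/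
theorem exact_lsmul_mkQ (M : Type) [AddCommGroup M] [Module R M] (x : R) :
    Function.Exact (LinearMap.lsmul R M x) (x • (⊤ : Submodule R M)).mkQ := by
  intro u
  rw [Submodule.mkQ_apply, Submodule.Quotient.mk_eq_zero, Submodule.mem_smul_pointwise_iff_exists]
  simp

theorem lsmul_injective {x : R} (h : IsSMulRegular M x) :
    Function.Injective (LinearMap.lsmul R M x) := h

theorem hmap_lsmul (i : ℕ) (x : R) (z : (localCohomology J i).obj (ModuleCat.of R M)) :
    hmap J i (LinearMap.lsmul R M x) z = x • z := by
  rw [← hmap_smul_id]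
  congr 1

theorem exists_pow_smul_eq_zero {i : ℕ} (z : (localCohomology J i).obj (ModuleCat.of R M)) {x : R}
    (hx : x ∈ J) : ∃ n : ℕ, x ^ n • z = 0 := by
  obtain ⟨t, ht⟩ := mem_powTorsion_top z
  exact ⟨t, ht _ (Ideal.pow_mem_pow hx t)⟩

theorem eq_zero_of_smul {i : ℕ} {x : R} (hx : x ∈ J)
    (h : ∀ z : (localCohomology J i).obj (ModuleCat.of R M), x • z = 0 → z = 0)
    (z : (localCohomology J i).obj (ModuleCat.of R M)) : z = 0 := by
  obtain ⟨n, hn⟩ := exists_pow_smul_eq_zero z hx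
  induction n with
  | zero => simpa using hn
  | succ n ih => exact ih (h _ (by rw [smul_smul, ← pow_succ', hn]))

theorem eq_zero_of_supportDim_lt [IsNoetherianRing R] [IsLocalRing R] (d : ℕ) {i : ℕ} (hi : d < i)
    {M : Type} [AddCommGroup M] [Module R M] [Module.Finite R M]
    (hd : Module.supportDim R M ≤ d)
    (z : (localCohomology (maximalIdeal R) i).obj (ModuleCat.of R M)) : z = 0 := by
  induction d generalizing i M with
  | zero =>
    obtain ⟨i, rfl⟩ := Nat.exists_eq_succ_of_ne_zero hi.ne'
    exact eq_zero_of_powTorsion i (powTorsion_eq_top_of_supportDim hd) z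
  | succ d ih =>
    obtain ⟨i, rfl⟩ := Nat.exists_eq_succ_of_ne_zero (Nat.ne_zero_of_lt hi)
    apply (hmap_mkQ_powTorsion_bijective (M := M) (J := maximalIdeal R) i).1
    rw [map_zero]
    generalize hmap (maximalIdeal R) (i + 1) (powTorsion (maximalIdeal R) M).mkQ z = w
    have hd' := (Module.supportDim_le_of_surjective (R := R) (powTorsion (maximalIdeal R) M).mkQ
      (Submodule.mkQ_surjective (powTorsion (maximalIdeal R) M))).trans hd
    obtain ⟨x, hx, hreg, hdim⟩ := (Filter.Eventually.and eventually_mem_maximalIdeal ((eventually_isSMulRegular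
      (M := M ⧸ powTorsion (maximalIdeal R) M)
      (powTorsion_quotient_eq_bot (maximalIdeal R) M)).and
      (supportDim_quotSMulTop_le d hd'))).exists
    refine eq_zero_of_smul hx (fun v hv => ?_) w
    rw [← hmap_lsmul] at hv
    obtain ⟨y, rfl⟩ := (exact_delta_hmap (lsmul_injective hreg) (exact_lsmul_mkQ _ x)
      (Submodule.mkQ_surjective _) i v).1 hv
    rw [ih (Nat.lt_of_succ_lt_succ hi) hdim y, map_zero]

end localCohomology

end

section
open IsLocalRing Pointwise

section DSequence
variable {R : Type} [CommRing R] {M : Type} [AddCommGroup M] [Module R M] {r : ℕ}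

/-- The ideal generated by the first `i` members of a sequence. -/
def initIdeal (x : Fin r → R) (i : ℕ) : Ideal R := Ideal.span (x '' {k | (k : ℕ) < i})

theorem initIdeal_zero (x : Fin r → R) : initIdeal x 0 = ⊥ := by simp [initIdeal]

theorem initIdeal_self (x : Fin r → R) : initIdeal x r = Ideal.span (Set.range x) := by
  simp [initIdeal]

theorem initIdeal_succ (x : Fin r → R) (i : Fin r) :
    initIdeal x (i + 1) = initIdeal x i ⊔ Ideal.span {x i} := by
  rw [initIdeal, initIdeal, ← Ideal.span_union, ← Set.image_singleton, ← Set.image_union]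
  congr 2
  ext k
  simp only [Set.mem_ofPred_eq, Set.mem_union, Set.mem_singleton_iff, Fin.ext_iff]
  omega

theorem initIdeal_mono (x : Fin r → R) {i j : ℕ} (h : i ≤ j) : initIdeal x i ≤ initIdeal x j :=
  Ideal.span_mono (Set.image_mono fun _ hk => lt_of_lt_of_le hk h)

theorem Ideal.smul_mono_left {I J : Ideal R} (h : I ≤ J) (N : Submodule R M) : I • N ≤ J • N :=
  Submodule.smul_mono h le_rfl

theorem mem_initIdeal_succ_smul {x : Fin r → R} {i : Fin r} {N : Submodule R M} {u : M} :
    u ∈ initIdeal x (i + 1) • N ↔ ∃ v ∈ initIdeal x i • N, ∃ w ∈ N, u = v + x i • w := by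
  rw [initIdeal_succ, Submodule.sup_smul, Submodule.mem_sup]
  simp only [Submodule.ideal_span_singleton_smul, Submodule.mem_smul_pointwise_iff_exists]
  constructor
  · rintro ⟨v, hv, _, ⟨w, hw, rfl⟩, rfl⟩
    exact ⟨v, hv, w, hw, rfl⟩
  · rintro ⟨v, hv, w, hw, rfl⟩
    exact ⟨v, hv, _, ⟨w, hw, rfl⟩, rfl⟩

theorem IsDSeq.smul_mem {x : Fin r → R} (h : IsDSeq R x M) {i j : Fin r} (hij : i ≤ j) {u : M}
    (hu : x i • x j • u ∈ initIdeal x i • (⊤ : Submodule R M)) :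
    x j • u ∈ initIdeal x i • (⊤ : Submodule R M) := by
  have h1 : u ∈ Submodule.comap (LinearMap.lsmul R M (x i * x j))
        (Ideal.span (x '' {k | k < i}) • (⊤ : Submodule R M)) := by
    change (x i * x j) • u ∈ initIdeal x i • (⊤ : Submodule R M)
    rw [mul_smul]
    exact hu
  rw [h i j hij] at h1
  exact h1

theorem IsDSeq.mem_of_mem {x : Fin r → R} (h : IsDSeq R x M) (i : Fin r) {u : M}
    (hu : x i • u ∈ initIdeal x i • (⊤ : Submodule R M))
    (hQ : u ∈ Ideal.span (Set.range x) • (⊤ : Submodule R M)) :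
    u ∈ initIdeal x i • (⊤ : Submodule R M) := by
  rw [← initIdeal_self] at hQ
  suffices ∀ k : ℕ, i ≤ k → k ≤ r → u ∈ initIdeal x k • (⊤ : Submodule R M) →
    u ∈ initIdeal x i • (⊤ : Submodule R M) from this r i.2.le le_rfl hQ
  intro k hk
  induction k, hk using Nat.le_induction with
  | base => exact fun _ h => h
  | succ k hk ih =>
    intro hkr hku
    refine ih (Nat.le_of_succ_le hkr) ?_
    obtain ⟨v, hv, w, -, rfl⟩ := (mem_initIdeal_succ_smul (i := ⟨k, hkr⟩)).1 hku
    have h1 : x ⟨k, hkr⟩ • (v + x ⟨k, hkr⟩ • w) ∈ initIdeal x i • (⊤ : Submodule R M) := by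
      refine h.smul_mem (j := ⟨k, hkr⟩) hk ?_
      rw [smul_comm]
      exact Submodule.smul_mem _ _ hu
    have h2 : x ⟨k, hkr⟩ • (v + x ⟨k, hkr⟩ • w) ∈ initIdeal x k • (⊤ : Submodule R M) :=
      Ideal.smul_mono_left (initIdeal_mono x hk) _ h1
    rw [smul_add] at h2
    exact Submodule.add_mem _ hv (h.smul_mem (i := ⟨k, hkr⟩) (j := ⟨k, hkr⟩) le_rfl
      ((Submodule.add_mem_iff_right _ (Submodule.smul_mem _ _ hv)).1 h2))

theorem IsDSeq.mem_initIdeal_smul_pow {x : Fin r → R} (h : IsDSeq R x M) (n : ℕ) {i : ℕ}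
    (hi : i ≤ r) {u : M} (hu : u ∈ initIdeal x i • (⊤ : Submodule R M))
    (hQ : u ∈ Ideal.span (Set.range x) ^ (n + 1) • (⊤ : Submodule R M)) :
    u ∈ initIdeal x i • Ideal.span (Set.range x) ^ n • (⊤ : Submodule R M) := by
  induction n generalizing i u with
  | zero => simpa using hu
  | succ n ih =>
    obtain ⟨k, hk⟩ := Nat.exists_eq_add_of_le hi
    induction k generalizing i u with
    | zero =>
      obtain rfl : r = i := hk
      rwa [initIdeal_self, ← mul_smul, ← pow_succ']
    | succ k ihi =>
      have hi : i < r := by omega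
      obtain ⟨v, hv, w, hw, rfl⟩ := (mem_initIdeal_succ_smul (i := ⟨i, hi⟩)).1
        (ihi hi (Ideal.smul_mono_left (initIdeal_mono x i.le_succ) _ hu) hQ (by omega))
      refine Submodule.add_mem _ hv ?_
      have h1 : x ⟨i, hi⟩ • w ∈ initIdeal x i • (⊤ : Submodule R M) :=
        (Submodule.add_mem_iff_right _ (Submodule.smul_mono le_rfl le_top hv)).1 hu
      have h2 : w ∈ initIdeal x i • (⊤ : Submodule R M) := h.mem_of_mem ⟨i, hi⟩ h1
        (Ideal.smul_mono_left (Ideal.pow_le_self n.succ_ne_zero) _ hw)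
      have h3 := Submodule.smul_mem_smul
        (Ideal.subset_span ⟨⟨i, hi⟩, rfl⟩ : x ⟨i, hi⟩ ∈ Ideal.span (Set.range x))
        (ih hi.le h2 hw)
      rwa [← mul_smul, mul_comm, mul_smul, ← mul_smul _ _ (⊤ : Submodule R M), ← pow_succ'] at h3

theorem IsDSeq.exists_sub_of_smul_mem {x : Fin (r + 1) → R} (h : IsDSeq R x M) (n : ℕ) {u : M}
    (hu : x 0 • u ∈ Ideal.span (Set.range x) ^ (n + 1) • (⊤ : Submodule R M)) :
    ∃ v ∈ Ideal.span (Set.range x) ^ n • (⊤ : Submodule R M), x 0 • (u - v) = 0 := by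
  have h1 := h.mem_initIdeal_smul_pow n (i := (0 : Fin (r + 1)) + 1) (by simp)
    (mem_initIdeal_succ_smul.2 ⟨0, Submodule.zero_mem _, u, Submodule.mem_top, (zero_add _).symm⟩) hu
  obtain ⟨v, hv, w, hw, hvw⟩ := mem_initIdeal_succ_smul.1 h1
  refine ⟨w, hw, ?_⟩
  simp only [Fin.val_zero, initIdeal_zero, Submodule.bot_smul, Submodule.mem_bot] at hv
  rw [smul_sub, hvw, hv, zero_add, sub_self]

theorem IsDSeq.eq_zero_of_smul_eq_zero {x : Fin (r + 1) → R} (h : IsDSeq R x M) {u : M}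
    (hu : x 0 • u = 0) (hQ : u ∈ Ideal.span (Set.range x) • (⊤ : Submodule R M)) : u = 0 := by
  have := h.mem_of_mem 0 (u := u) (by rw [hu]; exact Submodule.zero_mem _) hQ
  simpa [initIdeal_zero] using this

end DSequence

end

section
open IsLocalRing Pointwise

section ConsSequence
variable {R : Type} [CommRing R] {M : Type} [AddCommGroup M] [Module R M] {r : ℕ}

theorem Submodule.sup_pow_smul_top {I J : Ideal R} (hI : I • (⊤ : Submodule R M) = ⊥) (n : ℕ) :
    (I ⊔ J) ^ n • (⊤ : Submodule R M) = J ^ n • ⊤ := by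
  induction n with
  | zero => simp
  | succ n ih =>
    rw [pow_succ', mul_smul, ih, Submodule.sup_smul, pow_succ', mul_smul, sup_eq_right]
    exact (Submodule.smul_mono le_rfl le_top).trans (hI.trans_le bot_le)

theorem span_range_cons (a : R) (y : Fin r → R) :
    Ideal.span (Set.range (Fin.cons a y : Fin (r + 1) → R)) =
      Ideal.span {a} ⊔ Ideal.span (Set.range y) := by
  rw [Fin.range_cons, Ideal.span_insert]

theorem span_singleton_smul_quotSMulTop (a : R) :
    Ideal.span {a} • (⊤ : Submodule R (QuotSMulTop a M)) = ⊥ := by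
  rw [eq_bot_iff, Submodule.smul_le]
  rintro s hs u -
  obtain ⟨b, rfl⟩ := Ideal.mem_span_singleton'.1 hs
  obtain ⟨v, rfl⟩ := Submodule.mkQ_surjective _ u
  rw [Submodule.mem_bot, mul_smul, ← map_smul, ← map_smul, Submodule.mkQ_apply,
    Submodule.Quotient.mk_eq_zero]
  exact Submodule.smul_mem _ _ (Submodule.smul_mem_pointwise_smul _ _ _ trivial)

theorem map_mkQ_smul_top (a : R) (I : Ideal R) :
    (I • (⊤ : Submodule R M)).map (a • (⊤ : Submodule R M)).mkQ = I • ⊤ := by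
  rw [Submodule.map_smul'', Submodule.map_top, Submodule.range_mkQ]

/-- The quotient of `M / aM` by a submodule `I (M / aM)`, as a quotient of `M`. -/
theorem mkQ_mem_smul_top_iff (a : R) (I : Ideal R) {u : M} :
    (a • (⊤ : Submodule R M)).mkQ u ∈ I • (⊤ : Submodule R (QuotSMulTop a M)) ↔
      ∃ v ∈ I • (⊤ : Submodule R M), ∃ w, u = v + a • w := by
  rw [← map_mkQ_smul_top, Submodule.mem_map]
  constructor
  · rintro ⟨v, hv, h⟩
    rw [eq_comm, ← sub_eq_zero, ← map_sub, Submodule.mkQ_apply, Submodule.Quotient.mk_eq_zero,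
      Submodule.mem_smul_pointwise_iff_exists] at h
    obtain ⟨w, -, hw⟩ := h
    exact ⟨v, hv, w, by rw [hw]; abel⟩
  · rintro ⟨v, hv, w, rfl⟩
    refine ⟨v, hv, ?_⟩
    rw [map_add, left_eq_add, Submodule.mkQ_apply, Submodule.Quotient.mk_eq_zero]
    exact Submodule.smul_mem_pointwise_smul _ _ _ trivial

theorem span_image_cons (a : R) (y : Fin r → R) (i : Fin r) :
    Ideal.span ((Fin.cons a y : Fin (r + 1) → R) '' {k | k < i.succ}) =
      Ideal.span {a} ⊔ Ideal.span (y '' {k | k < i}) := by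
  rw [← Ideal.span_union]
  congr 1
  ext b
  simp only [Set.mem_image, Set.mem_union, Set.mem_singleton_iff, Fin.exists_fin_succ,
    Set.mem_ofPred_eq, Fin.cons_zero, Fin.cons_succ, Fin.succ_lt_succ_iff, Fin.succ_pos, true_and]
  rw [eq_comm]

theorem IsDSeq.cons {a : R} {y : Fin r → R} (hy : IsDSeq R y (QuotSMulTop a M))
    (haa : ∀ u : M, a • a • u = 0 → a • u = 0)
    (hay : ∀ j, ∀ u : M, a • y j • u = 0 → y j • u = 0) :
    IsDSeq R (Fin.cons a y : Fin (r + 1) → R) M := by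
  intro i j hij
  refine le_antisymm ?_ ?_
  · intro u hu
    rw [Submodule.mem_comap, LinearMap.lsmul_apply] at hu ⊢
    induction i using Fin.cases with
    | zero =>
      have h0 : {k : Fin (r + 1) | k < 0} = ∅ := by ext; simp
      rw [h0, Set.image_empty, Ideal.span_empty, Submodule.bot_smul, Submodule.mem_bot] at hu ⊢
      rw [mul_smul] at hu
      induction j using Fin.cases with
      | zero => exact haa u hu
      | succ j => exact hay j u hu
    | succ i =>
      induction j using Fin.cases with
      | zero => simp at hij
      | succ j =>
        have key : ∀ v : M, v ∈ Ideal.span ((Fin.cons a y : Fin (r + 1) → R) '' {k | k < i.succ}) •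
            (⊤ : Submodule R M) ↔ (a • (⊤ : Submodule R M)).mkQ v ∈
              Ideal.span (y '' {k | k < i}) • (⊤ : Submodule R (QuotSMulTop a M)) := by
          intro v
          rw [mkQ_mem_smul_top_iff, span_image_cons, Submodule.sup_smul, sup_comm,
            Submodule.mem_sup]
          simp [Submodule.ideal_span_singleton_smul, Submodule.mem_smul_pointwise_iff_exists,
            eq_comm]
        rw [key, map_smul] at hu ⊢
        exact (hy i j (Fin.succ_le_succ_iff.1 hij)).le hu
  · intro u hu
    rw [Submodule.mem_comap, LinearMap.lsmul_apply] at hu ⊢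
    rw [mul_smul]
    exact Submodule.smul_mem _ _ hu

variable {a : R} {y : Fin r → R}

theorem sup_pow_le_comap (a : R) (J : Ideal R) (n : ℕ) :
    (Ideal.span {a} ⊔ J) ^ n • (⊤ : Submodule R M) ≤
      (J ^ n • (⊤ : Submodule R (QuotSMulTop a M))).comap (a • (⊤ : Submodule R M)).mkQ := by
  rw [← Submodule.map_le_iff_le_comap, map_mkQ_smul_top]
  exact (Submodule.sup_pow_smul_top (span_singleton_smul_quotSMulTop a) n).le

/-- The projection from `M / (a, J)ⁿ M` to `(M / aM) / Jⁿ (M / aM)`. -/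
noncomputable def quotPowMap (M : Type) [AddCommGroup M] [Module R M] (a : R) (J : Ideal R)
    (n : ℕ) :
    (M ⧸ (Ideal.span {a} ⊔ J) ^ n • (⊤ : Submodule R M)) →ₗ[R]
      (QuotSMulTop a M ⧸ J ^ n • (⊤ : Submodule R (QuotSMulTop a M))) :=
  Submodule.mapQ _ _ (a • (⊤ : Submodule R M)).mkQ (sup_pow_le_comap a J n)

theorem quotPowMap_surjective (a : R) (J : Ideal R) (n : ℕ) :
    Function.Surjective (quotPowMap M a J n) := by
  intro z
  obtain ⟨z, rfl⟩ := Submodule.mkQ_surjective _ z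
  obtain ⟨z, rfl⟩ := Submodule.mkQ_surjective _ z
  exact ⟨Submodule.Quotient.mk z, rfl⟩

theorem exact_quotPowMap (a : R) (J : Ideal R) (n : ℕ) :
    Function.Exact (Submodule.mkQ ((Ideal.span {a} ⊔ J) ^ n • (⊤ : Submodule R M)) ∘ₗ
      LinearMap.lsmul R M a) (quotPowMap M a J n) := by
  intro z
  obtain ⟨z, rfl⟩ := Submodule.mkQ_surjective _ z
  have h1 : quotPowMap M a J n (Submodule.mkQ _ z) =
    Submodule.Quotient.mk ((a • (⊤ : Submodule R M)).mkQ z) := rfl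
  rw [h1, Submodule.Quotient.mk_eq_zero, mkQ_mem_smul_top_iff]
  constructor
  · rintro ⟨v, hv, w, rfl⟩
    refine ⟨w, ?_⟩
    rw [map_add, LinearMap.comp_apply, LinearMap.lsmul_apply, right_eq_add, Submodule.mkQ_apply,
      Submodule.Quotient.mk_eq_zero]
    exact Ideal.smul_mono_left (Ideal.pow_right_mono le_sup_right n) _ hv
  · rintro ⟨w, hw⟩
    rw [LinearMap.comp_apply, LinearMap.lsmul_apply, eq_comm, ← sub_eq_zero, ← map_sub,
      Submodule.mkQ_apply, Submodule.Quotient.mk_eq_zero] at hw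
    obtain ⟨v, hv, w', hw'⟩ := (mkQ_mem_smul_top_iff a (J ^ n)).1 (sup_pow_le_comap a J n hw)
    exact ⟨v, hv, w + w', by rw [smul_add, add_left_comm, ← hw']; abel⟩

end ConsSequence

end

section
open IsLocalRing Pointwise

section HilbertFunction
variable {R : Type} [CommRing R] {M : Type} [AddCommGroup M] [Module R M] {r : ℕ}
  {a : R} {y : Fin r → R}

/-- The Hilbert–Samuel function `n ↦ λ(M / Iⁿ⁺¹ M)`. -/
noncomputable def hilbFun (R : Type) [CommRing R] (I : Ideal R) (M : Type) [AddCommGroup M]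
    [Module R M] (n : ℕ) : ℕ∞ :=
  Module.length R (M ⧸ I ^ (n + 1) • (⊤ : Submodule R M))

theorem hilbFun_eq_of_isEmpty (y : Fin 0 → R) (n : ℕ) :
    hilbFun R (Ideal.span (Set.range y)) M n = hilbFun R (Ideal.span (Set.range y)) M 0 := by
  have h : Ideal.span (Set.range y) ^ (n + 1) = Ideal.span (Set.range y) ^ (0 + 1) := by
    simp [Set.range_eq_empty]
  rw [hilbFun, hilbFun, h]

theorem hilbFun_cons_zero :
    hilbFun R (Ideal.span (Set.range (Fin.cons a y : Fin (r + 1) → R))) M 0 =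
      hilbFun R (Ideal.span (Set.range y)) (QuotSMulTop a M) 0 := by
  rw [span_range_cons]
  refine LinearEquiv.length_eq (.ofBijective (quotPowMap M a _ (0 + 1)) ⟨?_,
    quotPowMap_surjective _ _ _⟩)
  rw [← LinearMap.ker_eq_bot, (exact_quotPowMap a _ (0 + 1)).linearMap_ker_eq, eq_bot_iff]
  rintro _ ⟨w, rfl⟩
  rw [LinearMap.comp_apply, Submodule.mem_bot, Submodule.mkQ_apply, Submodule.Quotient.mk_eq_zero,
    zero_add, pow_one]
  exact Submodule.smul_mem_smul (le_sup_left (a := Ideal.span {a})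
    (Ideal.mem_span_singleton_self a)) trivial

theorem hilbFun_cons_succ (h : IsDSeq R (Fin.cons a y : Fin (r + 1) → R) M) (n : ℕ) :
    hilbFun R (Ideal.span (Set.range (Fin.cons a y : Fin (r + 1) → R))) M (n + 1) +
        Module.length R (LinearMap.ker (LinearMap.lsmul R M a)) =
      hilbFun R (Ideal.span (Set.range y)) (QuotSMulTop a M) (n + 1) +
        hilbFun R (Ideal.span (Set.range (Fin.cons a y : Fin (r + 1) → R))) M n := by
  have key := fun u : M => h.exists_sub_of_smul_mem (n + 1) (u := u)
  have key0 := fun u : M => h.eq_zero_of_smul_eq_zero (u := u)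
  simp only [span_range_cons] at key key0 ⊢
  set Q := Ideal.span {a} ⊔ Ideal.span (Set.range y) with hQ
  simp only [Fin.cons_zero] at key key0
  have haQ : a ∈ Q := le_sup_left (a := Ideal.span {a}) (Ideal.mem_span_singleton_self a)
  let f : M →ₗ[R] (M ⧸ Q ^ (n + 1 + 1) • (⊤ : Submodule R M)) :=
    Submodule.mkQ _ ∘ₗ LinearMap.lsmul R M a
  have hf : ∀ u, f u = 0 ↔ a • u ∈ Q ^ (n + 1 + 1) • (⊤ : Submodule R M) := fun u =>
    Submodule.Quotient.mk_eq_zero _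
  have hle : Q ^ (n + 1) • (⊤ : Submodule R M) ≤ LinearMap.ker f := by
    intro u hu
    rw [LinearMap.mem_ker, hf, pow_succ', mul_smul]
    exact Submodule.smul_mem_smul haQ hu
  let g := Submodule.liftQ _ f hle
  let W := LinearMap.ker (LinearMap.lsmul R M a)
  have hW : ∀ u, u ∈ W ↔ a • u = 0 := fun u => Iff.rfl
  have e1 : Module.length R (M ⧸ Q ^ (n + 1) • (⊤ : Submodule R M)) =
      Module.length R W + Module.length R (LinearMap.range g) := by
    refine Module.length_eq_add_of_exact (Submodule.mkQ _ ∘ₗ W.subtype) g.rangeRestrict ?_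
      g.surjective_rangeRestrict ?_
    · rw [← LinearMap.ker_eq_bot, eq_bot_iff]
      rintro ⟨u, hu⟩ hu'
      have : u ∈ Q ^ (n + 1) • (⊤ : Submodule R M) := (Submodule.Quotient.mk_eq_zero _).1 hu'
      exact Subtype.ext (key0 u hu
        (Ideal.smul_mono_left (Ideal.pow_le_self n.succ_ne_zero) _ this))
    · intro z
      obtain ⟨u, rfl⟩ := Submodule.mkQ_surjective _ z
      have h1 : g.rangeRestrict (Submodule.mkQ _ u) = 0 ↔ f u = 0 := Subtype.ext_iff
      rw [h1, hf]
      constructor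
      · intro hu
        obtain ⟨v, hv, huv⟩ := key u hu
        refine ⟨⟨u - v, huv⟩, ?_⟩
        exact (Submodule.Quotient.eq _).2 (by simpa using hv)
      · rintro ⟨⟨w, hw⟩, hwu⟩
        have := (Submodule.Quotient.eq _).1 hwu
        rw [← hf]
        have h2 := hle this
        have h3 : f w = 0 := by rw [hf, (hW w).1 hw]; exact Submodule.zero_mem _
        rw [LinearMap.mem_ker, map_sub] at h2
        change f w - f u = 0 at h2
        rwa [h3, zero_sub, neg_eq_zero] at h2
  have e2 : Module.length R (M ⧸ Q ^ (n + 1 + 1) • (⊤ : Submodule R M)) =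
      Module.length R (LinearMap.range g) + Module.length R (QuotSMulTop a M ⧸
        Ideal.span (Set.range y) ^ (n + 1 + 1) • (⊤ : Submodule R (QuotSMulTop a M))) := by
    refine Module.length_eq_add_of_exact (LinearMap.range g).subtype (quotPowMap M a _ (n + 1 + 1))
      (Submodule.subtype_injective _) (quotPowMap_surjective _ _ _) ?_
    rw [LinearMap.exact_iff, (exact_quotPowMap a _ (n + 1 + 1)).linearMap_ker_eq,
      Submodule.range_subtype]
    exact (Submodule.range_liftQ _ _ _).symm
  change Module.length R (M ⧸ Q ^ (n + 1 + 1) • (⊤ : Submodule R M)) + Module.length R W =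
    Module.length R (QuotSMulTop a M ⧸
        Ideal.span (Set.range y) ^ (n + 1 + 1) • (⊤ : Submodule R (QuotSMulTop a M))) +
    Module.length R (M ⧸ Q ^ (n + 1) • (⊤ : Submodule R M))
  rw [e1, e2]
  ring

theorem hilbPoly_succ_sub (r : ℕ) (e : ℕ → ℤ) (n : ℕ) :
    ∑ i ∈ Finset.range (r + 1 + 1), (-1 : ℤ) ^ i * e i *
        ((n + 1 + (r + 1) - i).choose (r + 1 - i) : ℤ) =
      ∑ i ∈ Finset.range (r + 1 + 1), (-1 : ℤ) ^ i * e i *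
        ((n + (r + 1) - i).choose (r + 1 - i) : ℤ) +
      ∑ i ∈ Finset.range (r + 1), (-1 : ℤ) ^ i * e i * ((n + 1 + r - i).choose (r - i) : ℤ) := by
  rw [Finset.sum_range_succ _ (r + 1), Finset.sum_range_succ _ (r + 1),
    add_right_comm (∑ i ∈ _, _), ← Finset.sum_add_distrib]
  congr 1
  · refine Finset.sum_congr rfl fun i hi => ?_
    have hi : i < r + 1 := Finset.mem_range.1 hi
    rw [show n + 1 + (r + 1) - i = n + 1 + r - i + 1 by omega,
      show r + 1 - i = r - i + 1 by omega, Nat.choose_succ_succ,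
      show n + (r + 1) - i = n + 1 + r - i by omega]
    push_cast
    ring
  · simp

/-- A function with prescribed first differences is of Hilbert type. -/
theorem exists_hilbPoly_of_sub {F G : ℕ → ℤ} {w : ℤ} {r N : ℕ} {e : ℕ → ℤ}
    (hFG : ∀ n, F (n + 1) + w = G (n + 1) + F n)
    (hG : ∀ n ≥ N, G n = ∑ i ∈ Finset.range (r + 1), (-1 : ℤ) ^ i * e i *
      ((n + r - i).choose (r - i) : ℤ)) :
    ∃ e' : ℕ → ℤ, (∀ i < r, e' i = e i) ∧ (-1 : ℤ) ^ r * e' r = (-1) ^ r * e r - w ∧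
      ∀ n ≥ N, F n = ∑ i ∈ Finset.range (r + 1 + 1), (-1 : ℤ) ^ i * e' i *
        ((n + (r + 1) - i).choose (r + 1 - i) : ℤ) := by
  let e₀ : ℕ → ℤ := fun i => if i = r then e r - (-1) ^ r * w else e i
  have hsq : ((-1 : ℤ) ^ r * (-1) ^ r) = 1 := by rw [← mul_pow]; simp
  have hsq' : ((-1 : ℤ) ^ (r + 1) * (-1) ^ (r + 1)) = 1 := by rw [← mul_pow]; simp
  let c := F N - ∑ i ∈ Finset.range (r + 1), (-1 : ℤ) ^ i * e₀ i *
        ((N + (r + 1) - i).choose (r + 1 - i) : ℤ)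
  let e' : ℕ → ℤ := fun i => if i = r + 1 then (-1) ^ (r + 1) * c else e₀ i
  have he' : ∀ i ∈ Finset.range (r + 1), e' i = e₀ i := fun i hi =>
    if_neg (Finset.mem_range.1 hi).ne
  have her : (-1 : ℤ) ^ r * e₀ r = (-1) ^ r * e r - w := by
    simp only [e₀, if_true, mul_sub, ← mul_assoc, hsq, one_mul]
  refine ⟨e', fun i hi => ?_, ?_, fun n hn => ?_⟩
  · rw [he' i (Finset.mem_range.2 (by omega))]
    exact if_neg hi.ne
  · rw [he' r (by simp), her]
  · induction n, hn using Nat.le_induction with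
    | base =>
      rw [Finset.sum_range_succ, Finset.sum_congr rfl fun i hi => by rw [he' i hi]]
      simp only [e', if_true, ← mul_assoc, hsq', one_mul, c]
      simp
    | succ n hn ih =>
      rw [hilbPoly_succ_sub, ← ih]
      have h1 := hG (n + 1) (by omega)
      have h2 : ∑ i ∈ Finset.range (r + 1), (-1 : ℤ) ^ i * e' i *
          ((n + 1 + r - i).choose (r - i) : ℤ) = G (n + 1) - w := by
        rw [h1, Finset.sum_range_succ, Finset.sum_range_succ, he' r (by simp), her]
        rw [Finset.sum_congr rfl fun i hi => by
          rw [he' i (Finset.mem_range.2 ((Finset.mem_range.1 hi).trans r.lt_succ_self)),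
            show e₀ i = e i from if_neg (Finset.mem_range.1 hi).ne]]
        simp
        ring
      linarith [hFG n]

end HilbertFunction

end

section
open IsLocalRing Pointwise

section HilbertDSequence
variable {R : Type} [CommRing R] [IsLocalRing R] {M : Type} [AddCommGroup M] [Module R M] {r : ℕ}
  {a : R} {y : Fin r → R}

/-- `x` is a d-sequence in the maximal ideal with finite Hilbert–Samuel function,
whose Hilbert coefficients are `e`. -/
structure IsHilbDSeq (x : Fin r → R) (M : Type) [AddCommGroup M] [Module R M] (e : ℕ → ℤ) :
    Prop where
  mem : ∀ k, x k ∈ maximalIdeal R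
  isDSeq : IsDSeq R x M
  ne_top : ∀ n, hilbFun R (Ideal.span (Set.range x)) M n ≠ ⊤
  eq_sum : ∃ N, ∀ n ≥ N, ((hilbFun R (Ideal.span (Set.range x)) M n).toNat : ℤ) =
    ∑ i ∈ Finset.range (r + 1), (-1 : ℤ) ^ i * e i * ((n + r - i).choose (r - i) : ℤ)

theorem IsHilbDSeq.isParamIdeal {x : Fin r → R} {e : ℕ → ℤ} (h : IsHilbDSeq x M e) :
    IsParamIdeal R (Ideal.span (Set.range x)) M r := by
  refine ⟨?_, ⟨x, rfl⟩, ?_⟩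
  · rw [Ideal.span_le]
    rintro _ ⟨k, rfl⟩
    exact h.mem k
  · have := h.ne_top 0
    rw [hilbFun, zero_add, pow_one] at this
    exact Module.length_ne_top_iff.1 this

theorem IsHilbDSeq.hasHilbCoeffs {x : Fin r → R} {e : ℕ → ℤ} (h : IsHilbDSeq x M e) :
    HasHilbCoeffs R (Ideal.span (Set.range x)) M r e := by
  obtain ⟨N, hN⟩ := h.eq_sum
  refine ⟨N, fun n hn => ⟨_, ?_, hN n hn⟩⟩
  change mLength R _ = _
  rw [mLength, ← Module.coe_length]
  congr 1
  exact (ENat.natCast_toNat (h.ne_top n)).symm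

theorem IsDSeq.of_isGoodFor {x : R} (hx : IsGoodFor M a) (hxx : IsGoodFor M x) [IsNoetherian R M]
    {u : M} (hu : a • x • u = 0) : x • u = 0 :=
  hxx.smul_eq_zero ((hx _).1 hu)

theorem ker_lsmul_of_isGoodFor (ha : IsGoodFor M a) :
    LinearMap.ker (LinearMap.lsmul R M a) = powTorsion (maximalIdeal R) M := by
  ext u
  exact ha u

variable [IsNoetherianRing R] [Module.Finite R M]

theorem isFiniteLength_powTorsion (M : Type) [AddCommGroup M] [Module R M] [Module.Finite R M] :
    IsFiniteLength R (powTorsion (maximalIdeal R) M) := by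
  apply isFiniteLength_of_supportDim
  obtain ⟨t, ht⟩ := exists_pow_smul_powTorsion (maximalIdeal R) (M := M)
  have h : maximalIdeal R ^ t ≤ Module.annihilator R (powTorsion (maximalIdeal R) M) :=
    fun a ha => Module.mem_annihilator.2 fun u => Subtype.ext (ht a ha u u.2)
  have : Subsingleton (Module.support R (powTorsion (maximalIdeal R) M)) := by
    have key : ∀ p ∈ Module.support R (powTorsion (maximalIdeal R) M),
        p.asIdeal = maximalIdeal R := by
      intro p hp
      rw [Module.support_eq_zeroLocus, PrimeSpectrum.mem_zeroLocus] at hp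
      exact ((maximalIdeal.isMaximal R).eq_of_le p.2.ne_top (p.2.le_of_pow_le (h.trans hp))).symm
    exact ⟨fun p q => Subtype.ext (PrimeSpectrum.ext ((key p p.2).trans (key q q.2).symm))⟩
  exact Order.krullDim_nonpos_of_subsingleton

/-- Hilbert coefficients pass from `M / aM` to `M`. -/
theorem IsHilbDSeq.cons {e : ℕ → ℤ} (h : IsHilbDSeq y (QuotSMulTop a M) e)
    (ham : a ∈ maximalIdeal R) (ha : IsGoodFor M a) (hy : ∀ j, IsGoodFor M (y j)) :
    ∃ e', IsHilbDSeq (Fin.cons a y : Fin (r + 1) → R) M e' ∧ (∀ i < r, e' i = e i) ∧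
      (-1) ^ r * e' r = (-1) ^ r * e r -
        (Module.length R (powTorsion (maximalIdeal R) M)).toNat ∧
      (r = 0 → e' 1 = - (Module.length R (powTorsion (maximalIdeal R) M)).toNat) := by
  have hd : IsDSeq R (Fin.cons a y : Fin (r + 1) → R) M :=
    h.isDSeq.cons (fun u => IsDSeq.of_isGoodFor ha ha) fun j u => IsDSeq.of_isGoodFor ha (hy j)
  have hw := Module.length_ne_top_iff.2 (isFiniteLength_powTorsion (R := R) M)
  have h0 := hilbFun_cons_zero (M := M) (a := a) (y := y)
  have hs := hilbFun_cons_succ hd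
  rw [ker_lsmul_of_isGoodFor ha] at hs
  have hfin : ∀ n, hilbFun R (Ideal.span (Set.range (Fin.cons a y : Fin (r + 1) → R))) M n ≠ ⊤ := by
    intro n
    induction n with
    | zero => rw [h0]; exact h.ne_top 0
    | succ n ih =>
      intro hn
      have := hs n
      rw [hn, top_add] at this
      exact WithTop.add_ne_top.2 ⟨h.ne_top _, ih⟩ this.symm
  obtain ⟨N, hN0, hN⟩ : ∃ N, (r = 0 → N = 0) ∧
      ∀ n ≥ N, ((hilbFun R (Ideal.span (Set.range y)) (QuotSMulTop a M) n).toNat : ℤ) =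
        ∑ i ∈ Finset.range (r + 1), (-1 : ℤ) ^ i * e i * ((n + r - i).choose (r - i) : ℤ) := by
    obtain ⟨N, hN⟩ := h.eq_sum
    by_cases hr : r = 0
    · subst hr
      refine ⟨0, fun _ => rfl, fun n _ => ?_⟩
      rw [hilbFun_eq_of_isEmpty, ← hilbFun_eq_of_isEmpty y N, hN N le_rfl]
      simp
    · exact ⟨N, fun h => absurd h hr, hN⟩
  set w := (Module.length R (powTorsion (maximalIdeal R) M)).toNat with hwd
  have hF : ∀ n, ((hilbFun R (Ideal.span (Set.range (Fin.cons a y : Fin (r + 1) → R))) M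
      (n + 1)).toNat : ℤ) + w = ((hilbFun R (Ideal.span (Set.range y)) (QuotSMulTop a M)
      (n + 1)).toNat : ℤ) + ((hilbFun R (Ideal.span (Set.range (Fin.cons a y : Fin (r + 1) → R)))
      M n).toNat : ℤ) := by
    intro n
    have := congrArg ENat.toNat (hs n)
    rw [ENat.toNat_add (hfin _) hw, ENat.toNat_add (h.ne_top _) (hfin _)] at this
    exact_mod_cast this
  have hmem : ∀ k, (Fin.cons a y : Fin (r + 1) → R) k ∈ maximalIdeal R := by
    intro k
    induction k using Fin.cases with
    | zero => exact ham
    | succ k => exact h.mem k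
  obtain ⟨e', he, her, heN⟩ := exists_hilbPoly_of_sub (w := (w : ℤ))
    (F := fun n => ((hilbFun R (Ideal.span (Set.range (Fin.cons a y : Fin (r + 1) → R)))
      M n).toNat : ℤ))
    (G := fun n => ((hilbFun R (Ideal.span (Set.range y)) (QuotSMulTop a M) n).toNat : ℤ)) hF hN
  refine ⟨e', ⟨hmem, hd, hfin, N, heN⟩, he, her, ?_⟩
  rintro rfl
  obtain rfl := hN0 rfl
  have h1 := hN 0 le_rfl
  have h2 := heN 0 le_rfl
  simp only [h0, h1] at h2
  simp [Finset.sum_range_succ] at h2 her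
  linarith

end HilbertDSequence

end

section
open IsLocalRing Pointwise

section TorsionBound
variable {R : Type} [CommRing R] [IsLocalRing R]

theorem smul_eq_zero_of_length_le [IsNoetherianRing R] (ℓ : ℕ) {N : Type} [AddCommGroup N]
    [Module R N] (h : Module.length R N ≤ ℓ) {a : R} (ha : a ∈ maximalIdeal R ^ ℓ) (u : N) :
    a • u = 0 := by
  induction ℓ generalizing N a with
  | zero =>
    have : Subsingleton N := Module.length_eq_zero_iff.1 (by simpa using h)
    exact Subsingleton.elim _ _
  | succ ℓ ih =>
    obtain hN | hN := subsingleton_or_nontrivial N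
    · exact Subsingleton.elim _ _
    have hfin : IsFiniteLength R N := Module.length_ne_top_iff.1 (ne_top_of_le_ne_top (by simp) h)
    obtain ⟨h1, h2⟩ := isFiniteLength_iff_isNoetherian_isArtinian.1 hfin
    have hne : maximalIdeal R • (⊤ : Submodule R N) ≠ ⊤ := by
      intro htop
      have := Submodule.eq_bot_of_le_smul_of_le_jacobson_bot (maximalIdeal R) (⊤ : Submodule R N)
        (IsNoetherian.noetherian _) htop.ge (maximalIdeal_le_jacobson _)
      exact top_ne_bot this
    have hlt := (Submodule.length_lt hne).trans_le h
    have hle : Module.length R ↥(maximalIdeal R • (⊤ : Submodule R N)) ≤ ℓ := by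
      push_cast at hlt
      exact Order.le_of_lt_add_one hlt
    rw [pow_succ] at ha
    induction ha using Submodule.mul_induction_on' with
    | mem_mul_mem b hb c hc =>
      rw [mul_smul]
      exact congrArg Subtype.val
        (ih hle hb ⟨c • u, Submodule.smul_mem_smul hc Submodule.mem_top⟩)
    | add b _ c _ hb hc => rw [add_smul, hb, hc, add_zero]

/-- Modulo `n + 1` generic elements, the power `mˡ` of the maximal ideal multiplies the torsion
of the module into the torsion of the preceding quotient. -/
def TorsionBound (H : Filter R) (ℓ : ℕ) : ℕ → ∀ (M : Type) [AddCommGroup M] [Module R M], Prop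
  | 0, M, _, _ => ∀ᶠ x in H, ∀ c ∈ maximalIdeal R ^ ℓ,
      ∀ u ∈ powTorsion (maximalIdeal R) (QuotSMulTop x M),
        ∃ w ∈ powTorsion (maximalIdeal R) M, c • u = (x • (⊤ : Submodule R M)).mkQ w
  | n + 1, M, _, _ => ∀ᶠ x in H, TorsionBound H ℓ n (QuotSMulTop x M)

theorem isHilbDSeq_of_isFiniteLength {M : Type} [AddCommGroup M] [Module R M]
    (h : IsFiniteLength R M) (y : Fin 0 → R) : ∃ e, IsHilbDSeq y M e := by
  have hne : ∀ n, hilbFun R (Ideal.span (Set.range y)) M n ≠ ⊤ := fun n =>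
    Module.length_ne_top_iff.2 (h.of_surjective (Submodule.mkQ_surjective _))
  refine ⟨fun _ => ((hilbFun R (Ideal.span (Set.range y)) M 0).toNat : ℤ), fun k => k.elim0,
    fun i => i.elim0, hne, 0, fun n _ => ?_⟩
  rw [hilbFun_eq_of_isEmpty]
  simp

variable [IsNoetherianRing R]

theorem forall_smul_mem_of_length_le {M : Type} [AddCommGroup M] [Module R M] [Module.Finite R M]
    {a : R} (ha : IsGoodFor M a) {ℓ : ℕ}
    (h : ((Module.length R (powTorsion (maximalIdeal R) (QuotSMulTop a M))).toNat : ℤ) ≤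
      (Module.length R (powTorsion (maximalIdeal R) M)).toNat + ℓ) :
    ∀ c ∈ maximalIdeal R ^ ℓ, ∀ u ∈ powTorsion (maximalIdeal R) (QuotSMulTop a M),
      ∃ w ∈ powTorsion (maximalIdeal R) M, c • u = (a • (⊤ : Submodule R M)).mkQ w := by
  have hw := Module.length_ne_top_iff.2 (isFiniteLength_powTorsion (R := R) M)
  have hw' := Module.length_ne_top_iff.2 (isFiniteLength_powTorsion (R := R) (QuotSMulTop a M))
  let f : powTorsion (maximalIdeal R) M →ₗ[R] powTorsion (maximalIdeal R) (QuotSMulTop a M) :=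
    LinearMap.codRestrict _ ((a • (⊤ : Submodule R M)).mkQ ∘ₗ Submodule.subtype _)
      fun u => map_mem_powTorsion (a • (⊤ : Submodule R M)).mkQ u.2
  have hf : Function.Injective f := by
    rw [← LinearMap.ker_eq_bot, eq_bot_iff]
    rintro ⟨u, hu⟩ hu'
    obtain ⟨v, -, rfl⟩ := (Submodule.mem_smul_pointwise_iff_exists _ _ _).1
      ((Submodule.Quotient.mk_eq_zero _).1 (congrArg Subtype.val hu'))
    exact Subtype.ext (ha.smul_eq_zero hu)
  have hlen := Module.length_eq_add_of_exact f (LinearMap.range f).mkQ hf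
    (Submodule.mkQ_surjective _) (LinearMap.exact_map_mkQ_range f)
  have hC : Module.length R (_ ⧸ LinearMap.range f) ≠ ⊤ := fun h0 =>
    hw' (by rw [hlen, h0, add_top])
  have hle : Module.length R (_ ⧸ LinearMap.range f) ≤ ℓ := by
    rw [← ENat.natCast_toNat hC]
    rw [hlen, ENat.toNat_add hw hC] at h
    push_cast at h
    exact_mod_cast (show ((Module.length R (_ ⧸ LinearMap.range f)).toNat : ℤ) ≤ ℓ by linarith)
  intro c hc u hu
  have h1 := smul_eq_zero_of_length_le ℓ hle hc ((LinearMap.range f).mkQ ⟨u, hu⟩)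
  rw [← map_smul, Submodule.mkQ_apply, Submodule.Quotient.mk_eq_zero] at h1
  obtain ⟨w, hw⟩ := h1
  exact ⟨w, w.2, (congrArg Subtype.val hw).symm⟩

theorem torsionBound_of_forall_isHilbDSeq {H : Filter R} [H.NeBot]
    (hH : H ≤ genericFilter R) (ℓ n : ℕ) (M : Type)
    [AddCommGroup M] [Module R M] [Module.Finite R M]
    (hd : Module.supportDim R M ≤ (n + 2 : ℕ)) {V : Set R} (hV : V ∈ H)
    (h : ∀ (x : Fin (n + 2) → R) (e : ℕ → ℤ), (∀ k, x k ∈ V) → IsHilbDSeq x M e →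
      -(ℓ : ℤ) ≤ e 1) :
    TorsionBound H ℓ n M := by
  induction n generalizing M V with
  | zero =>
    have e1 := hH (eventually_isGoodFor M)
    have e2 := hH (supportDim_quotSMulTop_le (M := M) 1 hd)
    have e3 := hH (eventually_mem_maximalIdeal (R := R))
    filter_upwards [hV, e1, e2, e3] with a haV ha hda ham
    obtain ⟨b, hbV, hb, hb', hdb, hbm⟩ := (Filter.Eventually.and hV <| Filter.Eventually.and e1 <|
      Filter.Eventually.and (hH (eventually_isGoodFor (QuotSMulTop a M))) <|
      Filter.Eventually.and (hH (supportDim_quotSMulTop_le (M := QuotSMulTop a M) 0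
        (by simpa using hda))) e3).exists
    obtain ⟨e₀, h0⟩ := isHilbDSeq_of_isFiniteLength
      (isFiniteLength_of_supportDim (by simpa using hdb)) Fin.elim0
    obtain ⟨e₁, h1, -, -, he₁⟩ := h0.cons hbm hb' (fun j => j.elim0)
    obtain ⟨e₂, h2, -, he₂, -⟩ := h1.cons ham ha (fun j => by
      induction j using Fin.cases with
      | zero => exact hb
      | succ j => exact j.elim0)
    have hle := h _ e₂ (fun k => by
      induction k using Fin.cases with
      | zero => exact haV
      | succ k =>
        induction k using Fin.cases with
        | zero => exact hbV
        | succ k => exact k.elim0) h2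
    rw [he₁ rfl] at he₂
    simp only [zero_add, pow_one, neg_one_mul] at he₂
    exact forall_smul_mem_of_length_le ha (by linarith)
  | succ n ih =>
    have e1 := hH (eventually_isGoodFor M)
    have e2 := hH (supportDim_quotSMulTop_le (M := M) (n + 2) hd)
    have e3 := hH (eventually_mem_maximalIdeal (R := R))
    filter_upwards [hV, e1, e2, e3] with a haV ha hda ham
    refine ih (QuotSMulTop a M) hda (Filter.inter_mem hV e1) fun y e hy he => ?_
    obtain ⟨e', h', he', -⟩ := he.cons ham ha fun j => (hy j).2
    rw [← he' 1 (by omega)]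
    refine h _ e' (fun k => ?_) h'
    induction k using Fin.cases with
    | zero => exact haV
    | succ k => exact (hy k).1

end TorsionBound

end

noncomputable section
open CategoryTheory IsLocalRing Pointwise

namespace localCohomology
variable {R : Type} [CommRing R] [IsLocalRing R] [IsNoetherianRing R]

/-- The local cohomology sequence of an element generic for `M`. -/
theorem exists_connecting {M : Type} [AddCommGroup M] [Module R M] [Module.Finite R M] {x : R}
    (hx : IsGoodFor M x) (i : ℕ) :
    ∃ D : (localCohomology (maximalIdeal R) i).obj (ModuleCat.of R (QuotSMulTop x M)) →ₗ[R]
        (localCohomology (maximalIdeal R) (i + 1)).obj (ModuleCat.of R M),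
      (∀ z, x • z = 0 → z ∈ LinearMap.range D) ∧
      (∀ v, D (hmap (maximalIdeal R) i (x • (⊤ : Submodule R M)).mkQ v) = 0) ∧
      ∀ z, hmap (maximalIdeal R) (i + 1) (x • (⊤ : Submodule R M)).mkQ z = 0 →
        ∃ w, z = x • w := by
  let W := powTorsion (maximalIdeal R) M
  let f : (M ⧸ W) →ₗ[R] M := W.liftQ (LinearMap.lsmul R M x) fun u hu => (hx u).2 hu
  have hf : Function.Injective f := by
    rw [← LinearMap.ker_eq_bot]
    exact Submodule.ker_liftQ_eq_bot _ _ _ fun u hu => (hx u).1 hu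
  have hcomp : f ∘ₗ W.mkQ = LinearMap.lsmul R M x := Submodule.liftQ_mkQ _ _ _
  have hg := Submodule.mkQ_surjective (x • (⊤ : Submodule R M))
  have hfg : Function.Exact f (x • (⊤ : Submodule R M)).mkQ := by
    rw [LinearMap.exact_iff, (exact_lsmul_mkQ M x).linearMap_ker_eq]
    exact (Submodule.range_liftQ _ _ _).symm
  let e := LinearEquiv.ofBijective _
    (hmap_mkQ_powTorsion_bijective (M := M) (J := maximalIdeal R) i)
  have he : ∀ z, hmap (maximalIdeal R) (i + 1) f (e z) = x • z := by
    intro z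
    refine Eq.trans (hmap_comp (i + 1) W.mkQ f z).symm ?_
    rw [hcomp, hmap_lsmul]
  refine ⟨e.symm.toLinearMap ∘ₗ delta (maximalIdeal R) hf hfg hg i, fun z hz => ?_, fun v => ?_,
    fun z hz => ?_⟩
  · rw [← he] at hz
    obtain ⟨w, hw⟩ := (exact_delta_hmap hf hfg hg i _).1 hz
    refine ⟨w, ?_⟩
    change e.symm _ = z
    rw [hw, LinearEquiv.symm_apply_apply]
  · change e.symm _ = 0
    rw [(exact_hmap_delta hf hfg hg i _).2 ⟨v, rfl⟩, map_zero]
  · obtain ⟨w, rfl⟩ := (hmap_exact hf hfg hg (i + 1) z).1 hz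
    obtain ⟨w, rfl⟩ := e.surjective w
    exact ⟨w, he w⟩

omit [IsLocalRing R] in
theorem finite_zero {J : Ideal R} (M : Type) [AddCommGroup M] [Module R M] [Module.Finite R M] :
    Module.Finite R ((localCohomology J 0).obj (ModuleCat.of R M)) :=
  Module.Finite.equiv (zeroEquiv J M).symm

/-- Torsion bounds for all quotients by generic elements of length at most `n`. -/
def _root_.HasTorsionBounds (H : Filter R) :
    ℕ → ∀ (M : Type) [AddCommGroup M] [Module R M], Prop
  | 0, _, _, _ => True
  | n + 1, M, _, _ => (∃ t, TorsionBound H t 0 M) ∧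
      ∀ᶠ x in H, HasTorsionBounds H n (QuotSMulTop x M)

variable {H : Filter R} [H.NeBot]

omit [IsNoetherianRing R] [H.NeBot] in
theorem eventually_smul_eq_zero (hH : H ≤ genericFilter R) {M : Type} [AddCommGroup M]
    [Module R M] {i : ℕ} (z : (localCohomology (maximalIdeal R) i).obj (ModuleCat.of R M)) :
    ∀ᶠ x in H, x • z = 0 := by
  obtain ⟨t, ht⟩ := mem_powTorsion_top z
  filter_upwards [hH (eventually_mem_pow t)] with x hx using ht x hx

theorem smul_one_eq_zero_of_torsionBound (hH : H ≤ genericFilter R) {M : Type} [AddCommGroup M]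
    [Module R M] [Module.Finite R M] {ℓ : ℕ} (h : TorsionBound H ℓ 0 M) {c : R}
    (hc : c ∈ maximalIdeal R ^ ℓ)
    (z : (localCohomology (maximalIdeal R) 1).obj (ModuleCat.of R M)) : c • z = 0 := by
  obtain ⟨x, hx, hxz, hxM⟩ := (Filter.Eventually.and h <|
    Filter.Eventually.and (eventually_smul_eq_zero hH z) (hH (eventually_isGoodFor M))).exists
  obtain ⟨D, hD, hD', -⟩ := exists_connecting hxM 0
  obtain ⟨w, rfl⟩ := hD z hxz
  obtain ⟨v, hv, hv'⟩ := hx c hc _ (zeroEquiv (maximalIdeal R) _ w).2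
  have h1 : c • w = hmap (maximalIdeal R) 0 (x • (⊤ : Submodule R M)).mkQ
      ((zeroEquiv (maximalIdeal R) M).symm ⟨v, hv⟩) := by
    apply (zeroEquiv (maximalIdeal R) _).injective
    apply Subtype.ext
    rw [zeroEquiv_hmap, LinearEquiv.apply_symm_apply, map_smul]
    exact hv'
  rw [← map_smul, h1, hD']

theorem finite_succ (hH : H ≤ genericFilter R) {M : Type} [AddCommGroup M]
    [Module R M] [Module.Finite R M] {i t : ℕ}
    (ht : ∀ c ∈ maximalIdeal R ^ t,
      ∀ z : (localCohomology (maximalIdeal R) (i + 1)).obj (ModuleCat.of R M), c • z = 0)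
    (h : ∀ᶠ x in H, Module.Finite R
      ((localCohomology (maximalIdeal R) i).obj (ModuleCat.of R (QuotSMulTop x M)))) :
    Module.Finite R ((localCohomology (maximalIdeal R) (i + 1)).obj (ModuleCat.of R M)) := by
  obtain ⟨x, hx, hxt, hxM⟩ := (Filter.Eventually.and h <|
    Filter.Eventually.and (hH (eventually_mem_pow t)) (hH (eventually_isGoodFor M))).exists
  obtain ⟨D, hD, -, -⟩ := exists_connecting hxM i
  exact Module.Finite.of_surjective D fun z => hD z (ht x hxt z)

theorem finite_and_smul_eq_zero (hH : H ≤ genericFilter R) (ℓ n : ℕ) (M : Type) [AddCommGroup M]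
    [Module R M] [Module.Finite R M] (h : TorsionBound H ℓ n M) (hG : HasTorsionBounds H n M)
    (i : ℕ) (hi : i < n + 2) :
    Module.Finite R ((localCohomology (maximalIdeal R) i).obj (ModuleCat.of R M)) ∧
      (i ≠ 0 → ∀ c ∈ maximalIdeal R ^ ℓ,
        ∀ z : (localCohomology (maximalIdeal R) i).obj (ModuleCat.of R M), c • z = 0) := by
  induction n generalizing M i with
  | zero =>
    obtain rfl | rfl : i = 0 ∨ i = 1 := by omega
    · exact ⟨finite_zero M, fun h => absurd rfl h⟩
    · have hz := fun c hc => smul_one_eq_zero_of_torsionBound hH h (c := c) hc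
      exact ⟨finite_succ hH hz (.of_forall fun x => finite_zero _), fun _ => hz⟩
  | succ n ih =>
    have ih' : ∀ᶠ x in H, ∀ i < n + 2,
        Module.Finite R
          ((localCohomology (maximalIdeal R) i).obj (ModuleCat.of R (QuotSMulTop x M))) ∧
        (i ≠ 0 → ∀ c ∈ maximalIdeal R ^ ℓ,
          ∀ z : (localCohomology (maximalIdeal R) i).obj (ModuleCat.of R (QuotSMulTop x M)),
            c • z = 0) := by
      have h' : ∀ᶠ x in H, TorsionBound H ℓ n (QuotSMulTop x M) := h
      filter_upwards [h', hG.2] with x h1 h2 using ih (QuotSMulTop x M) h1 h2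
    have hgood := hH (eventually_isGoodFor M)
    match i with
    | 0 => exact ⟨finite_zero M, fun h => absurd rfl h⟩
    | 1 =>
      obtain ⟨t, ht⟩ := hG.1
      have hz := fun c hc => smul_one_eq_zero_of_torsionBound hH ht (c := c) hc
      refine ⟨finite_succ hH hz (.of_forall fun x => finite_zero _), fun _ c hc z => ?_⟩
      obtain ⟨x, hx, hxt, hxM⟩ := (Filter.Eventually.and ih' <|
        Filter.Eventually.and (hH (eventually_mem_pow t)) hgood).exists
      obtain ⟨-, -, -, hD⟩ := exists_connecting hxM 0
      obtain ⟨w, hw⟩ := hD (c • z) (by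
        rw [map_smul]
        exact (hx 1 (by omega)).2 one_ne_zero c hc _)
      rw [hw]
      exact hz x hxt w
    | i + 2 =>
      have hz : ∀ c ∈ maximalIdeal R ^ ℓ,
          ∀ z : (localCohomology (maximalIdeal R) (i + 2)).obj (ModuleCat.of R M), c • z = 0 := by
        intro c hc z
        obtain ⟨x, hx, hxz, hxM⟩ := (Filter.Eventually.and ih' <|
          Filter.Eventually.and (eventually_smul_eq_zero hH z) hgood).exists
        obtain ⟨D, hD, -, -⟩ := exists_connecting hxM (i + 1)
        obtain ⟨w, rfl⟩ := hD z hxz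
        rw [← map_smul, (hx (i + 1) (by omega)).2 (by omega) c hc, map_zero]
      refine ⟨finite_succ hH hz ?_, fun _ => hz⟩
      filter_upwards [ih'] with x hx using (hx (i + 1) (by omega)).1

end localCohomology

end

section
open IsLocalRing Pointwise localCohomology

section HasDepth
variable {S : Type} [CommRing S] [IsLocalRing S]

/-- The local cohomology modules of `A` vanish in degrees below `s`. -/
def HasDepth (s : ℕ) (A : Type) [AddCommGroup A] [Module S A] : Prop :=
  ∀ i < s, ∀ z : (localCohomology (maximalIdeal S) i).obj (ModuleCat.of S A), z = 0

variable {A : Type} [AddCommGroup A] [Module S A] {s : ℕ}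

theorem HasDepth.mono {t : ℕ} (h : HasDepth (S := S) s A) (hts : t ≤ s) :
    HasDepth (S := S) t A :=
  fun i hi => h i (hi.trans_le hts)

theorem HasDepth.quotSMulTop (h : HasDepth (S := S) (s + 1) A) {x : S} (hx : IsSMulRegular A x) :
    HasDepth (S := S) s (QuotSMulTop x A) := by
  intro i hi z
  obtain ⟨w, rfl⟩ := (exact_hmap_delta (J := maximalIdeal S) (lsmul_injective hx)
    (exact_lsmul_mkQ A x) (Submodule.mkQ_surjective _) i z).1 (h (i + 1) (by omega) _)
  rw [h i (by omega) w, map_zero]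

theorem HasDepth.of_quotSMulTop {x : S} (hx : IsSMulRegular A x) (hm : x ∈ maximalIdeal S)
    (h : HasDepth (S := S) s (QuotSMulTop x A)) : HasDepth (S := S) (s + 1) A := by
  intro i hi
  refine eq_zero_of_smul hm fun z hz => ?_
  rw [← hmap_lsmul] at hz
  cases i with
  | zero => exact hmap_injective_zero (lsmul_injective hx) (hz.trans (map_zero _).symm)
  | succ i =>
    obtain ⟨w, rfl⟩ := (exact_delta_hmap (J := maximalIdeal S) (lsmul_injective hx)
      (exact_lsmul_mkQ A x) (Submodule.mkQ_surjective _) i z).1 hz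
    rw [h i (by omega) w, map_zero]

theorem HasDepth.of_isWeaklyRegular {rs : List S} (hrs : ∀ x ∈ rs, x ∈ maximalIdeal S)
    (h : RingTheory.Sequence.IsWeaklyRegular A rs) : HasDepth (S := S) rs.length A := by
  induction rs generalizing A with
  | nil => exact fun i hi => absurd hi (Nat.not_lt_zero i)
  | cons x rs ih =>
    rw [RingTheory.Sequence.isWeaklyRegular_cons_iff] at h
    exact .of_quotSMulTop h.1 (hrs x List.mem_cons_self)
      (ih (fun y hy => hrs y (List.mem_cons_of_mem _ hy)) h.2)

theorem HasDepth.powTorsion_eq_bot (h : HasDepth (S := S) s A) (hs : 1 ≤ s) :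
    powTorsion (maximalIdeal S) A = ⊥ := by
  rw [eq_bot_iff]
  intro u hu
  have h1 := h 0 (by omega) ((zeroEquiv (maximalIdeal S) A).symm ⟨u, hu⟩)
  rw [LinearEquiv.map_eq_zero_iff] at h1
  exact congrArg Subtype.val h1

theorem ringKrullDim_quotient_add_one_le {S : Type*} [CommRing S] {P Q : Ideal S} [P.IsPrime] (h : P ≤ Q) {x : S}
    (hx : x ∈ Q) (hxP : x ∉ P) : ringKrullDim (S ⧸ Q) + 1 ≤ ringKrullDim (S ⧸ P) := by
  refine ringKrullDim_succ_le_of_surjective (Ideal.Quotient.factor h)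
    (Ideal.Quotient.factor_surjective h) (r := Ideal.Quotient.mk P x)
    (mem_nonZeroDivisors_of_ne_zero ?_) ?_
  · rwa [ne_eq, Ideal.Quotient.eq_zero_iff_mem]
  · simpa [Ideal.Quotient.eq_zero_iff_mem] using hx

variable [IsNoetherianRing S] [Module.Finite S A]

theorem isSMulRegular_of_notMem_associatedPrimes {S : Type*} [CommRing S] [IsNoetherianRing S]
    {A : Type*} [AddCommGroup A] [Module S A] {x : S}
    (h : ∀ P ∈ associatedPrimes S A, x ∉ P) : IsSMulRegular A x := by
  rw [isSMulRegular_iff_right_eq_zero_of_smul]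
  intro u hu
  by_contra hu'
  have : x ∈ ⋃ p ∈ associatedPrimes S A, (p : Set S) :=
    biUnion_associatedPrimes_eq_zero_divisors S A ▸ ⟨u, hu', hu⟩
  simp only [Set.mem_iUnion] at this
  obtain ⟨P, hP, hP'⟩ := this
  exact h P hP hP'

theorem HasDepth.le_ringKrullDim (h : HasDepth (S := S) s A) {P : Ideal S}
    (hP : P ∈ associatedPrimes S A) : (s : WithBot ℕ∞) ≤ ringKrullDim (S ⧸ P) := by
  have hp := hP.isPrime
  induction s generalizing A P with
  | zero =>
    have : Nontrivial (S ⧸ P) := Ideal.Quotient.nontrivial_iff.2 hp.ne_top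
    exact_mod_cast ringKrullDim_nonneg_of_nontrivial
  | succ s ih =>
    obtain ⟨x, hxm, hx⟩ := (Filter.Eventually.and eventually_mem_maximalIdeal
      (eventually_isSMulRegular (h.powTorsion_eq_bot (by omega)))).exists
    obtain ⟨-, u, hu⟩ := mem_associatedPrimes_iff.1 hP
    have hu0 : u ≠ 0 := fun h0 => hp.ne_top ((Ideal.eq_top_iff_one _).2 ((hu 1).2 (by simp [h0])))
    have hxP : x ∉ P := fun hx' => hu0 (hx.right_eq_zero_of_smul ((hu x).1 hx'))
    let N : Submodule S A :=
      { carrier := {a | ∀ c ∈ P, c • a = 0}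
        add_mem' := fun ha hb c hc => by rw [smul_add, ha c hc, hb c hc, add_zero]
        zero_mem' := fun c _ => smul_zero c
        smul_mem' := fun r a ha c hc => by rw [smul_comm, ha c hc, smul_zero] }
    have : Nontrivial N := ⟨⟨⟨u, fun c hc => (hu c).1 hc⟩, 0, fun h0 => hu0 (congrArg Subtype.val h0)⟩⟩
    have : Nontrivial (QuotSMulTop x N) := nontrivial_quotSMulTop_of_mem_maximalIdeal N hxm
    have hinj : Function.Injective (QuotSMulTop.map x N.subtype) := by
      rw [injective_iff_map_eq_zero]
      intro z hz
      obtain ⟨⟨a, ha⟩, rfl⟩ := Submodule.Quotient.mk_surjective _ z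
      rw [QuotSMulTop.map_apply_mk, Submodule.Quotient.mk_eq_zero,
        Submodule.mem_smul_pointwise_iff_exists] at hz
      obtain ⟨b, -, hb⟩ := hz
      rw [Submodule.Quotient.mk_eq_zero, Submodule.mem_smul_pointwise_iff_exists]
      refine ⟨⟨b, fun c hc => hx.right_eq_zero_of_smul ?_⟩, trivial, Subtype.ext hb⟩
      rw [smul_comm, hb]
      exact ha c hc
    obtain ⟨Q, hQ⟩ := associatedPrimes.nonempty S (QuotSMulTop x N)
    obtain ⟨hQp, w, hw⟩ := mem_associatedPrimes_iff.1 hQ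
    obtain ⟨w, rfl⟩ := Submodule.Quotient.mk_surjective _ w
    have hPQ : P ≤ Q := fun c hc => (hw c).2 <| by
      rw [← Submodule.Quotient.mk_smul, show c • w = 0 from Subtype.ext (w.2 c hc),
        Submodule.Quotient.mk_zero]
    have hxQ : x ∈ Q := (hw x).2 <| by
      rw [← Submodule.Quotient.mk_smul, Submodule.Quotient.mk_eq_zero]
      exact Submodule.smul_mem_pointwise_smul _ _ _ trivial
    have h1 := ih (h.quotSMulTop hx) (associatedPrimes.subset_of_injective hinj hQ) hQp
    refine le_trans ?_ (ringKrullDim_quotient_add_one_le hPQ hxQ hxP)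
    push_cast
    gcongr

theorem HasDepth.exists_mem_associatedPrimes (h : HasDepth (S := S) s A)
    (hdim : Module.supportDim S A ≤ s) {p : PrimeSpectrum S} (hp : p ∈ Module.support S A) {r : ℕ}
    (hr : ringKrullDim (S ⧸ p.asIdeal) = r) :
    ∃ (B : Type) (_ : AddCommGroup B) (_ : Module S B), Module.Finite S B ∧
      HasDepth (S := S) r B ∧ p.asIdeal ∈ associatedPrimes S B := by
  induction s using Nat.strong_induction_on generalizing A with
  | _ s ih =>
  have hle : ringKrullDim (S ⧸ p.asIdeal) ≤ s := by
    refine le_trans ?_ hdim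
    rw [Module.supportDim_eq_ringKrullDim_quotient_annihilator]
    exact ringKrullDim_le_of_surjective _ (Ideal.Quotient.factor_surjective
      (Module.annihilator_le_of_mem_support hp))
  by_cases hP : ∃ P ∈ associatedPrimes S A, p.asIdeal ≤ P
  · obtain ⟨P, hP, hpP⟩ := hP
    obtain rfl | hne := eq_or_ne p.asIdeal P
    · rw [hr] at hle
      exact ⟨A, _, _, inferInstance, h.mono (by exact_mod_cast hle), hP⟩
    · obtain ⟨x, hx, hxp⟩ := SetLike.exists_of_lt (lt_of_le_of_ne hpP hne)
      have h1 := h.le_ringKrullDim hP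
      have h2 := (ringKrullDim_quotient_add_one_le hpP hx hxp).trans hle
      have h3 : ((s + 1 : ℕ) : WithBot ℕ∞) ≤ (s : ℕ) := by
        refine le_trans ?_ h2
        push_cast
        gcongr
      exact absurd (by exact_mod_cast h3 : s + 1 ≤ s) (by omega)
  · push Not at hP
    obtain ⟨x, hxp, hx⟩ : ∃ x ∈ p.asIdeal, ∀ P ∈ associatedPrimes S A, x ∉ P := by
      by_contra! hcon
      have h1 : (p.asIdeal : Set S) ⊆ ⋃ P ∈ associatedPrimes S A, (P : Set S) := by
        intro x hx
        obtain ⟨P, hP, hxP⟩ := hcon x hx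
        exact Set.mem_biUnion hP hxP
      obtain ⟨P, hP', hle⟩ := (Ideal.subset_union_prime_finite (associatedPrimes.finite S A)
        (f := id) ⊥ ⊥ fun P hP _ _ => hP.isPrime).1 h1
      exact hP P hP' hle
    have hreg := isSMulRegular_of_notMem_associatedPrimes hx
    have hxm : x ∈ maximalIdeal S := le_maximalIdeal p.2.ne_top hxp
    have hp' : p ∈ Module.support S (QuotSMulTop x A) := by
      rw [Module.support_quotSMulTop]
      exact ⟨hp, by simpa using hxp⟩
    have hd := Module.supportDim_quotSMulTop_succ_eq_supportDim hreg hxm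
    have hnt : Nontrivial (QuotSMulTop x A) := Module.nonempty_support_iff.1 ⟨p, hp'⟩
    have hd0 : 0 ≤ Module.supportDim S (QuotSMulTop x A) := by
      have := Module.supportDim_ne_bot_of_nontrivial S (QuotSMulTop x A)
      revert this
      generalize Module.supportDim S (QuotSMulTop x A) = d
      cases d with
      | bot => simp
      | coe d => exact fun _ => by exact_mod_cast zero_le
    rw [← hd] at hdim
    cases s with
    | zero =>
      have : ((1 : ℕ) : WithBot ℕ∞) ≤ (0 : ℕ) := le_trans (by
        rw [← zero_add ((1 : ℕ) : WithBot ℕ∞)]; push_cast; gcongr) hdim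
      exact absurd (by exact_mod_cast this : 1 ≤ 0) (by omega)
    | succ s =>
      refine ih s (by omega) (h.quotSMulTop hreg) ?_ hp'
      generalize Module.supportDim S (QuotSMulTop x A) = a at hdim
      induction a with
      | bot => exact bot_le
      | coe a =>
        have h3 : a + 1 ≤ (s : ℕ∞) + 1 := by exact_mod_cast hdim
        have h4 : a ≤ s := (ENat.add_le_add_iff_right (by simp)).1 h3
        exact_mod_cast h4

end HasDepth

end

section
open IsLocalRing Pointwise localCohomology

section DepthFiltered
variable {S R : Type} [CommRing S] [IsLocalRing S] [CommRing R] [IsLocalRing R]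

/-- The additive map induced on the quotient by a submodule. -/
def Submodule.liftAddHom {R M A : Type*} [CommRing R] [AddCommGroup M] [Module R M]
    [AddCommGroup A] (K : Submodule R M) (h : M →+ A) (hK : ∀ u ∈ K, h u = 0) : M ⧸ K →+ A :=
  QuotientAddGroup.lift K.toAddSubgroup h hK

/-- The modules built by extensions from `𝔪`-torsion modules and from modules that embed, along
`φ`, into finitely generated modules of depth at least `r`. -/
inductive DepthFiltered (φ : S →+* R) (r : ℕ) : ∀ (M : Type) [AddCommGroup M] [Module R M], Prop
  | torsion (M : Type) [AddCommGroup M] [Module R M] (h : powTorsion (maximalIdeal R) M = ⊤) :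
      DepthFiltered φ r M
  | embed (M A : Type) [AddCommGroup M] [Module R M] [AddCommGroup A] [Module S A]
      [Module.Finite S A] (hA : HasDepth (S := S) r A) (f : M →+ A) (hf : Function.Injective f)
      (hφ : ∀ (s : S) (u : M), f (φ s • u) = s • f u) : DepthFiltered φ r M
  | ext (L M N : Type) [AddCommGroup L] [Module R L] [AddCommGroup M] [Module R M]
      [AddCommGroup N] [Module R N] (i : L →ₗ[R] M) (p : M →ₗ[R] N) (hi : Function.Injective i)
      (hip : Function.Exact i p) (hp : Function.Surjective p) (hL : DepthFiltered φ r L)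
      (hN : DepthFiltered φ r N) : DepthFiltered φ r M

variable {φ : S →+* R} (hφ : Function.Surjective φ) {r : ℕ}
  {M : Type} [AddCommGroup M] [Module R M] {M' : Type} [AddCommGroup M'] [Module R M']

theorem DepthFiltered.congr (h : DepthFiltered φ r M) (e : M ≃ₗ[R] M') :
    DepthFiltered φ r M' := by
  refine .ext M M' PUnit e.toLinearMap 0 e.injective (fun u => ?_) (fun u => ⟨0, rfl⟩) h
    (.torsion _ (eq_top_iff.2 fun u _ => ⟨0, fun _ _ => rfl⟩))
  exact ⟨fun _ => e.surjective u, fun _ => rfl⟩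

include hφ in
theorem map_mem_maximalIdeal_pow {s : S} {t : ℕ} (hs : s ∈ maximalIdeal S ^ t) :
    φ s ∈ maximalIdeal R ^ t := by
  have : IsLocalHom φ := .of_surjective φ hφ
  have h1 := Ideal.mem_map_of_mem φ hs
  rw [Ideal.map_pow] at h1
  exact Ideal.pow_right_mono (((local_hom_TFAE φ).out 0 2).1 this) t h1

include hφ in
theorem exists_map_eq_of_mem_maximalIdeal_pow {c : R} {t : ℕ} (hc : c ∈ maximalIdeal R ^ t) :
    ∃ s ∈ maximalIdeal S ^ t, φ s = c := by
  have : IsLocalHom φ := .of_surjective φ hφ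
  rw [← Ideal.mem_map_iff_of_surjective φ hφ, Ideal.map_pow]
  refine Ideal.pow_right_mono (fun c hc => ?_) t hc
  obtain ⟨s, rfl⟩ := hφ c
  exact Ideal.mem_map_of_mem φ (((local_hom_TFAE φ).out 0 4).1 this ▸ hc)

include hφ in
theorem map_mem_powTorsion_of_semilinear {A : Type} [AddCommGroup A] [Module S A] (f : M →+ A)
    (hf : ∀ (s : S) (u : M), f (φ s • u) = s • f u) {u : M}
    (hu : u ∈ powTorsion (maximalIdeal R) M) : f u ∈ powTorsion (maximalIdeal S) A := by
  obtain ⟨t, ht⟩ := hu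
  exact ⟨t, fun a ha => by rw [← hf, ht _ (map_mem_maximalIdeal_pow hφ ha), map_zero]⟩

include hφ in
theorem DepthFiltered.quotient (hr : 1 ≤ r) (h : DepthFiltered φ r M) (K : Submodule R M)
    (hK : K ≤ powTorsion (maximalIdeal R) M) : DepthFiltered φ r (M ⧸ K) := by
  induction h with
  | torsion M h =>
    refine .torsion _ (eq_top_iff.2 fun u _ => ?_)
    obtain ⟨u, rfl⟩ := K.mkQ_surjective u
    exact map_mem_powTorsion _ (h ▸ trivial)
  | embed M A hA f hf hs =>
    have hK0 : K = ⊥ := by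
      rw [eq_bot_iff]
      intro u hu
      have h1 := map_mem_powTorsion_of_semilinear hφ f hs (hK hu)
      rw [hA.powTorsion_eq_bot hr] at h1
      exact hf (((Submodule.mem_bot S).1 h1).trans (map_zero f).symm)
    exact (DepthFiltered.embed M A hA f hf hs).congr (K.quotEquivOfEqBot hK0).symm
  | ext L M N i p hi hip hp hL hN ihL ihN =>
    refine .ext (L ⧸ K.comap i) (M ⧸ K) (N ⧸ K.map p) (Submodule.mapQ _ _ i le_rfl)
      (Submodule.mapQ _ _ p (Submodule.le_comap_map _ _)) ?_ ?_ ?_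
      (ihL _ fun u hu => mem_powTorsion_of_injective i hi (hK hu))
      (ihN _ ?_)
    · rw [injective_iff_map_eq_zero]
      intro u hu
      obtain ⟨u, rfl⟩ := Submodule.Quotient.mk_surjective _ u
      rw [Submodule.mapQ_apply, Submodule.Quotient.mk_eq_zero] at hu
      rwa [Submodule.Quotient.mk_eq_zero]
    · intro u
      obtain ⟨u, rfl⟩ := Submodule.Quotient.mk_surjective _ u
      rw [Submodule.mapQ_apply, Submodule.Quotient.mk_eq_zero]
      constructor
      · rintro ⟨k, hk, hku⟩
        obtain ⟨l, hl⟩ := (hip (u - k)).1 (by rw [map_sub, hku, sub_self])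
        refine ⟨Submodule.Quotient.mk l, ?_⟩
        rw [Submodule.mapQ_apply, hl, Submodule.Quotient.eq]
        simpa using hk
      · rintro ⟨l, hl⟩
        obtain ⟨l, rfl⟩ := Submodule.Quotient.mk_surjective _ l
        rw [Submodule.mapQ_apply, Submodule.Quotient.eq] at hl
        refine ⟨u - i l, by simpa using K.neg_mem hl, ?_⟩
        rw [map_sub, hip.apply_apply_eq_zero, sub_zero]
    · intro u
      obtain ⟨u, rfl⟩ := Submodule.Quotient.mk_surjective _ u
      obtain ⟨v, rfl⟩ := hp u
      exact ⟨Submodule.Quotient.mk v, rfl⟩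
    · rintro _ ⟨k, hk, rfl⟩
      exact map_mem_powTorsion p (hK hk)

variable {L N : Type} [AddCommGroup L] [Module R L] [AddCommGroup N] [Module R N]

include hφ in
theorem DepthFiltered.of_exact (hr : 1 ≤ r) (i : L →ₗ[R] M) (p : M →ₗ[R] N)
    (hi : LinearMap.ker i ≤ powTorsion (maximalIdeal R) L) (hip : Function.Exact i p)
    (hp : Function.Surjective p) (hL : DepthFiltered φ r L) (hN : DepthFiltered φ r N) :
    DepthFiltered φ r M := by
  refine .ext (L ⧸ LinearMap.ker i) M N ((LinearMap.ker i).liftQ i le_rfl) p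
    (LinearMap.ker_eq_bot.1 (Submodule.ker_liftQ_eq_bot _ _ _ le_rfl)) ?_ hp
    (hL.quotient hφ hr _ hi) hN
  rw [LinearMap.exact_iff, Submodule.range_liftQ]
  exact hip.linearMap_ker_eq

include hφ in
theorem DepthFiltered.of_semilinear {A : Type} [AddCommGroup A] [Module S A]
    [Module.Finite S A] (hA : HasDepth (S := S) r A) (f : M →+ A)
    (hs : ∀ (s : S) (u : M), f (φ s • u) = s • f u)
    (hf : ∀ u, f u = 0 → u ∈ powTorsion (maximalIdeal R) M) : DepthFiltered φ r M := by
  let K : Submodule R M :=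
    { f.ker with
      smul_mem' := fun c u hu => by
        obtain ⟨s, rfl⟩ := hφ c
        exact (hs s u).trans (by rw [show f u = 0 from hu, smul_zero]) }
  refine .ext K M (M ⧸ K) K.subtype K.mkQ K.subtype_injective
    (LinearMap.exact_subtype_mkQ K) K.mkQ_surjective (.torsion _ (eq_top_iff.2 fun u _ =>
      mem_powTorsion_of_injective K.subtype K.subtype_injective (hf _ u.2)))
    (.embed _ A hA (K.liftAddHom f fun u hu => hu) ?_ ?_)
  · rw [injective_iff_map_eq_zero]
    intro u hu
    obtain ⟨u, rfl⟩ := Submodule.Quotient.mk_surjective _ u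
    exact (Submodule.Quotient.mk_eq_zero K).2 hu
  · intro s u
    obtain ⟨u, rfl⟩ := Submodule.Quotient.mk_surjective _ u
    exact hs s u

theorem ker_map_le_powTorsion {x : R} (hx : IsGoodFor N x) (i : L →ₗ[R] M) (p : M →ₗ[R] N)
    (hi : Function.Injective i) (hip : Function.Exact i p) :
    LinearMap.ker (QuotSMulTop.map x i) ≤ powTorsion (maximalIdeal R) (QuotSMulTop x L) := by
  intro u hu
  obtain ⟨l, rfl⟩ := Submodule.Quotient.mk_surjective _ u
  rw [LinearMap.mem_ker, QuotSMulTop.map_apply_mk, Submodule.Quotient.mk_eq_zero,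
    Submodule.mem_smul_pointwise_iff_exists] at hu
  obtain ⟨m, -, hm⟩ := hu
  obtain ⟨t, ht⟩ := (hx (p m)).1 (by rw [← map_smul, hm, hip.apply_apply_eq_zero])
  refine ⟨t, fun c hc => ?_⟩
  obtain ⟨l', hl'⟩ := (hip (c • m)).1 (by rw [map_smul, ht c hc])
  rw [← Submodule.Quotient.mk_smul, Submodule.Quotient.mk_eq_zero,
    Submodule.mem_smul_pointwise_iff_exists]
  refine ⟨l', trivial, hi ?_⟩
  rw [map_smul, map_smul, hl', ← hm, smul_comm]

end DepthFiltered

end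

section
open IsLocalRing Pointwise localCohomology

section DepthFiltered
variable {S R : Type} [CommRing S] [IsLocalRing S] [CommRing R] [IsLocalRing R]
  {φ : S →+* R} (hφ : Function.Surjective φ) {r : ℕ}

theorem mk_smul_eq_zero {R M : Type*} [CommRing R] [AddCommGroup M] [Module R M] (x : R) (m : M) :
    (Submodule.Quotient.mk (x • m) : QuotSMulTop x M) = 0 :=
  (Submodule.Quotient.mk_eq_zero _).2 (Submodule.smul_mem_pointwise_smul _ _ _ trivial)

theorem mk_eq_zero_iff_exists_smul {R M : Type*} [CommRing R] [AddCommGroup M] [Module R M] (x : R) {m : M} :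
    (Submodule.Quotient.mk m : QuotSMulTop x M) = 0 ↔ ∃ m', x • m' = m := by
  rw [Submodule.Quotient.mk_eq_zero, Submodule.mem_smul_pointwise_iff_exists]
  simp

section Embed
variable {M A : Type} [AddCommGroup M] [Module R M] [AddCommGroup A] [Module S A] (f : M →+ A)
  (hs : ∀ (s : S) (u : M), f (φ s • u) = s • f u)

/-- The range of a semilinear map, as a submodule over the source of the ring map. -/
def semilinearRange : Submodule S A :=
  { f.range with
    smul_mem' := by
      rintro s _ ⟨u, rfl⟩
      exact ⟨φ s • u, hs s u⟩ }

/-- The reduction of a semilinear map modulo an element. -/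
def semilinearQuot (x : S) : QuotSMulTop (φ x) M →+ QuotSMulTop x A :=
  Submodule.liftAddHom _ ((Submodule.mkQ (x • (⊤ : Submodule S A))).toAddMonoidHom.comp f) <| by
    intro u hu
    obtain ⟨v, -, rfl⟩ := (Submodule.mem_smul_pointwise_iff_exists _ _ _).1 hu
    exact (congrArg _ (hs x v)).trans (mk_smul_eq_zero x (f v))

omit [IsLocalRing S] [IsLocalRing R] in
theorem semilinearQuot_mk (x : S) (u : M) :
    semilinearQuot f hs x (Submodule.Quotient.mk u) = Submodule.Quotient.mk (f u) := rfl

omit [IsLocalRing S] [IsLocalRing R] in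
theorem semilinearQuot_smul (x s : S) (u : QuotSMulTop (φ x) M) :
    semilinearQuot f hs x (φ s • u) = s • semilinearQuot f hs x u := by
  obtain ⟨u, rfl⟩ := Submodule.Quotient.mk_surjective _ u
  rw [← Submodule.Quotient.mk_smul, semilinearQuot_mk, hs, semilinearQuot_mk,
    Submodule.Quotient.mk_smul]

include hφ in
theorem smul_eq_zero_of_semilinearQuot_eq_zero (hf : Function.Injective f) {t : ℕ}
    (ht : ∀ s ∈ maximalIdeal S ^ t,
      ∀ z ∈ powTorsion (maximalIdeal S) (A ⧸ semilinearRange f hs), s • z = 0)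
    {x : S} (hx : IsGoodFor (A ⧸ semilinearRange f hs) x) {u : QuotSMulTop (φ x) M}
    (hu : semilinearQuot f hs x u = 0) {c : R} (hc : c ∈ maximalIdeal R ^ t) : c • u = 0 := by
  obtain ⟨u, rfl⟩ := Submodule.Quotient.mk_surjective _ u
  obtain ⟨a, ha⟩ := (mk_eq_zero_iff_exists_smul x).1 hu
  obtain ⟨s, hs', rfl⟩ := exists_map_eq_of_mem_maximalIdeal_pow hφ hc
  have h1 := ht s hs' (Submodule.Quotient.mk a) ((hx _).1 (by
    rw [← Submodule.Quotient.mk_smul, Submodule.Quotient.mk_eq_zero, ha]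
    exact ⟨u, rfl⟩))
  rw [← Submodule.Quotient.mk_smul, Submodule.Quotient.mk_eq_zero] at h1
  obtain ⟨v, hv⟩ := h1
  rw [← Submodule.Quotient.mk_smul, mk_eq_zero_iff_exists_smul]
  exact ⟨v, hf (by rw [hs, hs, hv, smul_comm, ha])⟩

end Embed

variable [IsNoetherianRing S] [IsNoetherianRing R] {M : Type} [AddCommGroup M] [Module R M]

include hφ in
theorem DepthFiltered.eventually_quotSMulTop (hr : 1 ≤ r) (h : DepthFiltered φ (r + 1) M)
    [hM : Module.Finite R M] :
    ∀ᶠ x in (genericFilter S).map φ, DepthFiltered φ r (QuotSMulTop x M) := by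
  rw [Filter.eventually_map]
  revert hM
  induction h with
  | torsion M h =>
    intro
    refine Filter.Eventually.of_forall fun x => .torsion _ (eq_top_iff.2 fun u _ => ?_)
    obtain ⟨u, rfl⟩ := Submodule.mkQ_surjective _ u
    exact map_mem_powTorsion _ (h ▸ trivial)
  | embed M A hA f hf hs =>
    intro
    obtain ⟨t, ht⟩ := exists_pow_smul_powTorsion (maximalIdeal S) (M := A ⧸ semilinearRange f hs)
    filter_upwards [eventually_isSMulRegular (hA.powTorsion_eq_bot (by omega)),
      eventually_isGoodFor (A ⧸ semilinearRange f hs)] with x hx hx'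
    exact .of_semilinear hφ (hA.quotSMulTop hx) (semilinearQuot f hs x) (semilinearQuot_smul f hs x)
      fun u hu => ⟨t, fun c hc =>
        smul_eq_zero_of_semilinearQuot_eq_zero hφ f hs hf ht hx' hu hc⟩
  | ext L M N i p hi hip hp hL hN ihL ihN =>
    intro
    have : Module.Finite R L := Module.Finite.of_injective i hi
    have : Module.Finite R N := Module.Finite.of_surjective p hp
    filter_upwards [ihL, ihN, tendsto_genericFilter φ hφ (eventually_isGoodFor N)]
      with x hxL hxN hx
    exact .of_exact hφ hr (QuotSMulTop.map (φ x) i) (QuotSMulTop.map (φ x) p)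
      (ker_map_le_powTorsion hx i p hi hip) (QuotSMulTop.map_exact (φ x) hip hp)
      (QuotSMulTop.map_surjective (φ x) hp) hxL hxN

include hφ in
theorem DepthFiltered.exists_torsionBound (hr : 2 ≤ r) (h : DepthFiltered φ r M)
    [hM : Module.Finite R M] : ∃ t, TorsionBound ((genericFilter S).map φ) t 0 M := by
  revert hM
  induction h with
  | torsion M h =>
    intro
    refine ⟨0, Filter.Eventually.of_forall fun x c _ u _ => ?_⟩
    obtain ⟨u, rfl⟩ := Submodule.mkQ_surjective _ u
    exact ⟨c • u, h ▸ trivial, rfl⟩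
  | embed M A hA f hf hs =>
    intro
    obtain ⟨t, ht⟩ := exists_pow_smul_powTorsion (maximalIdeal S) (M := A ⧸ semilinearRange f hs)
    refine ⟨t, ?_⟩
    change ∀ᶠ x in genericFilter S, _
    filter_upwards [eventually_isSMulRegular (hA.powTorsion_eq_bot (by omega)),
      eventually_isGoodFor (A ⧸ semilinearRange f hs)] with x hx hx' c hc u hu
    refine ⟨0, zero_mem _, ?_⟩
    rw [map_zero]
    refine smul_eq_zero_of_semilinearQuot_eq_zero hφ f hs hf ht hx' ?_ hc
    have h1 := map_mem_powTorsion_of_semilinear hφ _ (semilinearQuot_smul f hs x) hu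
    obtain ⟨r, rfl⟩ := Nat.exists_eq_add_of_le' hr
    rwa [(HasDepth.quotSMulTop (s := r + 1) hA hx).powTorsion_eq_bot (by omega)] at h1
  | ext L M N i p hi hip hp hL hN ihL ihN =>
    intro
    have : Module.Finite R L := Module.Finite.of_injective i hi
    have : Module.Finite R N := Module.Finite.of_surjective p hp
    obtain ⟨a, ha⟩ := ihL
    obtain ⟨b, hb⟩ := ihN
    obtain ⟨s, hs⟩ := exists_pow_smul_powTorsion (maximalIdeal R) (M := N)
    have hle : (genericFilter S).map φ ≤ genericFilter R := tendsto_genericFilter φ hφ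
    refine ⟨a + (s + b), ?_⟩
    filter_upwards [ha, hb, hle (eventually_isGoodFor N)] with x hxL hxN hx
    intro c hc u hu
    let W := (powTorsion (maximalIdeal R) M).map (x • (⊤ : Submodule R M)).mkQ
    suffices h : c ∈ W.comap (LinearMap.toSpanSingleton R _ u) by
      obtain ⟨w, hw, hwu⟩ := h
      exact ⟨w, hw, hwu.symm⟩
    obtain ⟨u, rfl⟩ := Submodule.Quotient.mk_surjective _ u
    have h1 : ∀ d ∈ maximalIdeal R ^ (s + b),
        (Submodule.Quotient.mk (d • p u) : QuotSMulTop x N) = 0 := by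
      intro d hd
      suffices h : d ∈ LinearMap.ker (LinearMap.toSpanSingleton R (QuotSMulTop x N)
        (Submodule.Quotient.mk (p u))) from h
      rw [pow_add] at hd
      refine Ideal.mul_le.2 (fun c' hc' c hc => ?_) hd
      obtain ⟨w, hw, hwu⟩ := hxN c hc (Submodule.Quotient.mk (p u))
        (map_mem_powTorsion (QuotSMulTop.map x p) hu)
      rw [LinearMap.mem_ker, LinearMap.toSpanSingleton_apply, mul_smul, hwu, ← map_smul,
        hs c' hc' w hw, map_zero]
    rw [pow_add] at hc
    refine Ideal.mul_le.2 (fun c hc d hd => ?_) hc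
    obtain ⟨n, hn⟩ := (mk_eq_zero_iff_exists_smul x).1 (h1 d hd)
    obtain ⟨m, rfl⟩ := hp n
    obtain ⟨l, hl⟩ := (hip (d • u - x • m)).1 (by rw [map_sub, map_smul, map_smul, hn, sub_self])
    have h2 : (Submodule.Quotient.mk (i l) : QuotSMulTop x M) = d • Submodule.Quotient.mk u := by
      rw [hl, Submodule.Quotient.mk_sub, mk_smul_eq_zero, sub_zero, Submodule.Quotient.mk_smul]
    have h3 : (Submodule.Quotient.mk l : QuotSMulTop x L) ∈ powTorsion (maximalIdeal R) _ := by
      obtain ⟨t, ht⟩ := hu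
      refine mem_powTorsion_of_forall_smul_mem t fun e he =>
        ker_map_le_powTorsion hx i p hi hip ?_
      rw [LinearMap.mem_ker, map_smul, QuotSMulTop.map_apply_mk, h2, smul_comm, ht e he, smul_zero]
    obtain ⟨w, hw, hwl⟩ := hxL c hc _ h3
    refine ⟨i w, map_mem_powTorsion i hw, ?_⟩
    rw [LinearMap.toSpanSingleton_apply, mul_smul, ← h2]
    exact ((congrArg (QuotSMulTop.map x i) hwl).symm.trans
      ((QuotSMulTop.map x i).map_smul c _))

include hφ in
theorem DepthFiltered.hasTorsionBounds (n : ℕ) (h : DepthFiltered φ (n + 2) M)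
    [Module.Finite R M] : HasTorsionBounds ((genericFilter S).map φ) n M := by
  induction n generalizing M with
  | zero => trivial
  | succ n ih =>
    refine ⟨h.exists_torsionBound hφ (by omega), ?_⟩
    filter_upwards [h.eventually_quotSMulTop hφ (by omega)] with x hx
    exact ih hx

end DepthFiltered

end

section
open IsLocalRing Pointwise localCohomology

section ConstantDimension
variable {R : Type} [CommRing R] [IsNoetherianRing R] {N : Type} [AddCommGroup N] [Module R N]

theorem exists_mem_associatedPrimes_of_ne_zero {v : N} (hv : v ≠ 0) :
    ∃ Q ∈ associatedPrimes R N, ∀ a : R, a • v = 0 → a ∈ Q := by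
  obtain ⟨Q, hQ, hle⟩ := exists_le_isAssociatedPrime_of_isNoetherianRing R v hv
  exact ⟨Q, hQ, fun a ha => hle (by simpa [Submodule.mem_colon_singleton] using ha)⟩

/-- The elements killed by `P` that are torsion modulo `u`, relative to the complement of `P`. -/
def primeClosure (P : Ideal R) [P.IsPrime] (u : N) : Submodule R N where
  carrier := {v | (∀ c ∈ P, c • v = 0) ∧ ∃ s ∉ P, ∃ a : R, s • v = a • u}
  add_mem' := by
    rintro v w ⟨hv, s, hs, a, ha⟩ ⟨hw, t, ht, b, hb⟩
    refine ⟨fun c hc => by rw [smul_add, hv c hc, hw c hc, add_zero], t * s,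
      fun h => (Ideal.IsPrime.mem_or_mem ‹_› h).elim ht hs, t * a + s * b, ?_⟩
    rw [smul_add, mul_smul, ha, mul_comm t s, mul_smul, hb, add_smul, mul_smul, mul_smul]
  zero_mem' := ⟨fun c _ => smul_zero c, 1, Ideal.IsPrime.one_notMem ‹_›, 0, by simp⟩
  smul_mem' := by
    rintro b v ⟨hv, s, hs, a, ha⟩
    refine ⟨fun c hc => by rw [smul_comm, hv c hc, smul_zero], s, hs, b * a, ?_⟩
    rw [smul_comm, ha, mul_smul]

variable {P : Ideal R} [hp : P.IsPrime] {u : N}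
  (hP : ∀ Q ∈ associatedPrimes R N, P ≤ Q → Q = P)

include hP in
theorem mem_of_smul_eq_zero_of_mem_primeClosure {v : N} (hv : v ∈ primeClosure P u) (hv0 : v ≠ 0)
    {c : R} (hc : c • v = 0) : c ∈ P := by
  obtain ⟨Q, hQ, hle⟩ := exists_mem_associatedPrimes_of_ne_zero (R := R) hv0
  exact hP Q hQ (fun a ha => hle a (hv.1 a ha)) ▸ hle c hc

theorem exists_smul_mem_span_of_primeClosure [Module.Finite R N] :
    ∃ s ∉ P, ∀ v ∈ primeClosure P u, ∃ a : R, s • v = a • u := by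
  obtain ⟨T, hT⟩ := IsNoetherian.noetherian (primeClosure P u)
  have h1 : ∀ T : Finset N, (∀ v ∈ T, v ∈ primeClosure P u) →
      ∃ s ∉ P, ∀ v ∈ T, s • v ∈ Submodule.span R {u} := by
    classical
    intro T
    induction T using Finset.induction_on with
    | empty => exact fun _ => ⟨1, hp.one_notMem, by simp⟩
    | insert v T _ ih =>
      intro hT
      obtain ⟨s, hs, h⟩ := ih fun w hw => hT w (Finset.mem_insert_of_mem hw)
      obtain ⟨-, t, ht, a, ha⟩ := hT v (Finset.mem_insert_self _ _)
      refine ⟨t * s, fun h => (hp.mem_or_mem h).elim ht hs, fun w hw => ?_⟩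
      obtain rfl | hw := Finset.mem_insert.1 hw
      · rw [mul_comm, mul_smul, ha]
        exact Submodule.smul_mem _ _ (Submodule.smul_mem _ _ (Submodule.mem_span_singleton_self u))
      · rw [mul_smul]
        exact Submodule.smul_mem _ _ (h w hw)
  obtain ⟨s, hs, h⟩ := h1 T fun v hv => hT ▸ Submodule.subset_span hv
  refine ⟨s, hs, fun v hv => ?_⟩
  have h2 : primeClosure P u ≤ (Submodule.span R {u}).comap (LinearMap.lsmul R N s) := by
    rw [← hT, Submodule.span_le]
    exact h
  obtain ⟨a, ha⟩ := Submodule.mem_span_singleton.1 (h2 hv)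
  exact ⟨a, ha.symm⟩

include hP in
theorem associatedPrimes_quotient_primeClosure_subset (hPN : P ∈ associatedPrimes R N) :
    associatedPrimes R (N ⧸ primeClosure P u) ⊆ associatedPrimes R N := by
  intro Q hQ
  obtain ⟨hQp, w, hw⟩ := mem_associatedPrimes_iff.1 hQ
  obtain ⟨w, rfl⟩ := Submodule.Quotient.mk_surjective _ w
  replace hw : ∀ a, a ∈ Q ↔ a • w ∈ primeClosure P u := fun a => by
    rw [hw, ← Submodule.Quotient.mk_smul, Submodule.Quotient.mk_eq_zero]
  by_cases hPQ : P ≤ Q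
  · suffices Q ≤ P from le_antisymm this hPQ ▸ hPN
    by_cases hb : ∃ b ∈ P, b • w ≠ 0
    · obtain ⟨b, hb, hbw⟩ := hb
      refine fun a ha => mem_of_smul_eq_zero_of_mem_primeClosure hP ((hw b).1 (hPQ hb)) hbw ?_
      rw [smul_comm]
      exact ((hw a).1 ha).1 b hb
    · push Not at hb
      intro c hc
      by_contra hcP
      obtain ⟨-, s, hs, a, ha⟩ := (hw c).1 hc
      refine hQp.one_notMem ((hw 1).2 ?_)
      rw [one_smul]
      exact ⟨hb, s * c, fun h => (hp.mem_or_mem h).elim hs hcP, a, by rw [mul_smul, ha]⟩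
  · obtain ⟨b, hb, hbQ⟩ := SetLike.not_le_iff_exists.1 hPQ
    refine mem_associatedPrimes_iff.2 ⟨hQp, b • w, fun a => ⟨fun ha => ?_, fun ha => ?_⟩⟩
    · rw [smul_comm]
      exact ((hw a).1 ha).1 b hb
    · refine (hQp.mem_or_mem ((hw (a * b)).2 ?_)).resolve_right hbQ
      rw [mul_smul, ha]
      exact zero_mem _

end ConstantDimension

section DepthFiltered
variable {S R : Type} [CommRing S] [IsLocalRing S] [CommRing R] [IsLocalRing R]
  [IsNoetherianRing S] [IsNoetherianRing R]
  {φ : S →+* R} (hφ : Function.Surjective φ) {r : ℕ} {N : Type} [AddCommGroup N] [Module R N]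

include hφ in
theorem DepthFiltered.primeClosure [Module.Finite R N] {P : Ideal R} [P.IsPrime] {u : N}
    (hu : ∀ a : R, a ∈ P ↔ a • u = 0) (hP : ∀ Q ∈ associatedPrimes R N, P ≤ Q → Q = P)
    {B : Type} [AddCommGroup B] [Module S B] [Module.Finite S B] (hB : HasDepth (S := S) r B)
    (hPB : P.comap φ ∈ associatedPrimes S B) : DepthFiltered φ r (primeClosure P u) := by
  obtain ⟨-, v, hv⟩ := mem_associatedPrimes_iff.1 hPB
  have huv : ∀ d d' : S, φ d • u = φ d' • u ↔ d • v = d' • v := fun d d' => by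
    rw [← sub_eq_zero, ← sub_smul, ← map_sub, ← hu, ← Ideal.mem_comap, hv, sub_smul, sub_eq_zero]
  obtain ⟨s, hs, h⟩ := exists_smul_mem_span_of_primeClosure (P := P) (u := u)
  have h' : ∀ k : _root_.primeClosure P u, ∃ d : S, φ d • u = s • (k : N) := fun k => by
    obtain ⟨a, ha⟩ := h k k.2
    obtain ⟨d, rfl⟩ := hφ a
    exact ⟨d, ha.symm⟩
  choose d hd using h'
  let f : _root_.primeClosure P u →+ B := AddMonoidHom.mk' (fun k => d k • v) fun k k' => by
    rw [← add_smul, ← huv, map_add, add_smul, hd, hd, hd, Submodule.coe_add, smul_add]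
  refine .embed _ B hB f ?_ fun c k => ?_
  · rw [injective_iff_map_eq_zero]
    intro k hk
    by_contra hk0
    refine hs (mem_of_smul_eq_zero_of_mem_primeClosure hP k.2
      (fun h0 => hk0 (Subtype.ext h0)) ?_)
    rw [← hd, ← hu, ← Ideal.mem_comap, hv]
    exact hk
  · change d _ • v = c • d k • v
    rw [← mul_smul, ← huv, hd, map_mul, mul_smul, hd, Submodule.coe_smul, smul_comm]

include hφ in
theorem DepthFiltered.of_associatedPrimes {s : ℕ} (hS : HasDepth (S := S) s S)
    (hdim : Module.supportDim S S ≤ s) {M : Type} [AddCommGroup M] [Module R M]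
    [Module.Finite R M] (hM : ∀ P ∈ associatedPrimes R M, ringKrullDim (R ⧸ P) = r) :
    DepthFiltered φ r M := by
  suffices h : ∀ (K : Submodule R M) (N : Type) [AddCommGroup N] [Module R N] (g : M →ₗ[R] N),
      Function.Surjective g → LinearMap.ker g = K →
      (∀ P ∈ associatedPrimes R N, ringKrullDim (R ⧸ P) = r) → DepthFiltered φ r N from
    h _ M LinearMap.id Function.surjective_id rfl hM
  intro K
  induction K using IsNoetherian.induction with
  | _ K ih =>
  rintro N _ _ g hg rfl hN
  obtain _ | _ := subsingleton_or_nontrivial N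
  · exact .torsion _ (Subsingleton.elim _ _)
  have : Module.Finite R N := .of_surjective g hg
  obtain ⟨P, hPN⟩ := associatedPrimes.nonempty R N
  obtain ⟨hp, u, hu⟩ := mem_associatedPrimes_iff.1 hPN
  have hP : ∀ Q ∈ associatedPrimes R N, P ≤ Q → Q = P := by
    intro Q hQ hPQ
    refine le_antisymm (fun x hx => ?_) hPQ
    by_contra hxP
    have h1 := ringKrullDim_quotient_add_one_le hPQ hx hxP
    rw [hN P hPN, hN Q hQ] at h1
    exact absurd (by exact_mod_cast h1 : r + 1 ≤ r) (by omega)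
  have hdimP : ringKrullDim (S ⧸ P.comap φ) = r := by
    rw [← hN P hPN]
    exact ringKrullDim_eq_of_ringEquiv (RingEquiv.ofBijective (Ideal.quotientMap P φ le_rfl)
      ⟨Ideal.quotientMap_injective, Ideal.quotientMap_surjective hφ⟩)
  obtain ⟨B, _, _, _, hB, hPB⟩ := hS.exists_mem_associatedPrimes hdim
    (p := ⟨P.comap φ, inferInstance⟩) (by
      rw [Module.support_of_algebra]
      intro x hx
      rw [show x = 0 from hx]
      exact zero_mem _) hdimP
  have hlt : LinearMap.ker g < (_root_.primeClosure P u).comap g := by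
    refine lt_of_le_of_ne (fun x hx => ?_) fun heq => ?_
    · rw [Submodule.mem_comap, show g x = 0 from hx]
      exact zero_mem _
    · obtain ⟨x, rfl⟩ := hg u
      have h1 : x ∈ (_root_.primeClosure P (g x)).comap g :=
        ⟨fun c hc => (hu c).1 hc, 1, hp.one_notMem, 1, rfl⟩
      rw [← heq] at h1
      exact hp.one_notMem ((hu 1).2 (by rw [show g x = 0 from h1, smul_zero]))
  refine .ext _ N _ (_root_.primeClosure P u).subtype (_root_.primeClosure P u).mkQ
    (Submodule.subtype_injective _) (LinearMap.exact_subtype_mkQ _) (Submodule.mkQ_surjective _)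
    (.primeClosure hφ hu hP hB hPB) (ih _ hlt _ ((_root_.primeClosure P u).mkQ ∘ₗ g)
      ((Submodule.mkQ_surjective _).comp hg) ?_ fun Q hQ =>
        hN Q (associatedPrimes_quotient_primeClosure_subset hP hPN hQ))
  rw [LinearMap.ker_comp, Submodule.ker_mkQ]

end DepthFiltered

end

section Main
open IsLocalRing Pointwise localCohomology

variable {R : Type} [CommRing R] [IsLocalRing R]

omit [IsLocalRing R] in
theorem supportDim_eq_mDim [IsNoetherianRing R] (M : Type) [AddCommGroup M] [Module R M]
    [Module.Finite R M] : Module.supportDim R M = mDim R M := by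
  rw [Module.supportDim_eq_ringKrullDim_quotient_annihilator, mDim, Submodule.annihilator_top]

theorem exists_isCM_surjective
    (hG : ∃ (S : Type) (_ : CommRing S),
      IsGorensteinRing S ∧ ∃ f : S →+* R, Function.Surjective f) :
    ∃ (S : Type) (_ : CommRing S) (_ : IsLocalRing S), IsNoetherianRing S ∧ IsCM S S ∧
      ∃ φ : S →+* R, Function.Surjective φ := by
  obtain ⟨S, _, hS, f, hf⟩ := hG
  let p := (maximalIdeal R).comap f
  obtain ⟨h1, h2, -⟩ := hS.2 p
  have hunit : ∀ y : p.primeCompl, IsUnit (f y) := fun y => by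
    have := y.2
    by_contra hy
    exact this ((mem_maximalIdeal _).2 hy)
  refine ⟨Localization.AtPrime p, inferInstance, inferInstance, h1, h2,
    IsLocalization.lift (M := p.primeCompl) hunit, fun x => ?_⟩
  obtain ⟨s, rfl⟩ := hf x
  exact ⟨algebraMap S _ s, IsLocalization.lift_eq hunit s⟩

theorem powTorsion_eq_bot_of_notMem_associatedPrimes [IsNoetherianRing R] {M : Type}
    [AddCommGroup M] [Module R M] (h : maximalIdeal R ∉ associatedPrimes R M) :
    powTorsion (maximalIdeal R) M = ⊥ := by
  rw [eq_bot_iff]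
  rintro u ⟨t, ht⟩
  by_contra hu
  obtain ⟨Q, hQ, hle⟩ := exists_mem_associatedPrimes_of_ne_zero (R := R) hu
  have hQm : maximalIdeal R ≤ Q := fun a ha =>
    hQ.isPrime.mem_of_pow_mem t (hle _ (ht _ (Ideal.pow_mem_pow ha t)))
  exact h ((maximalIdeal.isMaximal R).eq_of_le hQ.isPrime.ne_top hQm ▸ hQ)

end Main

theorem statement10 (R : Type) [CommRing R] [IsLocalRing R] [IsNoetherianRing R]
    (hG : ∃ (S : Type) (_ : CommRing S),
      IsGorensteinRing S ∧ ∃ f : S →+* R, Function.Surjective f)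
    (M : Type) [AddCommGroup M] [Module R M] [Module.Finite R M]
    (r : ℕ) (hr : mDim R M = (r : ℕ∞)) (hr2 : 2 ≤ r)
    (hass : ∀ p ∈ associatedPrimes R M, ringKrullDim (R ⧸ p) = mDim R M)
    (q : ℕ) (hq : 1 ≤ q)
    (hfin : Set.Finite {a : ℤ | ∃ (x : Fin r → R) (e : ℕ → ℤ),
      (∀ k, x k ∈ (maximalIdeal R) ^ q) ∧
      IsParamIdeal R (Ideal.span (Set.range x)) M r ∧ IsDSeq R x M ∧
      HasHilbCoeffs R (Ideal.span (Set.range x)) M r e ∧ e 1 = a})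
    (ℓ : ℕ)
    (hmin : IsLeast {a : ℤ | ∃ (x : Fin r → R) (e : ℕ → ℤ),
      (∀ k, x k ∈ (maximalIdeal R) ^ q) ∧
      IsParamIdeal R (Ideal.span (Set.range x)) M r ∧ IsDSeq R x M ∧
      HasHilbCoeffs R (Ideal.span (Set.range x)) M r e ∧ e 1 = a} (-(ℓ : ℤ))) :
    (∀ i : ℕ, i ≠ r →
      (maximalIdeal R) ^ ℓ • (⊤ : Submodule R ↥(LC R i M)) = ⊥) ∧
    (∀ i < r, Module.Finite R ↥(LC R i M)) := by
  obtain ⟨n, rfl⟩ := Nat.exists_eq_add_of_le' hr2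
  obtain ⟨S, _, _, _, ⟨rs, hrsm, hrs, hlen⟩, φ, hφ⟩ := exists_isCM_surjective hG
  have hle : (genericFilter S).map φ ≤ genericFilter R := tendsto_genericFilter φ hφ
  have hS : HasDepth (S := S) rs.length S := .of_isWeaklyRegular hrsm hrs.toIsWeaklyRegular
  have hdS : Module.supportDim S S ≤ rs.length := by rw [supportDim_eq_mDim, hlen]
  have hd : Module.supportDim R M = (n + 2 : ℕ) := (supportDim_eq_mDim M).trans hr
  have hG' : HasTorsionBounds ((genericFilter S).map φ) n M :=
    DepthFiltered.hasTorsionBounds hφ n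
      (.of_associatedPrimes hφ hS hdS fun P hP => (hass P hP).trans hr)
  have hT : TorsionBound ((genericFilter S).map φ) ℓ n M :=
    torsionBound_of_forall_isHilbDSeq hle ℓ n M hd.le (hle (eventually_mem_pow q))
      fun x e hx h => hmin.2 ⟨x, e, hx, h.isParamIdeal, h.isDSeq, h.hasHilbCoeffs, rfl⟩
  have hW : powTorsion (maximalIdeal R) M = ⊥ := by
    refine powTorsion_eq_bot_of_notMem_associatedPrimes fun h => ?_
    have h1 := (hass _ h).trans hr
    have : IsField (R ⧸ maximalIdeal R) := (Ideal.Quotient.maximal_ideal_iff_isField_quotient _).1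
      (maximalIdeal.isMaximal R)
    rw [ringKrullDim_eq_zero_of_isField this] at h1
    exact absurd (by exact_mod_cast h1 : 0 = n + 2) (by omega)
  have hmain := fun i hi => localCohomology.finite_and_smul_eq_zero hle ℓ n M hT hG' i hi
  refine ⟨fun i hi => ?_, fun i hi => (hmain i hi).1⟩
  rw [eq_bot_iff]
  refine Submodule.smul_le.2 fun c hc z _ => (Submodule.mem_bot R).2 ?_
  obtain hlt | hgt := lt_or_gt_of_ne hi
  · obtain rfl | hi0 := eq_or_ne i 0
    · have h0 : localCohomology.zeroEquiv (maximalIdeal R) M z = 0 :=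
        Subtype.ext ((Submodule.mem_bot R).1
          (hW ▸ (localCohomology.zeroEquiv (maximalIdeal R) M z).2))
      have : z = 0 := (LinearEquiv.map_eq_zero_iff _).1 h0
      rw [this, smul_zero]
    · exact (hmain i hlt).2 hi0 c hc z
  · have : z = 0 := localCohomology.eq_zero_of_supportDim_lt (n + 2) hgt hd.le z
    rw [this, smul_zero]
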